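/- Let L be a differential field extension of ℂ(t) with derivation D, let K be a differential subfield of L, let n ≥ 1, and let y₁, …, yₙ ∈ L be pairwise distinct solutions of the first Painlevé equation y'' = 6y² + t such that no yᵢ is algebraic over K. Then the 2n elements y₁, y₁', y₂, y₂', …, yₙ, yₙ' are algebraically independent over K. (Nishioka's theorem, Fact 3.3; it yields the ω-categoricity and disintegratedness of P_I asserted in Proposition 3.1.) -/

import Mathlib

section

open TensorProduct

theorem Derivation.exists_extend_of_formallyEtale {A B : Type*} [CommRing A] [CommRing B]
    [Algebra A B] [Algebra.FormallyEtale A B] (d : Derivation ℤ A B) :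
    ∃ d' : Derivation ℤ B B, ∀ a, d' (algebraMap A B a) = d a := by
  let l : B ⊗[A] Ω[A⁄ℤ] →ₗ[B] B := d.liftKaehlerDifferential.liftBaseChange B
  let e := KaehlerDifferential.tensorKaehlerEquivOfFormallyEtale ℤ A B
  refine ⟨(l ∘ₗ e.symm.toLinearMap).compDer (KaehlerDifferential.D ℤ B), fun a => ?_⟩
  have h := KaehlerDifferential.tensorKaehlerEquivOfFormallyEtale_symm_D_algebraMap ℤ A B a
  change l (e.symm (KaehlerDifferential.D ℤ B (algebraMap A B a))) = d a
  rw [h]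
  simp [l]

theorem Derivation.exists_mvPolynomial {K F σ : Type*} [CommRing K] [CommRing F] [Algebra K F]
    (δ : Derivation ℤ K F) (x a : σ → F) :
    ∃ d : MvPolynomial σ K →+ F,
      (∀ p q, d (p * q) = MvPolynomial.aeval x p * d q + MvPolynomial.aeval x q * d p) ∧
      (∀ c, d (MvPolynomial.C c) = δ c) ∧ ∀ i, d (MvPolynomial.X i) = a i := by
  let f : K →+* TrivSqZeroExt F F :=
    { toFun := fun c => TrivSqZeroExt.inl (algebraMap K F c) + TrivSqZeroExt.inr (δ c)
      map_one' := by ext <;> simp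
      map_mul' := fun c e => by
        ext
        · simp
        · simp only [map_mul, Derivation.leibniz]
          simp [Algebra.smul_def c (δ e), Algebra.smul_def e (δ c), mul_comm]
      map_zero' := by ext <;> simp
      map_add' := fun c e => by ext <;> simp }
  let g : MvPolynomial σ K →+* TrivSqZeroExt F F :=
    MvPolynomial.eval₂Hom f (fun i => TrivSqZeroExt.inl (x i) + TrivSqZeroExt.inr (a i))
  have hg : ∀ p, (g p).fst = MvPolynomial.aeval x p := by
    intro p
    have : (TrivSqZeroExt.fstHom F F F).toRingHom.comp g
        = (MvPolynomial.aeval (R := K) x).toRingHom := by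
      ext i
      · simp [g, f]
      · simp [g]
    exact congrArg (fun h => h p) this
  refine ⟨⟨⟨fun p => (g p).snd, by simp⟩, fun p q => by simp⟩, ?_, ?_, ?_⟩
  · intro p q
    change (g (p * q)).snd = MvPolynomial.aeval x p * (g q).snd + MvPolynomial.aeval x q * (g p).snd
    rw [map_mul, TrivSqZeroExt.snd_mul, hg, hg]
    simp [mul_comm]
  · intro c
    change (g (MvPolynomial.C c)).snd = _
    simp [g, f]
  · intro i
    change (g (MvPolynomial.X i)).snd = _
    simp [g]

/-- A derivation of the base field extends, with prescribed values on a transcendence basis. -/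
theorem Derivation.exists_extend {K F σ : Type*} [Field K] [CharZero K] [Field F] [Algebra K F]
    (δ : Derivation ℤ K F) {x : σ → F} (hx : IsTranscendenceBasis K x) (a : σ → F) :
    ∃ d : Derivation ℤ F F, (∀ c, d (algebraMap K F c) = δ c) ∧ ∀ i, d (x i) = a i := by
  let : Algebra (MvPolynomial σ K) F := (MvPolynomial.aeval (R := K) x).toRingHom.toAlgebra
  have hmap : ∀ p, algebraMap (MvPolynomial σ K) F p = MvPolynomial.aeval x p := fun _ => rfl
  have hinj : Function.Injective (algebraMap (MvPolynomial σ K) F) := hx.1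
  have : FaithfulSMul (MvPolynomial σ K) F := (faithfulSMul_iff_algebraMap_injective _ _).2 hinj
  have : IsScalarTower K (MvPolynomial σ K) F :=
    IsScalarTower.of_algebraMap_eq fun c => by rw [hmap]; simp
  have halg : Algebra.IsAlgebraic (MvPolynomial σ K) F := by
    have h0 := hx.isAlgebraic
    refine ⟨fun z => ?_⟩
    obtain ⟨p, hp0, hp⟩ := h0.1 z
    let ψ : Algebra.adjoin K (Set.range x) →+* MvPolynomial σ K :=
      hx.1.aevalEquiv.symm.toAlgHom.toRingHom
    have hψinj : Function.Injective ψ := hx.1.aevalEquiv.symm.injective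
    refine ⟨p.map ψ, (Polynomial.map_ne_zero_iff hψinj).2 hp0, ?_⟩
    rw [← hp, Polynomial.aeval_def, Polynomial.eval₂_map, Polynomial.aeval_def]
    congr 1
    ext y
    change MvPolynomial.aeval x (hx.1.aevalEquiv.symm y) = (y : F)
    rw [← hx.1.algebraMap_aevalEquiv]
    simp
  have : CharZero F := charZero_of_injective_algebraMap (algebraMap K F).injective
  obtain ⟨d₀, hdmul, hdC, hdX⟩ := Derivation.exists_mvPolynomial δ x a
  let d : Derivation ℤ (MvPolynomial σ K) F := Derivation.mk' d₀.toIntLinearMap fun p q => by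
    simp only [Algebra.smul_def, hmap]
    exact hdmul p q
  have hd : ∀ p, d p = d₀ p := fun _ => rfl
  let : Algebra (FractionRing (MvPolynomial σ K)) F := FractionRing.liftAlgebra _ _
  have : IsScalarTower (MvPolynomial σ K) (FractionRing (MvPolynomial σ K)) F :=
    FractionRing.isScalarTower_liftAlgebra _ _
  have : Algebra.IsAlgebraic (FractionRing (MvPolynomial σ K)) F :=
    ⟨fun z => (IsFractionRing.isAlgebraic_iff (MvPolynomial σ K)
      (FractionRing (MvPolynomial σ K)) F).1 (halg.1 z)⟩
  have : CharZero (FractionRing (MvPolynomial σ K)) := 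
    charZero_of_injective_algebraMap (IsFractionRing.injective (MvPolynomial σ K) _)
  have : Algebra.IsSeparable (FractionRing (MvPolynomial σ K)) F :=
    Algebra.IsAlgebraic.isSeparable_of_perfectField
  have := Algebra.FormallyEtale.of_isSeparable (FractionRing (MvPolynomial σ K)) F
  have : Algebra.FormallyEtale (MvPolynomial σ K) (FractionRing (MvPolynomial σ K)) :=
    Algebra.FormallyEtale.of_isLocalization (nonZeroDivisors (MvPolynomial σ K))
  have : Algebra.FormallyEtale (MvPolynomial σ K) F :=
    Algebra.FormallyEtale.comp _ (FractionRing (MvPolynomial σ K)) F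
  obtain ⟨d', hd'⟩ := Derivation.exists_extend_of_formallyEtale d
  refine ⟨d', fun c => ?_, fun i => ?_⟩
  · have := (hd' (MvPolynomial.C c)).trans ((hd _).trans (hdC c))
    rwa [hmap, MvPolynomial.aeval_C] at this
  · have := (hd' (MvPolynomial.X i)).trans ((hd _).trans (hdX i))
    rwa [hmap, MvPolynomial.aeval_X] at this

theorem Derivation.map_aeval_of_kills {R F : Type*} [CommRing R] [CommRing F] [Algebra R F]
    (d : Derivation ℤ F F) (hd : ∀ r, d (algebraMap R F r) = 0) (a : F) (p : Polynomial R) :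
    d (Polynomial.aeval a p) = Polynomial.aeval a (Polynomial.derivative p) * d a := by
  induction p using Polynomial.induction_on' with
  | add p q hp hq => simp [hp, hq, add_mul]
  | monomial n r =>
    simp [Polynomial.aeval_monomial, hd, Polynomial.derivative_monomial, Derivation.leibniz_pow]
    ring

/-- A derivation killing `R` kills everything algebraic over `R`. -/
theorem Derivation.eq_zero_of_isAlgebraic {R F : Type*} [CommRing R] [Field F]
    [CharZero F] [Algebra R F] [FaithfulSMul R F] (d : Derivation ℤ F F)
    (hd : ∀ r, d (algebraMap R F r) = 0) {a : F} (ha : IsAlgebraic R a) : d a = 0 := by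
  by_contra h0
  have hinj : Function.Injective (algebraMap R F) := FaithfulSMul.algebraMap_injective R F
  have : IsDomain R := hinj.isDomain
  have : CharZero R := (algebraMap R F).charZero
  have key : ∀ n : ℕ, ∀ p : Polynomial R, p.natDegree = n → Polynomial.aeval a p = 0 → p = 0 := by
    intro n
    induction n with
    | zero =>
      intro p hp h
      rw [Polynomial.eq_C_of_natDegree_eq_zero hp] at h ⊢
      simp only [Polynomial.aeval_C] at h
      rw [(map_eq_zero_iff _ hinj).1 h, map_zero]
    | succ n ih =>
      intro p hp h
      have h1 := d.map_aeval_of_kills hd a p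
      rw [h, map_zero] at h1
      have h2 := (mul_eq_zero.1 h1.symm).resolve_right h0
      have h3 := ih p.derivative (by rw [Polynomial.natDegree_derivative, hp]; rfl) h2
      have h4 := Polynomial.derivative_eq_zero.1 h3
      rw [h4] at hp
      simp at hp
  obtain ⟨p, hp0, hp⟩ := ha
  exact hp0 (key _ p rfl hp)

/-- Two derivations of `F` into itself agreeing on `R` agree on all elements algebraic over `R`. -/
theorem Derivation.eq_of_isAlgebraic {R F : Type*} [CommRing R] [Field F]
    [CharZero F] [Algebra R F] [FaithfulSMul R F] (d e : Derivation ℤ F F)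
    (h : ∀ r, d (algebraMap R F r) = e (algebraMap R F r)) {a : F} (ha : IsAlgebraic R a) :
    d a = e a := by
  have := (d - e).eq_zero_of_isAlgebraic (fun r => by simp [h]) ha
  simpa [sub_eq_zero] using this

theorem Derivation.map_ofNat_eq_zero {R : Type*} [CommRing R] (d : Derivation ℤ R R) (n : ℕ)
    [n.AtLeastTwo] : d ofNat(n) = 0 := by
  have := d.map_natCast n; rwa [← Nat.cast_ofNat]

end

theorem PowerSeries.exists_monic_dvd {k : Type*} [Field k] (F : Polynomial (PowerSeries k)) (m : ℕ)
    (hm : constantCoeff (F.coeff m) ≠ 0)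
    (hlt : ∀ j < m, constantCoeff (F.coeff j) = 0) :
    ∃ g : Polynomial (PowerSeries k), g.Monic ∧ g.natDegree = m ∧ g ∣ F := by
  have hmax : IsLocalRing.maximalIdeal (PowerSeries k) = Ideal.span {PowerSeries.X} :=
    PowerSeries.maximalIdeal_eq_span_X
  have : IsAdicComplete (IsLocalRing.maximalIdeal (PowerSeries k)) (PowerSeries k) := by
    rw [hmax]; infer_instance
  have hres : ∀ a : PowerSeries k, IsLocalRing.residue _ a = 0 ↔ constantCoeff a = 0 := by
    intro a
    rw [IsLocalRing.residue_eq_zero_iff, hmax, Ideal.mem_span_singleton, PowerSeries.X_dvd_iff]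
  have hord : ((F : PowerSeries (PowerSeries k)).map (IsLocalRing.residue _)).order = m := by
    rw [PowerSeries.order_eq_nat]
    constructor
    · rw [PowerSeries.coeff_map, Polynomial.coeff_coe]
      exact fun h => hm ((hres _).1 h)
    · intro j hj
      rw [PowerSeries.coeff_map, Polynomial.coeff_coe]
      exact (hres _).2 (hlt j hj)
  have hne : (F : PowerSeries (PowerSeries k)).map (IsLocalRing.residue _) ≠ 0 := by
    intro h
    rw [h, PowerSeries.order_zero] at hord
    exact ENat.top_ne_natCast m hord
  obtain ⟨g, h, H⟩ := PowerSeries.exists_isWeierstrassFactorization hne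
  have hg := H.isDistinguishedAt
  have hdeg : g.natDegree = m := by rw [H.natDegree_eq_toNat_order_map, hord]; rfl
  refine ⟨g, hg.monic, hdeg, ?_⟩
  rw [← Polynomial.modByMonic_eq_zero_iff_dvd hg.monic]
  have hI : IsLocalRing.maximalIdeal (PowerSeries k) ≠ ⊤ := Ideal.IsMaximal.ne_top inferInstance
  have hd := hg.isWeierstrassDivisorAt hI
  have hgo0 := hg.coe_natDegree_eq_order_map (g : PowerSeries (PowerSeries k)) 1
    (by rwa [PowerSeries.constantCoeff_one, ← Ideal.ne_top_iff_one]) (by simp)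
  have hgo : g.natDegree = ((g : PowerSeries (PowerSeries k)).map
      (Ideal.Quotient.mk (IsLocalRing.maximalIdeal (PowerSeries k)))).order.toNat := by
    simpa using congrArg ENat.toNat hgo0
  refine (hd.eq_of_mul_add_eq_mul_add (q := ((F /ₘ g : Polynomial _) : PowerSeries _)) (q' := h)
    (r := F %ₘ g) (r' := 0) ?_ ?_ ?_).2
  · rw [← hgo, ← Polynomial.degree_eq_natDegree hg.monic.ne_zero]
    exact Polynomial.degree_modByMonic_lt _ hg.monic
  · simp
  · rw [← Polynomial.coe_mul, ← Polynomial.coe_add, add_comm, Polynomial.modByMonic_add_div F g,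
      H.eq_mul]
    simp

namespace HahnSeries

variable {Γ k : Type*}

/-- The part of a Hahn series supported in a given set of exponents. -/
noncomputable def restrict [PartialOrder Γ] [Zero k] (S : Set Γ) (x : HahnSeries Γ k) :
    HahnSeries Γ k :=
  open Classical in ⟨fun i => if i ∈ S then x.coeff i else 0,
    x.isPWO_support.mono fun i hi => by
      simp only [Function.mem_support, ne_eq, ite_eq_right_iff, Classical.not_imp] at hi
      exact hi.2⟩

theorem coeff_restrict_of_mem [PartialOrder Γ] [Zero k] {S : Set Γ} (x : HahnSeries Γ k) {i : Γ}
    (hi : i ∈ S) : (x.restrict S).coeff i = x.coeff i := by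
  classical
  simp [restrict, hi]

theorem coeff_restrict_of_notMem [PartialOrder Γ] [Zero k] {S : Set Γ} (x : HahnSeries Γ k) {i : Γ}
    (hi : i ∉ S) : (x.restrict S).coeff i = 0 := by
  classical
  simp [restrict, hi]

theorem support_restrict_subset [PartialOrder Γ] [Zero k] {S : Set Γ} (x : HahnSeries Γ k) :
    (x.restrict S).support ⊆ x.support := by
  classical
  intro i hi
  simp [restrict] at hi
  exact hi.2

variable [AddCommGroup Γ] [LinearOrder Γ] [IsOrderedAddMonoid Γ] [Field k]

theorem restrict_mul_of_support_subset (G : AddSubgroup Γ) (x y : HahnSeries Γ k)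
    (hx : x.support ⊆ G) : (x * y).restrict (G : Set Γ) = x * y.restrict (G : Set Γ) := by
  ext i
  rw [coeff_mul_right' y.isPWO_support (support_restrict_subset y)]
  by_cases hi : i ∈ (G : Set Γ)
  · rw [coeff_restrict_of_mem _ hi, coeff_mul]
    refine Finset.sum_congr rfl fun p hp => ?_
    rw [Finset.mem_antidiagonal] at hp
    have h1 := hx hp.1
    have h2 : p.2 ∈ G := by
      have : p.2 = i - p.1 := by rw [← hp.2.2]; abel
      rw [this]; exact G.sub_mem hi h1
    rw [coeff_restrict_of_mem _ h2]
  · rw [coeff_restrict_of_notMem _ hi]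
    symm
    refine Finset.sum_eq_zero fun p hp => ?_
    rw [Finset.mem_antidiagonal] at hp
    have h1 := hx hp.1
    rw [coeff_restrict_of_notMem, mul_zero]
    intro h2
    apply hi
    rw [← hp.2.2]; exact G.add_mem h1 h2

/-- Hahn series with exponents in a subgroup. -/
def supportedIn (k : Type*) [Field k] (G : AddSubgroup Γ) : Subfield (HahnSeries Γ k) where
  carrier := {x | x.support ⊆ G}
  mul_mem' := fun {x y} hx hy i hi => by
    obtain ⟨a, ha, b, hb, rfl⟩ := support_mul_subset hi
    exact G.add_mem (hx ha) (hy hb)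
  one_mem' := fun i hi => by
    have : i = 0 := eq_of_mem_support_single hi
    rw [this]; exact G.zero_mem
  add_mem' := fun {x y} hx hy i hi =>
    (support_add_subset _ _ hi).elim (fun h => hx h) (fun h => hy h)
  zero_mem' := by simp
  neg_mem' := fun {x} hx => by simpa using hx
  inv_mem' := fun x hx => by
    by_cases h0 : x = 0
    · simp [h0]
    have h1 := restrict_mul_of_support_subset G x x⁻¹ hx
    have h2 : (1 : HahnSeries Γ k).restrict (G : Set Γ) = 1 := by
      ext i
      by_cases hi : i ∈ (G : Set Γ)
      · rw [coeff_restrict_of_mem _ hi]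
      · rw [coeff_restrict_of_notMem _ hi, coeff_one, if_neg]
        rintro rfl
        exact hi G.zero_mem
    rw [mul_inv_cancel₀ h0, h2] at h1
    have h3 : x⁻¹ = x⁻¹.restrict (G : Set Γ) := by
      exact inv_eq_of_mul_eq_one_right h1.symm
    intro i hi
    by_contra h
    apply hi
    change (x⁻¹).coeff i = 0
    rw [h3, coeff_restrict_of_notMem _ h]

theorem mem_supportedIn {G : AddSubgroup Γ} {x : HahnSeries Γ k} :
    x ∈ supportedIn k G ↔ ∀ i, x.coeff i ≠ 0 → i ∈ G :=
  ⟨fun h _ hi => h hi, fun h _ hi => h _ hi⟩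

end HahnSeries

namespace HahnSeries

variable {k : Type*} [Field k]

theorem mem_zmultiples_one_div {N : ℕ} (_hN : 0 < N) {q : ℚ} :
    q ∈ AddSubgroup.zmultiples (1 / (N : ℚ)) ↔ ∃ m : ℤ, q = m / N := by
  rw [AddSubgroup.mem_zmultiples_iff]
  constructor
  · rintro ⟨m, rfl⟩; exact ⟨m, by simp [div_eq_mul_inv]⟩
  · rintro ⟨m, rfl⟩; exact ⟨m, by simp [div_eq_mul_inv]⟩

theorem supportedIn_mono_of_dvd {N M : ℕ} (hM : 0 < M) (h : N ∣ M) :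
    supportedIn k (AddSubgroup.zmultiples (1 / (N : ℚ))) ≤
      supportedIn k (AddSubgroup.zmultiples (1 / (M : ℚ))) := by
  intro x hx i hi
  have := hx hi
  obtain ⟨c, rfl⟩ := h
  have hN : 0 < N := Nat.pos_of_mul_pos_right hM
  have hc : 0 < c := Nat.pos_of_mul_pos_left hM
  rw [SetLike.mem_coe, mem_zmultiples_one_div hN] at this
  rw [SetLike.mem_coe, mem_zmultiples_one_div hM]
  obtain ⟨m, rfl⟩ := this
  refine ⟨m * c, ?_⟩
  push_cast
  field_simp

/-- The field of Puiseux series, inside Hahn series with rational exponents. -/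
def puiseux (k : Type*) [Field k] : Subfield (HahnSeries ℚ k) where
  carrier := {x | ∃ N : ℕ, 0 < N ∧ x ∈ supportedIn k (AddSubgroup.zmultiples (1 / (N : ℚ)))}
  mul_mem' := by
    rintro x y ⟨N, hN, hx⟩ ⟨M, hM, hy⟩
    exact ⟨N * M, by positivity, mul_mem (supportedIn_mono_of_dvd (by positivity) ⟨M, rfl⟩ hx)
      (supportedIn_mono_of_dvd (by positivity) ⟨N, mul_comm _ _⟩ hy)⟩
  one_mem' := ⟨1, one_pos, one_mem _⟩
  add_mem' := by
    rintro x y ⟨N, hN, hx⟩ ⟨M, hM, hy⟩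
    exact ⟨N * M, by positivity, add_mem (supportedIn_mono_of_dvd (by positivity) ⟨M, rfl⟩ hx)
      (supportedIn_mono_of_dvd (by positivity) ⟨N, mul_comm _ _⟩ hy)⟩
  zero_mem' := ⟨1, one_pos, zero_mem _⟩
  neg_mem' := by
    rintro x ⟨N, hN, hx⟩
    exact ⟨N, hN, neg_mem hx⟩
  inv_mem' := by
    rintro x ⟨N, hN, hx⟩
    exact ⟨N, hN, inv_mem hx⟩

theorem single_mem_puiseux (q : ℚ) (a : k) : single q a ∈ puiseux k := by
  refine ⟨q.den, q.den_pos, fun i hi => ?_⟩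
  rw [eq_of_mem_support_single hi, SetLike.mem_coe, mem_zmultiples_one_div q.den_pos]
  exact ⟨q.num, (Rat.num_div_den q).symm⟩

theorem exists_common_denominator {n : ℕ} (x : Fin n → puiseux k) :
    ∃ N : ℕ, 0 < N ∧ ∀ i,
      (x i : HahnSeries ℚ k) ∈ supportedIn k (AddSubgroup.zmultiples (1 / (N : ℚ))) := by
  choose N hN hx using fun i => (x i).2
  exact ⟨∏ i, N i, Finset.prod_pos fun i _ => hN i, fun i =>
    supportedIn_mono_of_dvd (Finset.prod_pos fun i _ => hN i)
      (Finset.dvd_prod_of_mem _ (Finset.mem_univ i)) (hx i)⟩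

/-- Substitution of the `N`-th root of the variable in a power series. -/
noncomputable def rootSubst (k : Type*) [Field k] {N : ℕ} (hN : 0 < N) :
    PowerSeries k →+* HahnSeries ℚ k :=
  (embDomainRingHom (Γ := ℕ) (Γ' := ℚ)
    { toFun := fun m => (m : ℚ) / N
      map_zero' := by simp
      map_add' := fun a b => by push_cast; ring }
    (fun a b h => by
      have : (N : ℚ) ≠ 0 := by positivity
      simpa [div_left_inj' this] using h)
    (fun a b => by
      change (a : ℚ) / N ≤ (b : ℚ) / N ↔ a ≤ b
      rw [div_le_div_iff_of_pos_right (by positivity)]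
      exact Nat.cast_le)).comp toPowerSeries.symm.toRingHom

theorem coeff_rootSubst {N : ℕ} (hN : 0 < N) (f : PowerSeries k) (m : ℕ) :
    (rootSubst k hN f).coeff ((m : ℚ) / N) = PowerSeries.coeff m f := by
  rw [← coeff_toPowerSeries_symm]
  exact embDomain_coeff (a := m)

theorem coeff_rootSubst_of_notMem {N : ℕ} (hN : 0 < N) (f : PowerSeries k) {q : ℚ}
    (hq : ∀ m : ℕ, q ≠ (m : ℚ) / N) : (rootSubst k hN f).coeff q = 0 :=
  embDomain_of_notMem_range (by rintro ⟨m, rfl⟩; exact hq m rfl)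

theorem rootSubst_mem_puiseux {N : ℕ} (hN : 0 < N) (f : PowerSeries k) :
    rootSubst k hN f ∈ puiseux k := by
  refine ⟨N, hN, fun q hq => ?_⟩
  rw [SetLike.mem_coe, mem_zmultiples_one_div hN]
  by_contra! h
  exact hq (coeff_rootSubst_of_notMem hN f fun m => by simpa using h m)

theorem exists_rootSubst_eq {N : ℕ} (hN : 0 < N) {x : HahnSeries ℚ k}
    (hx : x ∈ supportedIn k (AddSubgroup.zmultiples (1 / (N : ℚ)))) (h0 : ∀ q < 0, x.coeff q = 0) :
    ∃ f, rootSubst k hN f = x := by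
  refine ⟨PowerSeries.mk fun m => x.coeff ((m : ℚ) / N), ?_⟩
  ext q
  by_cases h : ∃ m : ℕ, q = (m : ℚ) / N
  · obtain ⟨m, rfl⟩ := h
    rw [coeff_rootSubst, PowerSeries.coeff_mk]
  · push Not at h
    rw [coeff_rootSubst_of_notMem hN _ h]
    by_contra hne
    obtain ⟨m, rfl⟩ := (mem_zmultiples_one_div hN).1 (hx (Ne.symm hne))
    have hm : 0 ≤ m := by
      by_contra! hm
      refine hne (h0 _ ?_).symm
      exact div_neg_of_neg_of_pos (by exact_mod_cast hm) (by positivity)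
    lift m to ℕ using hm
    exact h m rfl

open Polynomial in
theorem exists_root_puiseux [IsAlgClosed k] [CharZero k] (n : ℕ) :
    ∀ f : Polynomial (puiseux k), f.Monic → f.natDegree = n → 0 < n → ∃ a, f.eval a = 0 := by
  induction n using Nat.strong_induction_on with
  | _ n ih =>
  intro f hf hfn hn
  have hchar : CharZero (puiseux k) := by
    have : CharZero (HahnSeries ℚ k) :=
      ((C (Γ := ℚ) (R := k)).charZero_iff C_injective).1 inferInstance
    exact ((puiseux k).subtype.charZero_iff (puiseux k).subtype.injective).2 this
  classical
  -- kill the subleading coefficient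
  have tay : ∀ {R : Type _} [CommRing R] (p : Polynomial R) (r : R), p.Monic → p.natDegree = n →
      (taylor r p).coeff (n - 1) = p.coeff (n - 1) + n * r := by
    intro R _ p r hp hpn
    have h1 : (hasseDeriv (n - 1) p).natDegree < 2 := by
      have := natDegree_hasseDeriv_le p (n - 1)
      omega
    rw [taylor_coeff, eval_eq_sum_range' h1, Finset.sum_range_succ, Finset.sum_range_one,
      hasseDeriv_coeff, hasseDeriv_coeff]
    have h2 : 1 + (n - 1) = n := by omega
    rw [h2, zero_add, Nat.choose_self]
    have h3 : n.choose (n - 1) = n := by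
      rw [← Nat.choose_symm (by omega : n - 1 ≤ n), show n - (n - 1) = 1 by omega]; simp
    have h4 : p.coeff n = 1 := by rw [← hpn]; exact hp
    rw [h3, h4]; simp
  set f₁ := taylor (-(f.coeff (n - 1) / n)) f with hf₁
  suffices ∃ a, f₁.eval a = 0 by
    obtain ⟨a, ha⟩ := this
    exact ⟨_, by rw [← ha, hf₁, taylor_eval]⟩
  have hf₁m : f₁.Monic := hf.comp_X_add_C _
  have hf₁n : f₁.natDegree = n := by rw [hf₁, natDegree_taylor, hfn]
  have hf₁s : f₁.coeff (n - 1) = 0 := by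
    rw [hf₁, tay f _ hf hfn]
    have : (n : puiseux k) ≠ 0 := by exact_mod_cast hn.ne'
    field_simp; ring
  by_cases hall : ∀ i < n, f₁.coeff i = 0
  · refine ⟨0, ?_⟩
    rw [← coeff_zero_eq_eval_zero]; exact hall 0 hn
  push Not at hall
  obtain ⟨i₁, hi₁, hi₁0⟩ := hall
  -- rescale so that all coefficients are integral and one of them is a unit
  let v : ℕ → ℚ := fun i => (f₁.coeff i : HahnSeries ℚ k).order / ((n : ℚ) - i)
  obtain ⟨i₀, hi₀, hmin⟩ := Finset.exists_min_image
    ((Finset.range n).filter fun i => f₁.coeff i ≠ 0) v ⟨i₁, by simp [hi₁, hi₁0]⟩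
  simp only [Finset.mem_filter, Finset.mem_range] at hi₀ hmin
  set s : puiseux k := ⟨single (-(v i₀)) 1, single_mem_puiseux _ _⟩ with hs
  have hs0 : s ≠ 0 := by
    intro h
    have := congrArg (fun z : puiseux k => (z : HahnSeries ℚ k)) h
    exact one_ne_zero (single_eq_zero_iff.1 this)
  set f₂ := scaleRoots f₁ s with hf₂
  suffices ∃ a, f₂.eval a = 0 by
    obtain ⟨a, ha⟩ := this
    refine ⟨a / s, ?_⟩
    have h := scaleRoots_eval_mul f₁ (a / s) s
    rw [mul_div_cancel₀ _ hs0, ← hf₂, ha] at h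
    exact (mul_eq_zero.1 h.symm).resolve_left (pow_ne_zero _ hs0)
  have hf₂m : f₂.Monic := (monic_scaleRoots_iff s).2 hf₁m
  have hf₂n : f₂.natDegree = n := by rw [hf₂, natDegree_scaleRoots, hf₁n]
  have hcoef : ∀ i q, (f₂.coeff i : HahnSeries ℚ k).coeff q =
      (f₁.coeff i : HahnSeries ℚ k).coeff (q + (n - i : ℕ) * v i₀) := by
    intro i q
    rw [hf₂, coeff_scaleRoots, hf₁n, hs]
    push_cast
    rw [single_pow, one_pow, coeff_mul_single, mul_one]
    congr 1
    simp
  have hf₂s : f₂.coeff (n - 1) = 0 := by rw [hf₂, coeff_scaleRoots, hf₁s, zero_mul]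
  have hintegral : ∀ i, ∀ q < 0, (f₂.coeff i : HahnSeries ℚ k).coeff q = 0 := by
    intro i q hq
    rcases lt_trichotomy i n with h | h | h
    · rw [hcoef]
      by_cases h0 : f₁.coeff i = 0
      · simp [h0]
      apply coeff_eq_zero_of_lt_order
      have h1 := hmin i ⟨h, h0⟩
      have h2 : (0 : ℚ) < (n : ℚ) - i := by
        have : (i : ℚ) < n := by exact_mod_cast h
        linarith
      have h3 : (f₁.coeff i : HahnSeries ℚ k).order = v i * ((n : ℚ) - i) := by
        simp only [v]; field_simp
      rw [h3, Nat.cast_sub h.le]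
      nlinarith
    · have : f₂.coeff i = 1 := by rw [h, ← hf₂n]; exact hf₂m
      rw [this]
      simp [coeff_one, hq.ne]
    · rw [coeff_eq_zero_of_natDegree_lt (by omega)]; simp
  have hunit : (f₂.coeff i₀ : HahnSeries ℚ k).coeff 0 ≠ 0 := by
    rw [hcoef, zero_add]
    have h2 : (n : ℚ) - i₀ ≠ 0 := by
      have : (i₀ : ℚ) < n := by exact_mod_cast hi₀.1
      linarith
    have h3 : ((n - i₀ : ℕ) : ℚ) * v i₀ = (f₁.coeff i₀ : HahnSeries ℚ k).order := by
      rw [Nat.cast_sub hi₀.1.le]; simp only [v]; field_simp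
    rw [h3]
    intro h
    rw [coeff_order_eq_zero] at h
    exact hi₀.2 (Subtype.ext h)
  -- transport to power series
  obtain ⟨N, hN, hNf⟩ := exists_common_denominator fun i : Fin (n + 1) => f₂.coeff i
  have hlift : ∀ i, ∃ a, rootSubst k hN a = (f₂.coeff i : HahnSeries ℚ k) := by
    intro i
    by_cases h : i < n + 1
    · exact exists_rootSubst_eq hN (hNf ⟨i, h⟩) (hintegral i)
    · exact ⟨0, by rw [coeff_eq_zero_of_natDegree_lt (by omega)]; simp⟩
  let e : PowerSeries k →+* puiseux k :=
    (rootSubst k hN).codRestrict (puiseux k) (rootSubst_mem_puiseux hN)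
  have he0 : ∀ a, (e a : HahnSeries ℚ k).coeff 0 = PowerSeries.constantCoeff a := by
    intro a
    have := coeff_rootSubst hN a 0
    simp only [Nat.cast_zero, zero_div] at this
    exact this.trans (by simp)
  obtain ⟨F, hF, hFdeg, hFm⟩ : ∃ F : Polynomial (PowerSeries k), F.map e = f₂ ∧
      F.natDegree = n ∧ F.Monic := by
    have hl : f₂ ∈ lifts e := by
      rw [lifts_iff_coeff_lifts]
      intro i
      obtain ⟨a, ha⟩ := hlift i
      exact ⟨a, Subtype.ext ha⟩
    obtain ⟨F, hF1, hF2, hF3⟩ := lifts_and_natDegree_eq_and_monic hl hf₂m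
    exact ⟨F, hF1, by rw [hF2, hf₂n], hF3⟩
  have hFc : ∀ i, PowerSeries.constantCoeff (F.coeff i) =
      (f₂.coeff i : HahnSeries ℚ k).coeff 0 := by
    intro i; rw [← he0, ← hF, coeff_map]
  set F₀ := F.map (PowerSeries.constantCoeff (R := k)) with hF₀
  have hF₀m : F₀.Monic := hFm.map _
  have hF₀n : F₀.natDegree = n := by rw [hF₀, hFm.natDegree_map, hFdeg]
  obtain ⟨c, hc⟩ := IsAlgClosed.exists_root F₀ (by
    rw [degree_eq_natDegree hF₀m.ne_zero, hF₀n]; exact_mod_cast hn.ne')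
  set F₁ := taylor (PowerSeries.C c) F with hF₁
  have hF₁0 : F₁.map (PowerSeries.constantCoeff (R := k)) = taylor c F₀ := by
    rw [hF₁, hF₀, taylor_apply, taylor_apply, Polynomial.map_comp]; simp
  have hcc : ∀ j, PowerSeries.constantCoeff (F₁.coeff j) = (taylor c F₀).coeff j := by
    intro j; rw [← hF₁0, coeff_map]
  have hex : ∃ j, j < n ∧ PowerSeries.constantCoeff (F₁.coeff j) ≠ 0 := by
    by_cases hc0 : c = 0
    · refine ⟨i₀, hi₀.1, ?_⟩
      rw [hcc, hc0, taylor_zero, hF₀, coeff_map, hFc]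
      exact hunit
    · refine ⟨n - 1, by omega, ?_⟩
      rw [hcc, tay F₀ c hF₀m hF₀n, hF₀, coeff_map, hFc, hf₂s]
      simp [hc0, hn.ne']
  have hex' : ∃ j, PowerSeries.constantCoeff (F₁.coeff j) ≠ 0 := hex.imp fun _ h => h.2
  set m := Nat.find hex' with hmdef
  have hmn : m < n := by
    obtain ⟨j, hj, hj'⟩ := hex
    exact (Nat.find_min' hex' hj').trans_lt hj
  have hm0 : 0 < m := by
    rw [Nat.pos_iff_ne_zero]
    intro h
    have h1 := Nat.find_spec hex'
    rw [← hmdef, h, hcc, taylor_coeff_zero] at h1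
    exact h1 hc
  obtain ⟨g, hgm, hgn, hgd⟩ := PowerSeries.exists_monic_dvd F₁ m (Nat.find_spec hex')
    (fun j hj => not_not.1 (Nat.find_min hex' hj))
  obtain ⟨b, hb⟩ := ih m hmn (g.map e) (hgm.map e) (by rw [hgm.natDegree_map, hgn]) hm0
  refine ⟨b + e (PowerSeries.C c), ?_⟩
  have h1 : (F₁.map e).eval b = 0 :=
    eval_eq_zero_of_dvd_of_eval_eq_zero (Polynomial.map_dvd e hgd) hb
  have h2 : F₁.map e = taylor (e (PowerSeries.C c)) f₂ := by
    rw [hF₁, ← hF, taylor_apply, taylor_apply, Polynomial.map_comp]; simp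
  rw [h2, taylor_eval] at h1
  exact h1

/-- Puiseux series over an algebraically closed field of characteristic zero form an
algebraically closed field. -/
instance [IsAlgClosed k] [CharZero k] : IsAlgClosed (puiseux k) :=
  .of_exists_root _ fun p hp hirr => exists_root_puiseux _ p hp rfl hirr.natDegree_pos

end HahnSeries

namespace HahnSeries

/-- The canonical `ℤ`-algebra structure, taking precedence over other ones found by unification. -/
noncomputable instance instIntAlgebra {Γ R : Type*} [AddCommGroup Γ] [LinearOrder Γ]
    [IsOrderedAddMonoid Γ]
    [CommRing R] : Algebra ℤ (HahnSeries Γ R) := Ring.toIntAlgebra _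

section Coefficientwise

variable {Γ R : Type*} [AddCommGroup Γ] [LinearOrder Γ] [IsOrderedAddMonoid Γ] [CommRing R]

/-- The derivation of a ring of Hahn series acting on coefficients. -/
noncomputable def mapDerivation (Γ : Type*) [AddCommGroup Γ] [LinearOrder Γ] [IsOrderedAddMonoid Γ]
    (d : Derivation ℤ R R) : Derivation ℤ (HahnSeries Γ R) (HahnSeries Γ R) :=
  Derivation.mk'
    (AddMonoidHom.toIntLinearMap
      { toFun := fun x => x.map (d : R →+ R)
        map_zero' := by ext; simp
        map_add' := fun x y => by ext; simp }) <| by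
    intro x y
    ext n
    have h1 : ∀ z : HahnSeries Γ R, (z.map (d : R →+ R)).support ⊆ z.support := by
      intro z i hi h
      exact hi (by simp [h])
    simp only [AddMonoidHom.coe_toIntLinearMap, AddMonoidHom.coe_mk, ZeroHom.coe_mk, map_coeff,
      smul_eq_mul, coeff_add]
    rw [coeff_mul, coeff_mul_right' y.isPWO_support (h1 y), mul_comm y,
      coeff_mul_left' x.isPWO_support (h1 x), ← Finset.sum_add_distrib]
    change d _ = _
    rw [map_sum]
    refine Finset.sum_congr rfl fun p _ => ?_
    rw [Derivation.leibniz]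
    change _ = x.coeff p.1 * d (y.coeff p.2) + d (x.coeff p.1) * y.coeff p.2
    rw [smul_eq_mul, smul_eq_mul]; ring

@[simp] theorem coeff_mapDerivation (d : Derivation ℤ R R) (x : HahnSeries Γ R) (n : Γ) :
    (mapDerivation Γ d x).coeff n = d (x.coeff n) := rfl

/-- The derivation multiplying the coefficient of index `n` by `χ n`. -/
noncomputable def eulerDerivation (χ : Γ →+ R) :
    Derivation ℤ (HahnSeries Γ R) (HahnSeries Γ R) :=
  Derivation.mk'
    (AddMonoidHom.toIntLinearMap
      { toFun := fun x => ⟨fun n => χ n * x.coeff n, x.isPWO_support.mono fun n hn h => hn (by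
          simp only [h, mul_zero])⟩
        map_zero' := by ext; simp
        map_add' := fun x y => by ext; simp [mul_add] }) <| by
    intro x y
    ext n
    simp only [AddMonoidHom.coe_toIntLinearMap, AddMonoidHom.coe_mk, ZeroHom.coe_mk, smul_eq_mul,
      coeff_add]
    rw [coeff_mul, coeff_mul_right' y.isPWO_support, mul_comm y,
      coeff_mul_left' x.isPWO_support, ← Finset.sum_add_distrib, Finset.mul_sum]
    · refine Finset.sum_congr rfl fun p hp => ?_
      have := (Finset.mem_antidiagonal.1 hp).2.2
      rw [← this, map_add]
      simp only
      ring
    · intro i hi h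
      exact hi (by simp [h])
    · intro i hi h
      exact hi (by simp [h])

@[simp] theorem coeff_eulerDerivation (χ : Γ →+ R) (x : HahnSeries Γ R) (n : Γ) :
    (eulerDerivation χ x).coeff n = χ n * x.coeff n := rfl

/-- The coefficients of `x` below `p` vanish. -/
def Low (p : Γ) (x : HahnSeries Γ R) : Prop := ∀ i < p, x.coeff i = 0

omit [AddCommGroup Γ] [IsOrderedAddMonoid Γ] in
theorem Low.mono {p q : Γ} {x : HahnSeries Γ R} (h : Low q x) (hpq : p ≤ q) : Low p x :=
  fun i hi => h i (hi.trans_le hpq)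

omit [AddCommGroup Γ] [IsOrderedAddMonoid Γ] in
theorem Low.zero (p : Γ) : Low p (0 : HahnSeries Γ R) := fun _ _ => rfl

omit [AddCommGroup Γ] [IsOrderedAddMonoid Γ] in
theorem Low.add {p : Γ} {x y : HahnSeries Γ R} (hx : Low p x) (hy : Low p y) : Low p (x + y) :=
  fun i hi => by rw [coeff_add, hx i hi, hy i hi, add_zero]

omit [AddCommGroup Γ] [IsOrderedAddMonoid Γ] in
theorem Low.neg {p : Γ} {x : HahnSeries Γ R} (hx : Low p x) : Low p (-x) :=
  fun i hi => by rw [coeff_neg, hx i hi, neg_zero]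

theorem Low.mul {p q : Γ} {x y : HahnSeries Γ R} (hx : Low p x) (hy : Low q y) :
    Low (p + q) (x * y) := by
  intro i hi
  rw [HahnSeries.coeff_mul]
  refine Finset.sum_eq_zero fun a ha => ?_
  have h := (Finset.mem_antidiagonal.1 ha).2.2
  by_cases h1 : a.1 < p
  · rw [hx _ h1, zero_mul]
  · rw [hy a.2, mul_zero]
    by_contra! h2
    have := add_le_add (not_lt.1 h1) h2
    rw [h] at this
    exact absurd hi this.not_gt

theorem Low.coeff_mul {p q : Γ} {x y : HahnSeries Γ R} (hx : Low p x) (hy : Low q y) :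
    (x * y).coeff (p + q) = x.coeff p * y.coeff q := by
  rw [HahnSeries.coeff_mul]
  refine Finset.sum_eq_single (p, q) (fun a ha hne => ?_) fun hn => ?_
  · have h := (Finset.mem_antidiagonal.1 ha).2.2
    by_cases h1 : a.1 < p
    · rw [hx _ h1, zero_mul]
    · rw [hy a.2, mul_zero]
      by_contra! h2
      obtain h1 | h1 := (not_lt.1 h1).eq_or_lt
      · refine hne (Prod.ext h1.symm ?_)
        rw [← h1] at h
        exact add_left_cancel h
      · exact absurd h (add_lt_add_of_lt_of_le h1 h2).ne'
  · by_contra h0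
    exact hn (Finset.mem_antidiagonal.2 ⟨left_ne_zero_of_mul h0, right_ne_zero_of_mul h0, rfl⟩)

end Coefficientwise
end HahnSeries

section

open HahnSeries

/-- A derivation identity on a field generated by a set can be checked on the generators. -/
theorem Derivation.map_comp_eq_of_adjoin_eq_top {K N H : Type*} [Field K] [Field N] [Field H]
    [Algebra K N] (ψ : N →+* H) (d : Derivation ℤ N N) (d' : Derivation ℤ H H) {s : Set N}
    (hs : IntermediateField.adjoin K s = ⊤)
    (hK : ∀ a : K, ψ (d (algebraMap K N a)) = d' (ψ (algebraMap K N a)))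
    (hgen : ∀ x ∈ s, ψ (d x) = d' (ψ x)) (x : N) : ψ (d x) = d' (ψ x) := by
  have hx : x ∈ IntermediateField.adjoin K s := hs ▸ IntermediateField.mem_top
  induction hx using IntermediateField.adjoin_induction with
  | mem x hx => exact hgen x hx
  | algebraMap a => exact hK a
  | add x y _ _ hx hy => simp only [map_add, hx, hy]
  | inv x _ hx => rw [Derivation.leibniz_inv, map_inv₀, Derivation.leibniz_inv]; simp [hx]
  | mul x y _ _ hx hy => simp [hx, hy]

/-- The field `K(Y, Z)` with the derivations used to study the first Painlevé equation, graded so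
that `Y` has weight `2` and `Z` weight `3`. -/
structure PainleveModel {K : Type*} (N : Type*) [Field K] [Field N] [Algebra K N]
    (δ : Derivation ℤ K K) (t : K) where
  Y : N
  Z : N
  indep : AlgebraicIndependent K ![Y, Z]
  adjoin_eq_top : IntermediateField.adjoin K {Y, Z} = ⊤
  D₀ : Derivation ℤ N N
  D₁ : Derivation ℤ N N
  D₃ : Derivation ℤ N N
  E : Derivation ℤ N N
  D₀_map : ∀ a, D₀ (algebraMap K N a) = algebraMap K N (δ a)
  D₀_Y : D₀ Y = 0
  D₀_Z : D₀ Z = 0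
  D₁_map : ∀ a, D₁ (algebraMap K N a) = 0
  D₁_Y : D₁ Y = Z
  D₁_Z : D₁ Z = 6 * Y ^ 2
  D₃_map : ∀ a, D₃ (algebraMap K N a) = 0
  D₃_Y : D₃ Y = 0
  D₃_Z : D₃ Z = algebraMap K N t
  E_map : ∀ a, E (algebraMap K N a) = 0
  E_Y : E Y = 2 * Y
  E_Z : E Z = 3 * Z
  Ψ : N →+* HahnSeries ℤ N
  Ψ_map : ∀ a, Ψ (algebraMap K N a) = C (algebraMap K N a)
  Ψ_Y : Ψ Y = single (-2) Y
  Ψ_Z : Ψ Z = single (-3) Z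

section Existence

variable {K N : Type*} [Field K] [Field N] [Algebra K N]

theorem eval₂_single_monomial (Y Z : N) (e : Fin 2 →₀ ℕ) (a : K) :
    MvPolynomial.eval₂ ((C (Γ := ℤ)).comp (algebraMap K N))
      ![single (-2) Y, single (-3) Z] (MvPolynomial.monomial e a) =
      single (-(2 * e 0 + 3 * e 1 : ℕ) : ℤ) (algebraMap K N a * (Y ^ e 0 * Z ^ e 1)) := by
  rw [MvPolynomial.eval₂_monomial, Finsupp.prod_fintype _ _ (by simp), Fin.prod_univ_two]
  simp only [RingHom.comp_apply, C_apply, Matrix.cons_val_zero, Matrix.cons_val_one, single_pow,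
    single_mul_single]
  congr 2
  push_cast [nsmul_eq_mul]; ring

theorem coeff_eval₂_single (Y Z : N) (p : MvPolynomial (Fin 2) K) (m : ℕ) :
    (MvPolynomial.eval₂ ((C (Γ := ℤ)).comp (algebraMap K N))
      ![single (-2) Y, single (-3) Z] p).coeff (-m) =
      MvPolynomial.aeval ![Y, Z] (MvPolynomial.weightedHomogeneousComponent ![2, 3] m p) := by
  classical
  induction p using MvPolynomial.induction_on' with
  | monomial e a =>
    have hw : Finsupp.weight ![2, 3] e = 2 * e 0 + 3 * e 1 := by
      rw [Finsupp.weight_apply, Finsupp.sum_fintype _ _ (by simp), Fin.sum_univ_two]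
      simp [mul_comm]
    rw [eval₂_single_monomial, MvPolynomial.weightedHomogeneousComponent_of_mem
      (MvPolynomial.isWeightedHomogeneous_monomial _ _ _ hw)]
    by_cases h : m = 2 * e 0 + 3 * e 1
    · rw [if_pos h, h, coeff_single_same, MvPolynomial.aeval_monomial,
        Finsupp.prod_fintype _ _ (by simp), Fin.prod_univ_two]
      simp
    · rw [if_neg h, coeff_single_of_ne (by omega), map_zero]
  | add p q hp hq => simp only [MvPolynomial.eval₂_add, coeff_add, hp, hq, map_add]

open scoped IntermediateField.algebraAdjoinAdjoin in
theorem isTranscendenceBasis_of_isAlgebraic_adjoin {ι : Type*} {x : ι → N}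
    (hi : AlgebraicIndependent K x)
    (h : Algebra.IsAlgebraic (IntermediateField.adjoin K (Set.range x)) N) :
    IsTranscendenceBasis K x := by
  rw [hi.isTranscendenceBasis_iff_isAlgebraic]
  exact Algebra.IsAlgebraic.trans _ (IntermediateField.adjoin K (Set.range x)) _

theorem PainleveModel.exists_of_algebraicIndependent [CharZero K] (δ : Derivation ℤ K K) (t : K)
    {Y Z : N} (hi : AlgebraicIndependent K ![Y, Z])
    (htop : IntermediateField.adjoin K {Y, Z} = ⊤) :
    ∃ M : PainleveModel N δ t, M.Y = Y ∧ M.Z = Z := by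
  have hr : Set.range ![Y, Z] = {Y, Z} := by
    simp [Matrix.range_cons, Set.pair_comm]
  have hb : IsTranscendenceBasis K ![Y, Z] := by
    refine isTranscendenceBasis_of_isAlgebraic_adjoin hi ⟨fun x => ?_⟩
    have : x ∈ IntermediateField.adjoin K (Set.range ![Y, Z]) := by
      rw [hr, htop]; trivial
    exact isAlgebraic_algebraMap (⟨x, this⟩ : IntermediateField.adjoin K (Set.range ![Y, Z]))
  have ext : ∀ (δ : Derivation ℤ K K) (a b : N), ∃ d : Derivation ℤ N N,
      (∀ c, d (algebraMap K N c) = algebraMap K N (δ c)) ∧ d Y = a ∧ d Z = b := by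
    intro δ a b
    obtain ⟨d, h1, h2⟩ := Derivation.exists_extend
      (((Algebra.linearMap K N).compDer δ).restrictScalars ℤ) hb ![a, b]
    exact ⟨d, h1, h2 0, h2 1⟩
  obtain ⟨D₀, h01, h02, h03⟩ := ext δ 0 0
  obtain ⟨D₁, h11, h12, h13⟩ := ext 0 Z (6 * Y ^ 2)
  obtain ⟨D₃, h31, h32, h33⟩ := ext 0 0 (algebraMap K N t)
  obtain ⟨E, he1, he2, he3⟩ := ext 0 (2 * Y) (3 * Z)
  let g : MvPolynomial (Fin 2) K →+* HahnSeries ℤ N :=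
    MvPolynomial.eval₂Hom ((C (Γ := ℤ)).comp (algebraMap K N)) ![single (-2) Y, single (-3) Z]
  have hg : Function.Injective g := by
    rw [injective_iff_map_eq_zero]
    intro p hp
    rw [← MvPolynomial.sum_weightedHomogeneousComponent (w := ![2, 3]) p]
    refine finsum_eq_zero_of_forall_eq_zero fun m => ?_
    have := coeff_eval₂_single Y Z p m
    change (g p).coeff _ = _ at this
    rw [hp, coeff_zero] at this
    exact (injective_iff_map_eq_zero _).1 hi _ this.symm
  let e₀ : FractionRing (MvPolynomial (Fin 2) K) ≃+* N :=
    (hi.aevalEquivField.trans ((IntermediateField.equivOfEq (hr ▸ htop)).trans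
      IntermediateField.topEquiv)).toRingEquiv
  have he₀ : ∀ p, e₀ (algebraMap _ _ p) = MvPolynomial.aeval ![Y, Z] p := fun p =>
    hi.aevalEquivField_algebraMap_apply_coe p
  let Ψ : N →+* HahnSeries ℤ N := (IsFractionRing.lift hg).comp e₀.symm.toRingHom
  have hΨ : ∀ p, Ψ (MvPolynomial.aeval ![Y, Z] p) = g p := by
    intro p
    change IsFractionRing.lift hg (e₀.symm _) = _
    rw [← he₀, RingEquiv.symm_apply_apply, IsFractionRing.lift_algebraMap]
  refine ⟨⟨Y, Z, hi, htop, D₀, D₁, D₃, E, h01, h02, h03, fun a => by simp [h11], h12, h13,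
    fun a => by simp [h31], h32, h33, fun a => by simp [he1], he2, he3, Ψ, fun a => ?_, ?_, ?_⟩,
    rfl, rfl⟩
  · have := hΨ (MvPolynomial.C a)
    rw [MvPolynomial.aeval_C] at this
    rw [this]; simp [g]
  · have := hΨ (MvPolynomial.X 0)
    rw [MvPolynomial.aeval_X] at this
    exact this.trans (by simp [g])
  · have := hΨ (MvPolynomial.X 1)
    rw [MvPolynomial.aeval_X] at this
    exact this.trans (by simp [g])

end Existence

end

section

open Polynomial

/-- A derivation of `N` killing `M` but not `x` has no new constants in `M(x)`. -/
theorem Derivation.exists_algebraMap_eq_of_mem_adjoin {M N : Type*} [Field M] [CharZero M]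
    [Field N] [Algebra M N]
    (E : Derivation ℤ N N) (hE : ∀ m, E (algebraMap M N m) = 0) {x f : N} (hx : E x ≠ 0)
    (hfx : f ∈ IntermediateField.adjoin M {x}) (hf : E f = 0) : ∃ m, algebraMap M N m = f := by
  have : CharZero N := charZero_of_injective_algebraMap (algebraMap M N).injective
  obtain ⟨p, q, h⟩ := (IntermediateField.mem_adjoin_simple_iff M f).1 hfx
  by_contra hne
  have hq : aeval x q ≠ 0 := fun h0 => hne ⟨0, by simp [h, h0]⟩
  have hfm : f ∈ IntermediateField.adjoin M {f} :=
    IntermediateField.mem_adjoin_simple_self M f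
  let f' : IntermediateField.adjoin M {f} := ⟨f, hfm⟩
  refine hx (Derivation.eq_zero_of_isAlgebraic (R := IntermediateField.adjoin M {f}) E ?_
    ⟨p.map (algebraMap _ _) - C f' * q.map (algebraMap _ _), fun h0 => ?_, ?_⟩)
  · intro ⟨y, hy⟩
    change E y = 0
    induction hy using IntermediateField.adjoin_induction with
    | mem y hy => rw [Set.mem_singleton_iff.1 hy, hf]
    | algebraMap a => exact hE a
    | add x y _ _ hx hy => simp only [map_add, hx, hy, add_zero]
    | inv x _ hx => rw [Derivation.leibniz_inv, hx, smul_zero]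
    | mul x y _ _ hx hy => simp [hx, hy]
  · have hq0 : q ≠ 0 := fun h0 => hq (by simp [h0])
    have h1 := congrArg (fun s => (s.coeff q.natDegree : IntermediateField.adjoin M {f})) h0
    simp only [coeff_sub, coeff_map, coeff_C_mul, coeff_zero, sub_eq_zero] at h1
    have h2 := congrArg (Subtype.val) h1
    change algebraMap M N _ = f * algebraMap M N _ at h2
    refine hne ⟨p.coeff q.natDegree / q.leadingCoeff, ?_⟩
    rw [map_div₀, h2]
    have : algebraMap M N (q.coeff q.natDegree) ≠ 0 := by
      simpa using hq0
    exact mul_div_cancel_right₀ _ this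
  · simp only [map_sub, map_mul, aeval_map_algebraMap, aeval_C]
    change _ - f * _ = 0
    rw [h, div_mul_cancel₀ _ hq, sub_self]

section Polynomials

variable {k : Type*} [Field k] [CharZero k] [IsAlgClosed k]

theorem isUnit_of_pole_equation {p q g : k[X]} {α β : k} (hcop : IsCoprime p q) (hq : q ≠ 0)
    (h : (C α * X + C β) * p * q + 3 * X * (4 * X + 1) *
      (derivative p * q - p * derivative q) = g * q ^ 2)
    (h1 : ∀ n : ℕ, 1 ≤ n → β - 3 * n ≠ 0) (h2 : ∀ n : ℕ, 1 ≤ n → -α / 4 + β + 3 * n ≠ 0) :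
    IsUnit q := by
  by_contra hu
  obtain ⟨c, hc⟩ := IsAlgClosed.exists_root q (fun h0 => hu (isUnit_iff_degree_eq_zero.2 h0))
  obtain ⟨q₁, hq₁, hnd⟩ := exists_eq_pow_rootMultiplicity_mul_and_not_dvd q hq c
  have hn : 0 < rootMultiplicity c q := (rootMultiplicity_pos hq).2 hc
  obtain ⟨n, hn'⟩ : ∃ n, rootMultiplicity c q = n + 1 := ⟨_, (Nat.succ_pred hn.ne').symm⟩
  rw [hn'] at hq₁
  have hq₁c : eval c q₁ ≠ 0 := fun h0 => hnd (dvd_iff_isRoot.2 h0)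
  have hpc : eval c p ≠ 0 := by
    intro h0
    obtain ⟨a, b, hab⟩ := hcop
    have := congrArg (eval c) hab
    simp [h0, hc.eq_zero] at this
  have hx : (X - C c : k[X]) ≠ 0 := X_sub_C_ne_zero c
  have key : (C α * X + C β) * p * (X - C c) * q₁ + 3 * X * (4 * X + 1) *
      (derivative p * (X - C c) * q₁ - p * ((n + 1 : k[X]) * q₁ + (X - C c) * derivative q₁)) =
      g * (X - C c) ^ (n + 2) * q₁ ^ 2 := by
    apply mul_left_cancel₀ (pow_ne_zero n hx)
    have hd : derivative q = (n + 1 : k[X]) * (X - C c) ^ n * q₁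
        + (X - C c) ^ (n + 1) * derivative q₁ := by
      rw [hq₁, derivative_mul, derivative_X_sub_C_pow]; simp
    rw [hd, hq₁] at h
    linear_combination h
  have hc0 : c * (4 * c + 1) = 0 := by
    have := congrArg (eval c) key
    simp only [eval_add, eval_mul, eval_sub, eval_X, eval_C, sub_self, mul_zero, zero_mul,
      eval_pow, eval_natCast, eval_one, eval_ofNat, add_zero, zero_sub, ne_eq,
      Nat.succ_ne_zero, not_false_eq_true, zero_pow] at this
    have hn0 : ((n : k) + 1) ≠ 0 := by exact_mod_cast n.succ_ne_zero
    have h3 : (3 : k) ≠ 0 := by norm_num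
    have h4 : (3 * (n + 1) * eval c p * eval c q₁) * (c * (4 * c + 1)) = 0 := by
      linear_combination -this
    exact (mul_eq_zero.1 h4).resolve_left (by positivity)
  rcases mul_eq_zero.1 hc0 with hc0 | hc0
  · subst hc0
    have key2 : (C α * X + C β) * p * q₁ + 3 * (4 * X + 1) *
      (derivative p * X * q₁ - p * ((n + 1 : k[X]) * q₁ + X * derivative q₁)) =
      g * X ^ (n + 1) * q₁ ^ 2 := by
      apply mul_left_cancel₀ (X_ne_zero (R := k))
      rw [C_0, sub_zero] at key
      linear_combination key
    have := congrArg (eval 0) key2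
    simp at this
    refine h1 (n + 1) (by omega) ?_
    have h4 : (eval 0 p * eval 0 q₁) * (β - 3 * (n + 1 : ℕ)) = 0 := by
      push_cast
      linear_combination this
    exact (mul_eq_zero.1 h4).resolve_left (mul_ne_zero hpc hq₁c)
  · have hc4 : c = -1 / 4 := by linear_combination hc0 / 4
    have key2 : (C α * X + C β) * p * q₁ + 12 * X *
      (derivative p * (X - C c) * q₁ - p * ((n + 1 : k[X]) * q₁ + (X - C c) * derivative q₁)) =
      g * (X - C c) ^ (n + 1) * q₁ ^ 2 := by
      apply mul_left_cancel₀ hx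
      have : (4 * X + 1 : k[X]) = 4 * (X - C c) := by
        have : (4 * C c + 1 : k[X]) = 0 := by
          rw [← C_ofNat, ← C_mul, ← C_1, ← C_add, hc0, C_0]
        linear_combination this
      rw [this] at key
      linear_combination key
    have := congrArg (eval c) key2
    simp only [eval_add, eval_mul, eval_sub, eval_X, eval_C, sub_self, mul_zero, zero_mul,
      eval_pow, eval_natCast, eval_one, eval_ofNat, add_zero, zero_sub, ne_eq,
      Nat.succ_ne_zero, not_false_eq_true, zero_pow] at this
    refine h2 (n + 1) (by omega) ?_
    have h4 : (eval c p * eval c q₁) * (-α / 4 + β + 3 * (n + 1 : ℕ)) = 0 := by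
      push_cast
      rw [show (-α / 4 : k) = α * c by rw [hc4]; ring]
      linear_combination this + 3 * (n + 1) * eval c p * eval c q₁ * hc0
    exact (mul_eq_zero.1 h4).resolve_left (mul_ne_zero hpc hq₁c)

theorem eq_zero_of_pole_equation {p q : k[X]} {α β u v : k} (hcop : IsCoprime p q) (hq : q ≠ 0)
    (h : (C α * X + C β) * p * q + 3 * X * (4 * X + 1) *
      (derivative p * q - p * derivative q) = (C u * X + C v) * q ^ 2)
    (h1 : ∀ n : ℕ, 1 ≤ n → β - 3 * n ≠ 0) (h2 : ∀ n : ℕ, 1 ≤ n → -α / 4 + β + 3 * n ≠ 0)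
    (h3 : ∀ n : ℕ, α + 12 * n ≠ 0) : ∃ s, α * s = u ∧ β * s = v := by
  obtain ⟨c, hc, rfl⟩ := isUnit_iff.1 (isUnit_of_pole_equation hcop hq h h1 h2)
  have hc0 : c ≠ 0 := hc.ne_zero
  obtain ⟨P, rfl⟩ : ∃ P, p = C c * P := ⟨C c⁻¹ * p, by rw [← mul_assoc, ← C_mul]; simp [hc0]⟩
  have hP : (C α * X + C β) * P + 3 * X * (4 * X + 1) * derivative P = C u * X + C v := by
    apply mul_left_cancel₀ (pow_ne_zero 2 (C_ne_zero.2 hc0))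
    simp only [derivative_C_mul, derivative_C] at h
    linear_combination h
  have hP2 : X * (C α * P + 12 * X * derivative P) + (C β * P + 3 * X * derivative P)
      = C u * X + C v := by linear_combination hP
  have h0 : P.natDegree = 0 := by
    by_contra hd
    have hP0 : P ≠ 0 := fun h => hd (by simp [h])
    obtain ⟨d, hd⟩ : ∃ d, P.natDegree = d + 1 := ⟨_, (Nat.succ_pred hd).symm⟩
    have := congrArg (fun s => coeff s (d + 1 + 1)) hP2
    have hd2 : P.coeff (d + 1 + 1) = 0 := coeff_eq_zero_of_natDegree_lt (by omega)
    have e1 : (12 * X * derivative P : k[X]) = C 12 * (X * derivative P) := by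
      rw [mul_assoc]; rfl
    have e2 : (3 * X * derivative P : k[X]) = C 3 * (X * derivative P) := by
      rw [mul_assoc]; rfl
    simp only [e1, e2, coeff_add, coeff_X_mul, coeff_C_mul, coeff_derivative, hd2, coeff_C_succ,
      coeff_X_of_ne_one (show d + 1 + 1 ≠ 1 by omega)] at this
    have hl : P.coeff (d + 1) ≠ 0 := by
      rw [← hd]; simpa using hP0
    refine h3 (d + 1) ?_
    have : P.coeff (d + 1) * (α + 12 * (d + 1 : ℕ)) = 0 := by
      push_cast
      linear_combination this
    exact (mul_eq_zero.1 this).resolve_left hl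
  obtain ⟨s, rfl⟩ := natDegree_eq_zero.1 h0
  refine ⟨s, ?_, ?_⟩
  · have := congrArg (fun s => coeff s 1) hP2
    simpa using this
  · have := congrArg (fun s => coeff s 0) hP2
    simpa using this

end Polynomials

end

section

open Polynomial

namespace PainleveModel

variable {K N : Type*} [Field K] [CharZero K] [Field N] [Algebra K N] {δ : Derivation ℤ K K}
  {t : K} (M : PainleveModel N δ t)

include M in
theorem charZero : CharZero N := charZero_of_injective_algebraMap (algebraMap K N).injective

omit [CharZero K] in
theorem Y_ne_zero : M.Y ≠ 0 := M.indep.ne_zero 0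

omit [CharZero K] in
theorem Z_ne_zero : M.Z ≠ 0 := M.indep.ne_zero 1

/-- The element `Z² - 4 * Y³`. -/
def H : N := M.Z ^ 2 - 4 * M.Y ^ 3

theorem H_ne_zero : M.H ≠ 0 := by
  intro h
  have := M.indep.eq_zero_of_aeval_eq_zero (MvPolynomial.X 1 ^ 2 - 4 * MvPolynomial.X 0 ^ 3)
    (by simpa [H] using h)
  have h1 := congrArg (MvPolynomial.eval ![0, 1]) this
  simp at h1

/-- The element `Y³ / H` of weight zero. -/
noncomputable def S : N := M.Y ^ 3 / M.H

/-- The element `Z / Y` of weight one. -/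
noncomputable def r : N := M.Z / M.Y

theorem r_ne_zero : M.r ≠ 0 := div_ne_zero M.Z_ne_zero M.Y_ne_zero

theorem S_ne_zero : M.S ≠ 0 := div_ne_zero (pow_ne_zero 3 M.Y_ne_zero) M.H_ne_zero

theorem four_S_add_one : 4 * M.S + 1 = M.Z ^ 2 / M.H := by
  have := M.H_ne_zero
  rw [S, eq_div_iff this, add_mul, mul_assoc, div_mul_cancel₀ _ this, H]; ring

theorem four_S_add_one_ne_zero : 4 * M.S + 1 ≠ 0 := by
  rw [four_S_add_one]; exact div_ne_zero (pow_ne_zero 2 M.Z_ne_zero) M.H_ne_zero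

theorem Y_eq : M.Y = M.r ^ 2 * M.S / (4 * M.S + 1) := by
  have := M.H_ne_zero
  have := M.Y_ne_zero
  have := M.Z_ne_zero
  rw [four_S_add_one, S, r]; field_simp

theorem H_eq : M.H = M.r ^ 6 * M.S ^ 2 / (4 * M.S + 1) ^ 3 := by
  have := M.H_ne_zero
  have := M.Y_ne_zero
  have := M.Z_ne_zero
  rw [four_S_add_one, S, r]; field_simp

omit [CharZero K] in
theorem D₁_H : M.D₁ M.H = 0 := by
  simp only [H, map_sub, Derivation.leibniz, Derivation.leibniz_pow, M.D₁_Y, M.D₁_Z,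
    Derivation.map_ofNat_eq_zero, smul_eq_mul, nsmul_eq_mul]
  push_cast; ring

omit [CharZero K] in
theorem D₃_H : M.D₃ M.H = 2 * algebraMap K N t * M.Z := by
  simp only [H, map_sub, Derivation.leibniz, Derivation.leibniz_pow, M.D₃_Y, M.D₃_Z,
    Derivation.map_ofNat_eq_zero, smul_eq_mul, nsmul_eq_mul]
  push_cast; ring

omit [CharZero K] in
theorem D₀_H : M.D₀ M.H = 0 := by
  simp only [H, map_sub, Derivation.leibniz, Derivation.leibniz_pow, M.D₀_Y, M.D₀_Z,
    Derivation.map_ofNat_eq_zero, smul_eq_mul, nsmul_eq_mul]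
  push_cast; ring

omit [CharZero K] in
theorem E_H : M.E M.H = 6 * M.H := by
  simp only [H, map_sub, Derivation.leibniz, Derivation.leibniz_pow, M.E_Y, M.E_Z,
    Derivation.map_ofNat_eq_zero, smul_eq_mul, nsmul_eq_mul]
  push_cast; ring

theorem E_r : M.E M.r = M.r := by
  have := M.Y_ne_zero
  rw [r, Derivation.leibniz_div, M.E_Y, M.E_Z]
  simp only [smul_eq_mul]
  field_simp; ring

theorem E_S : M.E M.S = 0 := by
  have := M.H_ne_zero
  rw [S, Derivation.leibniz_div, M.E_H, Derivation.leibniz_pow, M.E_Y]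
  simp only [smul_eq_mul, nsmul_eq_mul]
  field_simp; push_cast; ring

theorem D₁_S : M.D₁ M.S = 3 * M.S * M.r := by
  have := M.H_ne_zero
  have := M.Y_ne_zero
  rw [S, r, Derivation.leibniz_div, M.D₁_H, Derivation.leibniz_pow, M.D₁_Y]
  simp only [smul_eq_mul, nsmul_eq_mul]
  field_simp; push_cast; ring

theorem D₁_r : M.D₁ M.r = M.r ^ 2 * (2 * M.S - 1) / (4 * M.S + 1) := by
  have := M.H_ne_zero
  have := M.Y_ne_zero
  have := M.Z_ne_zero
  rw [four_S_add_one, S, r, Derivation.leibniz_div, M.D₁_Y, M.D₁_Z]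
  simp only [smul_eq_mul]
  field_simp; rw [H]; ring

theorem D₁_S_ne_zero : M.D₁ M.S ≠ 0 := by
  have := M.charZero
  rw [D₁_S]; exact mul_ne_zero (mul_ne_zero three_ne_zero M.S_ne_zero) M.r_ne_zero

theorem transcendental_S : Transcendental K M.S := fun h =>
  have := M.charZero
  M.D₁_S_ne_zero (M.D₁.eq_zero_of_isAlgebraic M.D₁_map h)

theorem aeval_S_eq_zero {p : K[X]} : aeval M.S p = 0 ↔ p = 0 :=
  ⟨fun h => by_contra fun hp => M.transcendental_S ⟨p, hp, h⟩, fun h => by simp [h]⟩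

theorem adjoin_r_eq_top :
    IntermediateField.adjoin (IntermediateField.adjoin K {M.S}) {M.r} = ⊤ := by
  set F := IntermediateField.adjoin (IntermediateField.adjoin K {M.S}) {M.r}
  have hr : M.r ∈ F := IntermediateField.mem_adjoin_simple_self _ _
  have hS : M.S ∈ F := F.algebraMap_mem
    (⟨M.S, IntermediateField.mem_adjoin_simple_self K M.S⟩ : IntermediateField.adjoin K {M.S})
  have hY : M.Y ∈ F := by
    rw [Y_eq]
    exact F.div_mem (F.mul_mem (pow_mem hr 2) hS)
      (F.add_mem (F.mul_mem (ofNat_mem F 4) hS) F.one_mem)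
  have hZ : M.Z ∈ F := by
    have : M.Z = M.r * M.Y := by rw [r, div_mul_cancel₀ _ M.Y_ne_zero]
    rw [this]; exact F.mul_mem hr hY
  have h : IntermediateField.adjoin K {M.Y, M.Z} ≤ F.restrictScalars K :=
    IntermediateField.adjoin_le_iff.2 (by rintro x (rfl | rfl) <;> assumption)
  rw [M.adjoin_eq_top] at h
  exact eq_top_iff.2 fun x _ => h (IntermediateField.mem_top (x := x))

theorem mem_adjoin_S_of_E_eq_zero {f : N} (hf : M.E f = 0) :
    f ∈ IntermediateField.adjoin K {M.S} := by
  have hE : ∀ m : IntermediateField.adjoin K {M.S}, M.E (algebraMap _ N m) = 0 := by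
    intro ⟨y, hy⟩
    change M.E y = 0
    induction hy using IntermediateField.adjoin_induction with
    | mem y hy => rw [Set.mem_singleton_iff.1 hy, E_S]
    | algebraMap a => exact M.E_map a
    | add x y _ _ hx hy => simp only [map_add, hx, hy, add_zero]
    | inv x _ hx => rw [Derivation.leibniz_inv, hx, smul_zero]
    | mul x y _ _ hx hy => simp [hx, hy]
  obtain ⟨m, rfl⟩ := M.E.exists_algebraMap_eq_of_mem_adjoin hE (x := M.r) (f := f)
    (by rw [E_r]; exact M.r_ne_zero) (by rw [adjoin_r_eq_top]; trivial) hf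
  exact m.2

theorem exists_algebraMap_eq {f : N} (hf : M.E f = 0) (hf' : M.D₁ f = 0) :
    ∃ a, algebraMap K N a = f :=
  M.D₁.exists_algebraMap_eq_of_mem_adjoin M.D₁_map M.D₁_S_ne_zero (M.mem_adjoin_S_of_E_eq_zero hf)
    hf'

theorem exists_coprime_of_E_eq_zero {f : N} (hf : M.E f = 0) :
    ∃ p q : K[X], IsCoprime p q ∧ q ≠ 0 ∧ f = aeval M.S p / aeval M.S q := by
  classical
  obtain ⟨p, q, h⟩ := (IntermediateField.mem_adjoin_simple_iff K f).1
    (M.mem_adjoin_S_of_E_eq_zero hf)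
  by_cases hq : q = 0
  · exact ⟨0, 1, isCoprime_zero_left.2 isUnit_one, one_ne_zero, by simp [h, hq]⟩
  have hg : EuclideanDomain.gcd p q ≠ 0 := fun h0 => hq (EuclideanDomain.gcd_eq_zero_iff.1 h0).2
  obtain ⟨p₁, hp₁⟩ := EuclideanDomain.gcd_dvd_left p q
  obtain ⟨q₁, hq₁⟩ := EuclideanDomain.gcd_dvd_right p q
  have hab := EuclideanDomain.gcd_eq_gcd_ab p q
  set g := EuclideanDomain.gcd p q
  set a := EuclideanDomain.gcdA p q
  set b := EuclideanDomain.gcdB p q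
  refine ⟨p₁, q₁, ⟨a, b, mul_left_cancel₀ hg ?_⟩, fun h0 => hq (by rw [hq₁, h0, mul_zero]), ?_⟩
  · rw [hp₁, hq₁] at hab
    linear_combination -hab
  · rw [h, hp₁, hq₁, map_mul, map_mul, mul_div_mul_left]
    rwa [Ne, aeval_S_eq_zero]

theorem exists_coprime {f : N} {m : ℤ} (hf : M.E f = m * f) :
    ∃ p q : K[X], IsCoprime p q ∧ q ≠ 0 ∧ f = M.r ^ m * (aeval M.S p / aeval M.S q) := by
  obtain ⟨p, q, h1, h2, h3⟩ := M.exists_coprime_of_E_eq_zero (f := f / M.r ^ m) (by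
    have := M.r_ne_zero
    rw [Derivation.leibniz_div, Derivation.leibniz_zpow, hf, E_r, smul_eq_mul,
      zpow_sub_one₀ this, zsmul_eq_mul, smul_eq_mul, smul_eq_mul, smul_eq_mul]
    field_simp; ring)
  refine ⟨p, q, h1, h2, ?_⟩
  rw [← h3, mul_div_cancel₀ _ (zpow_ne_zero m M.r_ne_zero)]

theorem D₁_aeval_S (p : K[X]) :
    M.D₁ (aeval M.S p) = aeval M.S (derivative p) * (3 * M.S * M.r) := by
  rw [M.D₁.map_aeval_of_kills M.D₁_map, D₁_S]

theorem D₁_zpow_H (l : ℤ) : M.D₁ (M.H ^ l) = 0 := by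
  rw [Derivation.leibniz_zpow, D₁_H, smul_zero, smul_zero]

theorem E_zpow_H (l : ℤ) : M.E (M.H ^ l) = 6 * l * M.H ^ l := by
  have := M.H_ne_zero
  rw [Derivation.leibniz_zpow, E_H, smul_eq_mul, zsmul_eq_mul, zpow_sub_one₀ this]
  field_simp

theorem D₁_div_zpow_H (f : N) (l : ℤ) : M.D₁ (f / M.H ^ l) = M.D₁ f / M.H ^ l := by
  rw [Derivation.leibniz_div_const _ _ _ (M.D₁_zpow_H l), smul_eq_mul, mul_comm, div_eq_mul_inv]

theorem E_div_zpow_H {f : N} {m : N} (l : ℤ) (hf : M.E f = m * f) :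
    M.E (f / M.H ^ l) = (m - 6 * l) * (f / M.H ^ l) := by
  have := zpow_ne_zero l M.H_ne_zero
  rw [Derivation.leibniz_div, E_zpow_H, hf, smul_eq_mul, smul_eq_mul, smul_eq_mul]
  field_simp

variable [IsAlgClosed K]

theorem eq_zero_of_D₁_eq {f : N} {a : K} {l : ℤ} (hf : M.E f = (6 * l - 1) * f)
    (h : M.D₁ f = algebraMap K N a * M.H ^ l) : a = 0 := by
  have hH := zpow_ne_zero l M.H_ne_zero
  obtain ⟨g, hg⟩ : ∃ g, g = f / M.H ^ l := ⟨_, rfl⟩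
  have hE : M.E g = ((-1 : ℤ) : N) * g := by
    rw [hg, M.E_div_zpow_H l hf]; push_cast; ring
  have hD : M.D₁ g = algebraMap K N a := by
    rw [hg, D₁_div_zpow_H, h, mul_div_cancel_right₀ _ hH]
  obtain ⟨p, q, hcop, hq, hf'⟩ := M.exists_coprime hE
  have hq' : aeval M.S q ≠ 0 := by rwa [Ne, aeval_S_eq_zero]
  have hr := M.r_ne_zero
  obtain ⟨w, hw⟩ : ∃ w, w = 4 * M.S + 1 := ⟨_, rfl⟩
  have hw0 : w ≠ 0 := hw ▸ M.four_S_add_one_ne_zero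
  have key : (C (-2) * X + C 1) * p * q + 3 * X * (4 * X + 1) *
      (derivative p * q - p * derivative q) = (C (4 * a) * X + C a) * q ^ 2 := by
    rw [← sub_eq_zero, ← M.aeval_S_eq_zero]
    rw [hf', zpow_neg_one, Derivation.leibniz, Derivation.leibniz_div, Derivation.leibniz_inv,
      D₁_aeval_S, D₁_aeval_S, D₁_r] at hD
    simp only [smul_eq_mul] at hD
    rw [← hw] at hD
    field_simp at hD
    simp only [map_sub, map_add, map_mul, aeval_C, aeval_X, map_pow, map_neg, map_one, map_ofNat]
    rw [← hw]
    linear_combination hD + algebraMap K N a * aeval M.S q ^ 2 * hw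
  obtain ⟨s, h1, h2⟩ := eq_zero_of_pole_equation hcop hq key
    (fun n hn h0 => by
      have : (3 * n : K) = 1 := by linear_combination -h0
      have : 3 * n = 1 := by exact_mod_cast this
      omega)
    (fun n hn h0 => by
      have : (3 + 6 * n : K) = 0 := by linear_combination 2 * h0
      have : 3 + 6 * n = 0 := by exact_mod_cast this
      omega)
    (fun n h0 => by
      have : (12 * n : K) = 2 := by linear_combination h0
      have : 12 * n = 2 := by exact_mod_cast this
      omega)
  have : (6 : K) ≠ 0 := by norm_num
  exact (mul_eq_zero.1 (by linear_combination -h1 - 2 * h2 : (6 : K) * a = 0)).resolve_left this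

theorem eq_zero_of_D₁_eq_mul_Y {f : N} {a : K} {l : ℤ} (hf : M.E f = (6 * l + 1) * f)
    (h : M.D₁ f = algebraMap K N a * M.H ^ l * M.Y) : a = 0 := by
  have hH := zpow_ne_zero l M.H_ne_zero
  obtain ⟨g, hg⟩ : ∃ g, g = f / M.H ^ l := ⟨_, rfl⟩
  have hE : M.E g = ((1 : ℤ) : N) * g := by
    rw [hg, M.E_div_zpow_H l hf]; push_cast; ring
  have hD : M.D₁ g = algebraMap K N a * M.Y := by
    rw [hg, D₁_div_zpow_H, h]; field_simp
  obtain ⟨p, q, hcop, hq, hf'⟩ := M.exists_coprime hE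
  have hq' : aeval M.S q ≠ 0 := by rwa [Ne, aeval_S_eq_zero]
  have hr := M.r_ne_zero
  obtain ⟨w, hw⟩ : ∃ w, w = 4 * M.S + 1 := ⟨_, rfl⟩
  have hw0 : w ≠ 0 := hw ▸ M.four_S_add_one_ne_zero
  have key : (C 2 * X + C (-1)) * p * q + 3 * X * (4 * X + 1) *
      (derivative p * q - p * derivative q) = (C a * X + C 0) * q ^ 2 := by
    rw [← sub_eq_zero, ← M.aeval_S_eq_zero]
    rw [hf', zpow_one, Derivation.leibniz, Derivation.leibniz_div,
      D₁_aeval_S, D₁_aeval_S, D₁_r, Y_eq] at hD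
    simp only [smul_eq_mul] at hD
    rw [← hw] at hD
    field_simp at hD
    simp only [map_sub, map_add, map_mul, aeval_C, aeval_X, map_pow, map_neg, map_one, map_ofNat,
      map_zero]
    rw [← hw]
    linear_combination hD
  obtain ⟨s, h1, h2⟩ := eq_zero_of_pole_equation hcop hq key
    (fun n hn h0 => by
      have : (3 * n + 1 : K) = 0 := by linear_combination -h0
      have : 3 * n + 1 = 0 := by exact_mod_cast this
      omega)
    (fun n hn h0 => by
      have : (6 * n : K) = 3 := by linear_combination 2 * h0
      have : 6 * n = 3 := by exact_mod_cast this
      omega)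
    (fun n h0 => by
      have : (12 * n + 2 : K) = 0 := by linear_combination h0
      have : 12 * n + 2 = 0 := by exact_mod_cast this
      omega)
  linear_combination -h1 - 2 * h2

end PainleveModel

end

section

open Polynomial

namespace PainleveModel

variable {K N : Type*} [Field K] [CharZero K] [Field N] [Algebra K N] {δ : Derivation ℤ K K}
  {t : K} (M : PainleveModel N δ t)

theorem six_dvd_of_D₁_eq_zero {f : N} (hf0 : f ≠ 0) {n : ℕ} (hf : M.E f = n * f)
    (h : M.D₁ f = 0) : 6 ∣ n := by
  have hH := M.H_ne_zero
  have hr := M.r_ne_zero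
  have hw0 := M.four_S_add_one_ne_zero
  obtain ⟨w, hw⟩ : ∃ w, w = 4 * M.S + 1 := ⟨_, rfl⟩
  obtain ⟨b, hb⟩ := M.exists_algebraMap_eq (f := f ^ 6 / M.H ^ (n : ℤ)) (by
    rw [M.E_div_zpow_H (m := 6 * n) _ (by
      rw [Derivation.leibniz_pow, hf]; simp only [smul_eq_mul, nsmul_eq_mul]; push_cast; ring)]
    push_cast; ring) (by
    rw [D₁_div_zpow_H, Derivation.leibniz_pow, h]; simp)
  have hb0 : b ≠ 0 := by
    rintro rfl
    rw [map_zero] at hb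
    exact div_ne_zero (pow_ne_zero 6 hf0) (zpow_ne_zero _ hH) hb.symm
  obtain ⟨p, q, hcop, hq, hf'⟩ := M.exists_coprime (m := n) (by exact_mod_cast hf)
  have hq' : aeval M.S q ≠ 0 := by rwa [Ne, aeval_S_eq_zero]
  have key : p ^ 6 * (4 * X + 1) ^ (3 * n) = C b * X ^ (2 * n) * q ^ 6 := by
    rw [← sub_eq_zero, ← M.aeval_S_eq_zero]
    simp only [map_sub, map_add, map_mul, aeval_C, aeval_X, map_pow, map_one, map_ofNat]
    rw [sub_eq_zero, hb, hf', H_eq, zpow_natCast, zpow_natCast]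
    have hS := M.S_ne_zero
    rw [← hw] at hw0 ⊢
    simp only [div_pow, mul_pow, ← pow_mul, mul_comm n]
    field_simp
  have hp : p ≠ 0 := by
    rintro rfl
    rw [map_zero, zero_div, mul_zero] at hf'
    exact hf0 hf'
  have h4 : (4 * X + 1 : K[X]) = C 4 * (X - C (-1 / 4)) := by
    rw [mul_sub, ← C_mul, show (4 : K) * (-1 / 4) = -1 by norm_num, C_neg, C_1, sub_neg_eq_add,
      C_ofNat]
  have hX4 : (X - C (-1 / 4) : K[X]) ≠ 0 := X_sub_C_ne_zero _
  have h40 : (4 * X + 1 : K[X]) ≠ 0 := by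
    rw [h4]; exact mul_ne_zero (C_ne_zero.2 (by norm_num)) hX4
  classical
  have hm : ∀ c, 6 * rootMultiplicity c p + 3 * n * rootMultiplicity c (4 * X + 1) =
      2 * n * rootMultiplicity c X + 6 * rootMultiplicity c q := by
    intro c
    have := congrArg (rootMultiplicity c) key
    have hC := C_ne_zero.2 hb0
    rw [rootMultiplicity_mul (mul_ne_zero (pow_ne_zero _ hp) (pow_ne_zero _ h40)),
      rootMultiplicity_mul (mul_ne_zero (mul_ne_zero hC (pow_ne_zero _ X_ne_zero))
        (pow_ne_zero _ hq)), rootMultiplicity_mul (mul_ne_zero hC (pow_ne_zero _ X_ne_zero)),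
      rootMultiplicity_C] at this
    simp only [← count_roots, roots_pow, Multiset.count_nsmul] at this ⊢
    omega
  have m0 := hm 0
  have m4 := hm (-1 / 4)
  have e1 : rootMultiplicity 0 (4 * X + 1 : K[X]) = 0 :=
    rootMultiplicity_eq_zero (by simp [IsRoot])
  have e2 : rootMultiplicity 0 (X : K[X]) = 1 := by
    simpa using rootMultiplicity_X_sub_C_self (x := (0 : K))
  have e3 : rootMultiplicity (-1 / 4) (X : K[X]) = 0 :=
    rootMultiplicity_eq_zero (by simp [IsRoot])
  have e4 : rootMultiplicity (-1 / 4) (4 * X + 1 : K[X]) = 1 := by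
    rw [h4, rootMultiplicity_mul (by rw [← h4]; exact h40), rootMultiplicity_C,
      rootMultiplicity_X_sub_C_self]
  rw [e1, e2] at m0
  rw [e3, e4] at m4
  omega

theorem exists_eq_zpow_H {f : N} (hf0 : f ≠ 0) {m : ℤ} (hf : M.E f = m * f) (h : M.D₁ f = 0) :
    ∃ (a : K) (l : ℤ), a ≠ 0 ∧ m = 6 * l ∧ f = algebraMap K N a * M.H ^ l := by
  have h6 : 6 ∣ m := by
    obtain ⟨n, rfl | rfl⟩ := m.eq_nat_or_neg
    · exact_mod_cast M.six_dvd_of_D₁_eq_zero hf0 (by exact_mod_cast hf) h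
    · rw [dvd_neg]
      refine Int.natCast_dvd_natCast.2 (M.six_dvd_of_D₁_eq_zero (inv_ne_zero hf0) ?_ ?_)
      · rw [Derivation.leibniz_inv, hf, smul_eq_mul]
        push_cast
        field_simp
      · rw [Derivation.leibniz_inv, h, smul_zero]
  obtain ⟨l, rfl⟩ := h6
  have hH := zpow_ne_zero l M.H_ne_zero
  obtain ⟨a, ha⟩ := M.exists_algebraMap_eq (f := f / M.H ^ l) (by
    rw [M.E_div_zpow_H _ hf]; push_cast; ring) (by rw [D₁_div_zpow_H, h, zero_div])
  refine ⟨a, l, ?_, rfl, by rw [ha, div_mul_cancel₀ _ hH]⟩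
  rintro rfl
  rw [map_zero] at ha
  exact div_ne_zero hf0 hH ha.symm

end PainleveModel

end

section

open HahnSeries

namespace PainleveModel

variable {K N : Type*} [Field K] [CharZero K] [Field N] [Algebra K N]
  {δ : Derivation ℤ K K} {t : K} (M : PainleveModel N δ t)

section Series

/-- The derivation `Y ↦ Z`, `Z ↦ 6Y² + t` extending `δ`. -/
def D : Derivation ℤ N N := M.D₀ + M.D₁ + M.D₃

omit [CharZero K] in
theorem D_apply (f : N) : M.D f = M.D₀ f + M.D₁ f + M.D₃ f := rfl

omit [CharZero K] in
theorem D_map (a : K) : M.D (algebraMap K N a) = algebraMap K N (δ a) := by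
  rw [D_apply, D₀_map, D₁_map, D₃_map, add_zero, add_zero]

omit [CharZero K] in
theorem D_Y : M.D M.Y = M.Z := by rw [D_apply, D₀_Y, D₁_Y, D₃_Y, zero_add, add_zero]

omit [CharZero K] in
theorem D_Z : M.D M.Z = 6 * M.Y ^ 2 + algebraMap K N t := by
  rw [D_apply, D₀_Z, D₁_Z, D₃_Z, zero_add]

/-- The derivation of Laurent series corresponding to `D`. -/
noncomputable def seriesD : Derivation ℤ (HahnSeries ℤ N) (HahnSeries ℤ N) :=
  (single (-1 : ℤ) (1 : N)) • mapDerivation ℤ M.D₁ + mapDerivation ℤ M.D₀ +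
    (single (3 : ℤ) (1 : N)) • mapDerivation ℤ M.D₃

omit [CharZero K] in
theorem coeff_seriesD (f : HahnSeries ℤ N) (n : ℤ) :
    (M.seriesD f).coeff n =
      M.D₁ (f.coeff (n + 1)) + M.D₀ (f.coeff n) + M.D₃ (f.coeff (n - 3)) := by
  have h : M.seriesD f = single (-1 : ℤ) (1 : N) * mapDerivation ℤ M.D₁ f +
    mapDerivation ℤ M.D₀ f + single (3 : ℤ) (1 : N) * mapDerivation ℤ M.D₃ f := rfl
  rw [h, coeff_add, coeff_add, coeff_mapDerivation, coeff_single_mul, coeff_single_mul,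
    coeff_mapDerivation, coeff_mapDerivation, one_mul, one_mul, sub_neg_eq_add]

omit [CharZero K] in
theorem Ψ_D (f : N) : M.Ψ (M.D f) = M.seriesD (M.Ψ f) := by
  refine Derivation.map_comp_eq_of_adjoin_eq_top M.Ψ M.D M.seriesD M.adjoin_eq_top ?_ ?_ f
  · intro a
    ext n
    rw [D_map, Ψ_map, Ψ_map, coeff_seriesD, C_apply, C_apply]
    have key : ∀ (d : Derivation ℤ N N) (m : ℤ), d (algebraMap K N a) = 0 →
        d ((single (0 : ℤ) (algebraMap K N a)).coeff m) = 0 := by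
      intro d m hd
      rw [coeff_single]
      split_ifs
      · exact hd
      · exact map_zero d
    rw [key M.D₁ _ (M.D₁_map a), key M.D₃ _ (M.D₃_map a), zero_add, add_zero, coeff_single,
      coeff_single]
    split_ifs
    · rw [D₀_map]
    · rw [map_zero]
  · have key : ∀ (d : Derivation ℤ N N) (m n : ℤ) (x y : N), d x = y →
        d ((single m x).coeff n) = (single m y).coeff n := by
      intro d m n x y hd
      rw [coeff_single, coeff_single]
      split_ifs
      · exact hd
      · exact map_zero d
    rintro x (rfl | rfl)
    · ext n
      rw [D_Y, Ψ_Y, Ψ_Z, coeff_seriesD, key _ _ _ _ _ M.D₁_Y, key _ _ _ _ _ M.D₀_Y,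
        key _ _ _ _ _ M.D₃_Y]
      simp only [single_eq_zero, coeff_zero, add_zero, coeff_single]
      congr 1
      simp; omega
    · ext n
      rw [D_Z, map_add, map_mul, map_pow, Ψ_Y, Ψ_Z, Ψ_map, coeff_seriesD, key _ _ _ _ _ M.D₁_Z,
        key _ _ _ _ _ M.D₀_Z, key _ _ _ _ _ M.D₃_Z, map_ofNat, single_pow, C_apply]
      rw [show (6 : HahnSeries ℤ N) = C 6 by rw [map_ofNat], C_apply, single_mul_single]
      simp only [single_eq_zero, coeff_zero, add_zero, coeff_single, coeff_add]
      have e1 : (n + 1 = -3) ↔ n = 0 + 2 • (-2) := by simp; omega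
      have e2 : (n - 3 = -3) ↔ n = 0 := by omega
      simp only [e1, e2]
      split_ifs <;> rfl

omit [CharZero K] in
theorem coeff_Ψ_D (f : N) (n : ℤ) : (M.Ψ (M.D f)).coeff n = M.D₁ ((M.Ψ f).coeff (n + 1)) +
    M.D₀ ((M.Ψ f).coeff n) + M.D₃ ((M.Ψ f).coeff (n - 3)) := by
  rw [Ψ_D, coeff_seriesD]

omit [CharZero K] in
theorem E_coeff_Ψ (f : N) (n : ℤ) :
    M.E ((M.Ψ f).coeff n) = ((-n : ℤ) : N) * (M.Ψ f).coeff n := by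
  have h : M.Ψ ((0 : Derivation ℤ N N) f) =
      (mapDerivation ℤ M.E + eulerDerivation (Int.castAddHom N)) (M.Ψ f) := by
    refine Derivation.map_comp_eq_of_adjoin_eq_top M.Ψ 0 _ M.adjoin_eq_top ?_ ?_ f
    · intro a
      ext n
      rw [Ψ_map, C_apply]
      simp only [Derivation.zero_apply, map_zero, coeff_zero, Derivation.add_apply, coeff_add,
        coeff_mapDerivation, coeff_eulerDerivation, coeff_single]
      split_ifs with hn
      · simp [hn, M.E_map]
      · simp
    · rintro x (rfl | rfl)
      · ext n
        rw [Ψ_Y]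
        simp only [Derivation.zero_apply, map_zero, coeff_zero, Derivation.add_apply, coeff_add,
          coeff_mapDerivation, coeff_eulerDerivation, coeff_single]
        split_ifs with hn
        · simp [hn, M.E_Y]
        · simp
      · ext n
        rw [Ψ_Z]
        simp only [Derivation.zero_apply, map_zero, coeff_zero, Derivation.add_apply, coeff_add,
          coeff_mapDerivation, coeff_eulerDerivation, coeff_single]
        split_ifs with hn
        · simp [hn, M.E_Z]
        · simp
  have h1 := congrArg (fun x => x.coeff n) h
  simp only [Derivation.zero_apply, map_zero, coeff_zero, Derivation.add_apply, coeff_add,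
    coeff_mapDerivation, coeff_eulerDerivation, Int.coe_castAddHom] at h1
  rw [eq_neg_of_add_eq_zero_left h1.symm]
  push_cast; ring

end Series

section Darboux

variable [IsAlgClosed K]

omit [IsAlgClosed K] in
theorem eq_zero_of_D₁_eq_zero {f : N} {m : ℤ} (hm : ¬ 6 ∣ m) (hf : M.E f = m * f)
    (h : M.D₁ f = 0) : f = 0 := by
  by_contra hf0
  obtain ⟨a, l, -, rfl, -⟩ := M.exists_eq_zpow_H hf0 hf h
  exact hm ⟨l, rfl⟩

omit [IsAlgClosed K] in
theorem eq_of_D₁_eq {f g : N} {m : ℤ} (hm : ¬ 6 ∣ m) (hf : M.E f = m * f) (hg : M.E g = m * g)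
    (h : M.D₁ f = M.D₁ g) : f = g :=
  sub_eq_zero.1 <| M.eq_zero_of_D₁_eq_zero hm (by rw [map_sub, hf, hg, mul_sub])
    (by rw [map_sub, h, sub_self])

omit [IsAlgClosed K] in
theorem D₃_zpow_H (l : ℤ) :
    M.D₃ (M.H ^ l) = 2 * l * algebraMap K N t * M.H ^ (l - 1) * M.Z := by
  rw [Derivation.leibniz_zpow, D₃_H, smul_eq_mul, zsmul_eq_mul]; ring

omit [IsAlgClosed K] in
theorem D₀_zpow_H (l : ℤ) : M.D₀ (M.H ^ l) = 0 := by
  rw [Derivation.leibniz_zpow, D₀_H, smul_zero, smul_zero]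

theorem order_eq_zero_of_seriesD_eq_mul (ht : δ t = 1) {f : HahnSeries ℤ N} (hf0 : f ≠ 0)
    (hE : ∀ n, M.E (f.coeff n) = ((-n : ℤ) : N) * f.coeff n) {q : K}
    (h : M.seriesD f = C (algebraMap K N q) * f) : f.order = 0 := by
  have := M.charZero
  obtain ⟨r, hr⟩ : ∃ r, f.order = r := ⟨_, rfl⟩
  have hc : ∀ n, M.D₁ (f.coeff (n + 1)) + M.D₀ (f.coeff n) + M.D₃ (f.coeff (n - 3)) =
      algebraMap K N q * f.coeff n := by
    intro n
    rw [← coeff_seriesD, h, C_apply, coeff_single_zero_mul]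
  have hlow : ∀ n < r, f.coeff n = 0 := fun n hn => coeff_eq_zero_of_lt_order (hr ▸ hn)
  have hfr : f.coeff r ≠ 0 := hr ▸ coeff_order_eq_zero.not.2 hf0
  have h0 := hc (r - 1)
  rw [sub_add_cancel, hlow (r - 1) (by omega), hlow (r - 1 - 3) (by omega)] at h0
  simp only [map_zero, add_zero, mul_zero] at h0
  obtain ⟨a, l, ha, hrl, hfa⟩ := M.exists_eq_zpow_H hfr (hE r) h0
  have hrl' : r = - (6 * l) := by omega
  subst hrl'
  have hHl : M.H ^ l = M.H ^ (l - 1) * M.H := by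
    rw [← zpow_add_one₀ M.H_ne_zero, sub_add_cancel]
  have h1 := hc (-(6 * l))
  rw [hlow (-(6 * l) - 3) (by omega), hfa] at h1
  simp only [map_zero, add_zero, Derivation.leibniz, M.D₀_zpow_H, smul_eq_mul, mul_zero,
    zero_add, M.D₀_map] at h1
  have h1' : M.D₁ (f.coeff (-(6 * l) + 1)) = algebraMap K N (q * a - δ a) * M.H ^ l := by
    rw [map_sub, map_mul]; linear_combination h1
  have hδ := M.eq_zero_of_D₁_eq (by rw [hE]; push_cast; ring) h1'
  have hδ' : δ a = q * a := (sub_eq_zero.1 hδ).symm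
  rw [hδ, map_zero, zero_mul] at h1'
  have f1 := M.eq_zero_of_D₁_eq_zero (by omega) (hE _) h1'
  have h2 := hc (-(6 * l) + 1)
  rw [f1, hlow (-(6 * l) + 1 - 3) (by omega)] at h2
  simp only [map_zero, add_zero, mul_zero] at h2
  have f2 := M.eq_zero_of_D₁_eq_zero (by omega) (hE _) h2
  have h3 := hc (-(6 * l) + 1 + 1)
  rw [f2, hlow (-(6 * l) + 1 + 1 - 3) (by omega)] at h3
  simp only [map_zero, add_zero, mul_zero] at h3
  have f3 := M.eq_zero_of_D₁_eq_zero (by omega) (hE _) h3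
  have h4 := hc (-(6 * l) + 1 + 1 + 1)
  rw [f3, show (-(6 * l) + 1 + 1 + 1 - 3) = -(6 * l) by ring, hfa] at h4
  simp only [map_zero, add_zero, mul_zero, Derivation.leibniz, M.D₃_zpow_H, M.D₃_map,
    smul_eq_mul] at h4
  have f4 : f.coeff (-(6 * l) + 1 + 1 + 1 + 1) =
      algebraMap K N (-2 * l * a * t) * M.H ^ (l - 1) * M.Y := by
    refine M.eq_of_D₁_eq (m := 6 * l - 4) (by omega) (by rw [hE]; push_cast; ring) ?_ ?_
    · simp only [Derivation.leibniz, M.E_map, M.E_zpow_H, M.E_Y, smul_eq_mul]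
      push_cast; ring
    · simp only [Derivation.leibniz, M.D₁_map, M.D₁_zpow_H, M.D₁_Y, smul_eq_mul]
      simp only [map_mul, map_neg, map_ofNat, map_intCast]
      linear_combination h4
  have h5 := hc (-(6 * l) + 1 + 1 + 1 + 1)
  rw [f4, show (-(6 * l) + 1 + 1 + 1 + 1 - 3) = -(6 * l) + 1 by ring, f1] at h5
  simp only [map_zero, add_zero, Derivation.leibniz, M.D₀_zpow_H, M.D₀_map, M.D₀_Y, smul_eq_mul,
    ht, hδ'] at h5
  have h5' : M.D₁ (f.coeff (-(6 * l) + 1 + 1 + 1 + 1 + 1)) =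
      algebraMap K N (2 * l * a) * M.H ^ (l - 1) * M.Y := by
    have h2' : δ (-2) = 0 := by
      rw [map_neg, Derivation.map_ofNat_eq_zero, neg_zero]
    simp only [map_mul, map_neg, map_ofNat, map_intCast, map_add, map_one, map_zero,
      Derivation.map_intCast, h2'] at h5 ⊢
    linear_combination h5
  have := M.eq_zero_of_D₁_eq_mul_Y (by rw [hE]; push_cast; ring) h5'
  have hl : (l : K) = 0 := by simpa [ha] using this
  have hl' : l = 0 := by exact_mod_cast hl
  rw [hr, hl']; simp

end Darboux

section Polynomial

omit [CharZero K] in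
theorem Ψ_aeval (p : MvPolynomial (Fin 2) K) (m : ℕ) :
    (M.Ψ (MvPolynomial.aeval ![M.Y, M.Z] p)).coeff (-m) =
      MvPolynomial.aeval ![M.Y, M.Z] (MvPolynomial.weightedHomogeneousComponent ![2, 3] m p) := by
  rw [← coeff_eval₂_single]
  congr 1
  rw [MvPolynomial.aeval_def, MvPolynomial.hom_eval₂]
  congr 1
  · ext1 a; exact M.Ψ_map a
  · ext1 i; fin_cases i
    · exact M.Ψ_Y
    · exact M.Ψ_Z

omit [CharZero K] in
theorem eq_C_of_Ψ_aeval {p : MvPolynomial (Fin 2) K}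
    (h : ∀ m : ℕ, 0 < m → (M.Ψ (MvPolynomial.aeval ![M.Y, M.Z] p)).coeff (-m) = 0) :
    ∃ a, p = MvPolynomial.C a := by
  refine ⟨MvPolynomial.coeff 0 p, ?_⟩
  have hw : MvPolynomial.weightedHomogeneousComponent ![2, 3] 0 p =
      MvPolynomial.C (MvPolynomial.coeff 0 p) := by
    refine MvPolynomial.weightedHomogeneousComponent_zero p ?_
    intro i; fin_cases i <;> simp
  rw [← hw]
  conv_lhs => rw [← MvPolynomial.sum_weightedHomogeneousComponent ![2, 3] p]
  rw [finsum_eq_single _ 0]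
  · intro m hm
    exact M.indep.eq_zero_of_aeval_eq_zero _ (by rw [← Ψ_aeval, h m (Nat.pos_of_ne_zero hm)])

end Polynomial

end PainleveModel

end

open HahnSeries in
theorem PainleveModel.exists_eq_C_of_D_aeval {K N : Type*} [Field K] [CharZero K] [IsAlgClosed K]
    [Field N] [Algebra K N] {δ : Derivation ℤ K K} {t : K} (M : PainleveModel N δ t) (ht : δ t = 1)
    {p q : MvPolynomial (Fin 2) K} (hp : p ≠ 0)
    (h : M.D (MvPolynomial.aeval ![M.Y, M.Z] p) =
      MvPolynomial.aeval ![M.Y, M.Z] q * MvPolynomial.aeval ![M.Y, M.Z] p) :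
    ∃ a, p = MvPolynomial.C a := by
  set f := MvPolynomial.aeval ![M.Y, M.Z] p with hf
  have hf0 : f ≠ 0 := fun h0 => hp (M.indep.eq_zero_of_aeval_eq_zero _ h0)
  have hΨ0 : M.Ψ f ≠ 0 := (map_ne_zero M.Ψ).2 hf0
  have h1 : M.seriesD (M.Ψ f) = M.Ψ (MvPolynomial.aeval ![M.Y, M.Z] q) * M.Ψ f := by
    rw [← Ψ_D, h, map_mul]
  have hq : ∃ a, q = MvPolynomial.C a := by
    refine M.eq_C_of_Ψ_aeval fun m hm => ?_
    obtain rfl | hm2 : m = 1 ∨ 2 ≤ m := by omega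
    · rw [Ψ_aeval]
      convert! map_zero (MvPolynomial.aeval ![M.Y, M.Z])
      ext e
      rw [MvPolynomial.coeff_weightedHomogeneousComponent, MvPolynomial.coeff_zero, if_neg]
      rw [Finsupp.weight_apply, Finsupp.sum_fintype _ _ (by simp), Fin.sum_univ_two]
      simp
      omega
    · by_contra hne
      have hΨq : M.Ψ (MvPolynomial.aeval ![M.Y, M.Z] q) ≠ 0 := by
        intro h0; rw [h0] at hne; exact hne rfl
      have h2 := order_le_of_coeff_ne_zero hne
      have h3 : (M.seriesD (M.Ψ f)).order =
        (M.Ψ (MvPolynomial.aeval ![M.Y, M.Z] q)).order + (M.Ψ f).order := by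
        rw [h1, order_mul hΨq hΨ0]
      have h4 : M.seriesD (M.Ψ f) ≠ 0 := h1 ▸ mul_ne_zero hΨq hΨ0
      apply coeff_order_eq_zero.not.2 h4
      rw [coeff_seriesD, coeff_eq_zero_of_lt_order, coeff_eq_zero_of_lt_order,
        coeff_eq_zero_of_lt_order]
      · simp
      all_goals omega
  obtain ⟨a, rfl⟩ := hq
  rw [MvPolynomial.aeval_C, Ψ_map] at h1
  have h0 := M.order_eq_zero_of_seriesD_eq_mul ht hΨ0 (M.E_coeff_Ψ f) h1
  exact M.eq_C_of_Ψ_aeval fun m hm => coeff_eq_zero_of_lt_order (by rw [← hf, h0]; omega)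

theorem algebraicIndependent_pair_iff {R A : Type*} [CommRing R] [CommRing A] [Algebra R A]
    {a b : A} : AlgebraicIndependent R ![a, b] ↔
      Transcendental R a ∧ Transcendental (Algebra.adjoin R {a}) b := by
  rw [← algebraicIndependent_iff_transcendental (x := a)]
  have h := AlgebraicIndependent.option_iff (R := R) (x := ![a]) (a := b)
  rw [show Set.range ![a] = {a} by simp] at h
  refine Iff.trans ?_ h
  let e : Option (Fin 1) ≃ Fin 2 := (finSuccEquivLast (n := 1)).symm
  rw [← algebraicIndependent_equiv e]
  have he : ![a, b] ∘ e = fun o => o.elim b ![a] := by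
    ext (_ | i)
    · rfl
    · fin_cases i; rfl
  rw [he]

namespace PainleveI

variable {K : Type*} [Field K]

theorem exists_derivation (δ : Derivation ℤ K K) (t : K) :
    ∃ d : Derivation ℤ (MvPolynomial (Fin 2) K) (MvPolynomial (Fin 2) K),
      (∀ a, d (MvPolynomial.C a) = MvPolynomial.C (δ a)) ∧
      d (MvPolynomial.X 0) = MvPolynomial.X 1 ∧
      d (MvPolynomial.X 1) = 6 * MvPolynomial.X 0 ^ 2 + MvPolynomial.C t := by
  let δ' : Derivation ℤ K (MvPolynomial (Fin 2) K) :=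
    ((Algebra.linearMap K (MvPolynomial (Fin 2) K))).compDer δ
  obtain ⟨d, h1, h2, h3⟩ := Derivation.exists_mvPolynomial δ' MvPolynomial.X
    ![MvPolynomial.X 1, 6 * MvPolynomial.X 0 ^ 2 + MvPolynomial.C t]
  refine ⟨Derivation.mk' d.toIntLinearMap fun p q => ?_, h2, h3 0, h3 1⟩
  simpa using h1 p q

theorem aeval_derivation {δ : Derivation ℤ K K} {t : K}
    {d : Derivation ℤ (MvPolynomial (Fin 2) K) (MvPolynomial (Fin 2) K)}
    (hC : ∀ a, d (MvPolynomial.C a) = MvPolynomial.C (δ a))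
    (h0 : d (MvPolynomial.X 0) = MvPolynomial.X 1)
    (h1 : d (MvPolynomial.X 1) = 6 * MvPolynomial.X 0 ^ 2 + MvPolynomial.C t)
    {F : Type*} [Field F] [Algebra K F] {D : Derivation ℤ F F}
    (hD : ∀ a, D (algebraMap K F a) = algebraMap K F (δ a)) {y z : F} (hy : D y = z)
    (hz : D z = 6 * y ^ 2 + algebraMap K F t) (p : MvPolynomial (Fin 2) K) :
    MvPolynomial.aeval ![y, z] (d p) = D (MvPolynomial.aeval ![y, z] p) := by
  induction p using MvPolynomial.induction_on with
  | C a => rw [hC, MvPolynomial.aeval_C, MvPolynomial.aeval_C, hD]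
  | add p q hp hq => simp only [map_add, hp, hq]
  | mul_X p i hp =>
    have : MvPolynomial.aeval ![y, z] (d (MvPolynomial.X i)) = D (![y, z] i) := by
      fin_cases i
      · simp [h0, hy]
      · simp [h1, hz, map_ofNat]
    simp only [Derivation.leibniz, map_add, smul_eq_mul, map_mul, hp, this, MvPolynomial.aeval_X]

theorem algebraicIndependent_of_transcendental [CharZero K] [IsAlgClosed K]
    {δ : Derivation ℤ K K} {t : K} (ht : δ t = 1) {F : Type*} [Field F] [Algebra K F]
    {D : Derivation ℤ F F} (hD : ∀ a, D (algebraMap K F a) = algebraMap K F (δ a)) {y z : F}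
    (hy : D y = z) (hz : D z = 6 * y ^ 2 + algebraMap K F t) (htr : Transcendental K y) :
    AlgebraicIndependent K ![y, z] := by
  by_contra hdep
  obtain ⟨d, hC, h0, h1⟩ := exists_derivation δ t
  set ev := MvPolynomial.aeval (R := K) ![y, z] with hev
  have hne : RingHom.ker ev ≠ ⊥ := by
    rw [algebraicIndependent_iff_injective_aeval, RingHom.injective_iff_ker_eq_bot] at hdep
    exact hdep
  obtain ⟨P, hP, hPp⟩ := Ideal.IsPrime.exists_mem_prime_of_ne_bot (RingHom.ker_isPrime ev) hne
  rw [RingHom.mem_ker] at hP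
  have hdvd : ∀ Q, ev Q = 0 → P ∣ Q := by
    intro Q hQ
    by_contra hPQ
    let I := Ideal.span {P}
    have hI : I.IsPrime := (Ideal.span_singleton_prime hPp.ne_zero).2 hPp
    let A := MvPolynomial (Fin 2) K ⧸ I
    let x : Fin 2 → A := fun i => Ideal.Quotient.mk I (MvPolynomial.X i)
    have hmk : ∀ q, Ideal.Quotient.mk I q = MvPolynomial.aeval ![x 0, x 1] q := by
      intro q
      have : (Ideal.Quotient.mkₐ K I) = MvPolynomial.aeval ![x 0, x 1] := by
        ext i; fin_cases i <;> simp [x]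
      exact congrArg (fun f => f q) this
    have hpoly : ∀ (c : Polynomial K), Ideal.Quotient.mk I (Polynomial.aeval (MvPolynomial.X 0) c) =
        Polynomial.aeval (x 0) c := by
      intro c
      rw [hmk, ← Polynomial.aeval_algHom_apply]
      simp
    have hevpoly : ∀ (c : Polynomial K), ev (Polynomial.aeval (MvPolynomial.X 0) c) =
        Polynomial.aeval y c := by
      intro c
      rw [← Polynomial.aeval_algHom_apply]
      simp [ev]
    have hevI : ∀ q, Ideal.Quotient.mk I q = 0 → ev q = 0 := by
      intro q hq
      obtain ⟨g, rfl⟩ := Ideal.mem_span_singleton.1 (Ideal.Quotient.eq_zero_iff_mem.1 hq)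
      rw [map_mul, hP, zero_mul]
    have hx0 : Transcendental K (x 0) := by
      rintro ⟨c, hc0, hc⟩
      exact htr ⟨c, hc0, by rw [← hevpoly, hevI _ (by rw [hpoly, hc])]⟩
    have hx1 : IsAlgebraic (Algebra.adjoin K {x 0}) (x 1) := by
      by_contra hx1
      have := algebraicIndependent_pair_iff.2 ⟨hx0, hx1⟩
      refine hPp.ne_zero (this.eq_zero_of_aeval_eq_zero P ?_)
      rw [← hmk]
      exact Ideal.Quotient.eq_zero_iff_mem.2 (Ideal.mem_span_singleton_self P)
    have halg : ∀ q, IsAlgebraic (Algebra.adjoin K {x 0}) (Ideal.Quotient.mk I q) := by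
      intro q
      induction q using MvPolynomial.induction_on with
      | C a =>
        exact isAlgebraic_algebraMap (algebraMap K (Algebra.adjoin K {x 0}) a)
      | add p q hp hq => rw [map_add]; exact hp.add hq
      | mul_X p i hp =>
        rw [map_mul]
        refine hp.mul ?_
        fin_cases i
        · exact isAlgebraic_algebraMap
            (⟨x 0, Algebra.self_mem_adjoin_singleton K _⟩ : Algebra.adjoin K {x 0})
        · exact hx1
    have hQ0 : Ideal.Quotient.mk I Q ≠ 0 := fun h =>
      hPQ (Ideal.mem_span_singleton.1 (Ideal.Quotient.eq_zero_iff_mem.1 h))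
    obtain ⟨⟨s, hs⟩, hs0, hsd⟩ := (halg Q).exists_nonzero_dvd (mem_nonZeroDivisors_of_ne_zero hQ0)
    rw [Algebra.adjoin_singleton_eq_range_aeval] at hs
    obtain ⟨c, rfl⟩ := hs
    obtain ⟨g, hg⟩ := hsd
    obtain ⟨G, rfl⟩ := Ideal.Quotient.mk_surjective g
    have hc : Polynomial.aeval y c = 0 := by
      have := hevI (Polynomial.aeval (MvPolynomial.X 0) c - Q * G) (by
        rw [map_sub, hpoly, map_mul, ← hg]; exact sub_self _)
      rwa [map_sub, map_mul, hQ, zero_mul, sub_zero, hevpoly] at this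
    refine htr ⟨c, ?_, hc⟩
    rintro rfl
    exact hs0 (Subtype.ext (map_zero _))
  obtain ⟨Q, hQ⟩ := hdvd (d P) (by
    rw [hev, aeval_derivation hC h0 h1 hD hy hz, ← hev, hP, map_zero])
  let N := FractionRing (MvPolynomial (Fin 2) K)
  let φ : MvPolynomial (Fin 2) K →ₐ[K] N := IsScalarTower.toAlgHom K _ N
  have hφ : Function.Injective φ := IsFractionRing.injective _ N
  let Y : N := φ (MvPolynomial.X 0)
  let Z : N := φ (MvPolynomial.X 1)
  have hφe : ∀ p, MvPolynomial.aeval ![Y, Z] p = φ p := by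
    intro p
    congr 1
    ext i; fin_cases i <;> simp [Y, Z]
  have hYZ : AlgebraicIndependent K ![Y, Z] := by
    rw [algebraicIndependent_iff_injective_aeval]
    intro p q hpq
    rw [hφe, hφe] at hpq
    exact hφ hpq
  have htop : IntermediateField.adjoin K {Y, Z} = ⊤ := by
    rw [eq_top_iff]
    rintro n -
    obtain ⟨p, q, -, rfl⟩ := IsFractionRing.div_surjective (A := MvPolynomial (Fin 2) K) n
    have hmem : ∀ p : MvPolynomial (Fin 2) K, algebraMap _ N p ∈
        IntermediateField.adjoin K {Y, Z} := by
      intro p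
      have : algebraMap _ N p = MvPolynomial.aeval ![Y, Z] p := (hφe p).symm
      rw [this]
      have hr : Set.range ![Y, Z] = {Y, Z} := by simp [Matrix.range_cons, Set.pair_comm]
      refine IntermediateField.algebra_adjoin_le_adjoin K _ ?_
      rw [← hr, Algebra.adjoin_range_eq_range_aeval]
      exact ⟨p, rfl⟩
    exact div_mem (hmem p) (hmem q)
  obtain ⟨M, hMY, hMZ⟩ := PainleveModel.exists_of_algebraicIndependent δ t hYZ htop
  obtain ⟨a, rfl⟩ := M.exists_eq_C_of_D_aeval ht hPp.ne_zero (q := Q) (by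
    rw [← aeval_derivation hC h0 h1 M.D_map M.D_Y M.D_Z, hQ, map_mul, mul_comm])
  refine hPp.not_isUnit (IsUnit.map _ (IsUnit.mk0 a ?_))
  rintro rfl
  exact hPp.ne_zero (map_zero _)

end PainleveI

section

open HahnSeries

namespace PainleveModel

variable {K N : Type*} [Field K] [CharZero K] [Field N] [Algebra K N]
  {δ : Derivation ℤ K K} {t : K} (M : PainleveModel N δ t)

omit [CharZero K] in
theorem E_D₁ (f : N) : M.E (M.D₁ f) = M.D₁ (M.E f) + M.D₁ f := by
  have h := Derivation.map_comp_eq_of_adjoin_eq_top (RingHom.id N) ⁅M.E, M.D₁⁆ M.D₁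
    M.adjoin_eq_top (fun a => by simp [Derivation.commutator_apply, M.E_map, M.D₁_map]) (by
      have h6 := M.E.map_ofNat_eq_zero 6
      have h2 := M.D₁.map_ofNat_eq_zero 2
      have h3 := M.D₁.map_ofNat_eq_zero 3
      rintro x (rfl | rfl)
      · simp only [RingHom.id_apply, Derivation.commutator_apply, M.D₁_Y, M.E_Y, M.E_Z,
          Derivation.leibniz, smul_eq_mul, h2]
        ring
      · simp only [RingHom.id_apply, Derivation.commutator_apply, M.D₁_Z, M.E_Y, M.E_Z,
          Derivation.leibniz, Derivation.leibniz_pow, smul_eq_mul, nsmul_eq_mul, h3, h6]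
        push_cast; ring) f
  simp only [RingHom.id_apply, Derivation.commutator_apply] at h
  linear_combination h

omit [CharZero K] in
theorem E_D₁_of_E_eq {f : N} {m : ℤ} (hf : M.E f = m * f) :
    M.E (M.D₁ f) = ((m + 1 : ℤ) : N) * M.D₁ f := by
  rw [E_D₁, hf, Derivation.leibniz, Derivation.map_intCast, smul_zero, add_zero, smul_eq_mul]
  push_cast; ring

omit [CharZero K] in
theorem low_Ψ_D {p : ℤ} {f : N} (hf : Low p (M.Ψ f)) : Low (p - 1) (M.Ψ (M.D f)) := fun i hi => by
  rw [coeff_Ψ_D, hf _ (by omega), hf _ (by omega), hf _ (by omega)]; simp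

omit [CharZero K] in
theorem coeff_Ψ_D_of_low {p : ℤ} {f : N} (hf : Low p (M.Ψ f)) :
    (M.Ψ (M.D f)).coeff (p - 1) = M.D₁ ((M.Ψ f).coeff p) := by
  rw [coeff_Ψ_D, hf (p - 1) (by omega), hf (p - 1 - 3) (by omega)]; simp

omit [CharZero K] in
theorem coeff_Ψ_map (a : K) {n : ℤ} (hn : n ≠ 0) : (M.Ψ (algebraMap K N a)).coeff n = 0 := by
  rw [Ψ_map, C_apply, coeff_single_of_ne hn]

omit [CharZero K] in
theorem coeff_zero_Ψ_map (a : K) : (M.Ψ (algebraMap K N a)).coeff 0 = algebraMap K N a := by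
  rw [Ψ_map, C_apply, coeff_single_same]

omit [CharZero K] in
theorem coeff_Ψ_map_mul (a : K) (f : N) (n : ℤ) :
    (M.Ψ (algebraMap K N a * f)).coeff n = algebraMap K N a * (M.Ψ f).coeff n := by
  rw [map_mul, Ψ_map, C_apply, coeff_single_zero_mul]

omit [CharZero K] in
theorem coeff_Ψ_natCast_mul (a : ℕ) (f : N) (n : ℤ) :
    (M.Ψ (a * f)).coeff n = a * (M.Ψ f).coeff n := by
  have := M.coeff_Ψ_map_mul a f n
  rwa [map_natCast] at this

omit [CharZero K] in
theorem coeff_Ψ_ofNat_mul (a : ℕ) [a.AtLeastTwo] (f : N) (n : ℤ) :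
    (M.Ψ (ofNat(a) * f)).coeff n = ofNat(a) * (M.Ψ f).coeff n := by
  exact M.coeff_Ψ_natCast_mul (OfNat.ofNat a) f n

variable {v : N}

theorem low_of_D_D_eq (hv : M.D (M.D v) = 6 * v ^ 2 + algebraMap K N t) : Low (-2) (M.Ψ v) := by
  have := M.charZero
  by_contra hlow
  have h0 : M.Ψ v ≠ 0 := by rintro h; rw [h] at hlow; exact hlow (Low.zero _)
  obtain ⟨r, hr⟩ : ∃ r, (M.Ψ v).order = r := ⟨_, rfl⟩
  have hvr : (M.Ψ v).coeff r ≠ 0 := hr ▸ coeff_order_eq_zero.not.2 h0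
  have hlr : Low r (M.Ψ v) := fun n hn => coeff_eq_zero_of_lt_order (hr ▸ hn)
  have hr2 : r < -2 := by
    by_contra h; exact hlow (hlr.mono (by omega))
  have h1 := congrArg (fun f => (M.Ψ f).coeff (r + r)) hv
  simp only [map_add, coeff_add] at h1
  rw [M.low_Ψ_D (M.low_Ψ_D hlr) _ (by omega), coeff_Ψ_map _ _ (by omega), coeff_Ψ_ofNat_mul,
    sq, map_mul, hlr.coeff_mul hlr, add_zero] at h1
  have : (6 : N) ≠ 0 := by norm_num
  simp_all

theorem D₁_D₁_coeff (hv : M.D (M.D v) = 6 * v ^ 2 + algebraMap K N t) :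
    M.D₁ (M.D₁ ((M.Ψ v).coeff (-2))) = 6 * (M.Ψ v).coeff (-2) ^ 2 := by
  have hl := M.low_of_D_D_eq hv
  have h1 := congrArg (fun f => (M.Ψ f).coeff (-2 - 1 - 1)) hv
  simp only [map_add, coeff_add] at h1
  rw [M.coeff_Ψ_D_of_low (M.low_Ψ_D hl), M.coeff_Ψ_D_of_low hl, coeff_Ψ_map _ _ (by omega),
    coeff_Ψ_ofNat_mul, sq, map_mul, show (-2 - 1 - 1 : ℤ) = -2 + -2 by rfl, hl.coeff_mul hl] at h1
  rw [h1]; ring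

variable [IsAlgClosed K]

/-- A solution without polar part is constant. -/
theorem exists_algebraMap_eq_of_coeff_eq_zero (ht : δ t = 1)
    (hv : M.D (M.D v) = 6 * v ^ 2 + algebraMap K N t) (hv2 : (M.Ψ v).coeff (-2) = 0) :
    ∃ a, v = algebraMap K N a := by
  have := M.charZero
  have hl2 := M.low_of_D_D_eq hv
  have hl1 : Low (-1) (M.Ψ v) := fun i hi => by
    obtain rfl | hi : i = -2 ∨ i < -2 := by omega
    · exact hv2
    · exact hl2 i hi
  have hsq : ∀ p n : ℤ, Low p (M.Ψ v) → n < p + p → (M.Ψ (6 * v ^ 2)).coeff n = 0 := by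
    intro p n hp hn
    rw [coeff_Ψ_ofNat_mul, sq, map_mul, hp.mul hp n hn, mul_zero]
  have h1 := congrArg (fun f => (M.Ψ f).coeff (-1 - 1 - 1)) hv
  simp only [map_add, coeff_add] at h1
  rw [M.coeff_Ψ_D_of_low (M.low_Ψ_D hl1), M.coeff_Ψ_D_of_low hl1, coeff_Ψ_map _ _ (by omega),
    hsq _ _ hl1 (by omega), add_zero] at h1
  have hv1 := M.eq_zero_of_D₁_eq_zero (by decide) (M.E_coeff_Ψ v (-1))
    (M.eq_zero_of_D₁_eq_zero (by decide) (M.E_D₁_of_E_eq (M.E_coeff_Ψ v (-1))) h1)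
  have hl0 : Low 0 (M.Ψ v) := fun i hi => by
    obtain rfl | hi : i = -1 ∨ i < -1 := by omega
    · exact hv1
    · exact hl1 i hi
  have h2 := congrArg (fun f => (M.Ψ f).coeff (0 - 1 - 1)) hv
  simp only [map_add, coeff_add] at h2
  rw [M.coeff_Ψ_D_of_low (M.low_Ψ_D hl0), M.coeff_Ψ_D_of_low hl0, coeff_Ψ_map _ _ (by omega),
    hsq _ _ hl0 (by omega), add_zero] at h2
  obtain ⟨a, ha⟩ := M.exists_algebraMap_eq (by simpa using M.E_coeff_Ψ v 0)
    (M.eq_zero_of_D₁_eq_zero (by decide) (M.E_D₁_of_E_eq (M.E_coeff_Ψ v 0)) h2)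
  refine ⟨a, ?_⟩
  by_contra hne
  set e := v - algebraMap K N a with he
  have he0 : M.Ψ e ≠ 0 := (map_ne_zero M.Ψ).2 (sub_ne_zero.2 hne)
  obtain ⟨r, hr⟩ : ∃ r, (M.Ψ e).order = r := ⟨_, rfl⟩
  have her : (M.Ψ e).coeff r ≠ 0 := hr ▸ coeff_order_eq_zero.not.2 he0
  have hlr : Low r (M.Ψ e) := fun n hn => coeff_eq_zero_of_lt_order (hr ▸ hn)
  have hl1 : Low 1 (M.Ψ e) := fun i hi => by
    rw [he, map_sub, coeff_sub]
    obtain rfl | hi : i = 0 ∨ i < 0 := by omega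
    · rw [coeff_zero_Ψ_map, ha, sub_self]
    · rw [coeff_Ψ_map _ _ hi.ne, hl0 i hi, sub_zero]
  have hr1 : 1 ≤ r := by
    by_contra h; exact her (hl1 r (by omega))
  set κ := 6 * a ^ 2 + t - δ (δ a) with hκ
  have heq : M.D (M.D e) = algebraMap K N κ + algebraMap K N (12 * a) * e + 6 * (e * e) := by
    rw [he, map_sub, map_sub, hv, D_map, D_map, hκ]
    simp only [map_add, map_sub, map_mul, map_pow, map_ofNat]
    ring
  have hw : ∀ n, (M.Ψ (M.D e)).coeff n = M.D₁ ((M.Ψ e).coeff (n + 1)) +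
    M.D₀ ((M.Ψ e).coeff n) + M.D₃ ((M.Ψ e).coeff (n - 3)) := M.coeff_Ψ_D e
  have hc : ∀ n, n < 2 * r → M.D₁ ((M.Ψ (M.D e)).coeff (n + 1)) +
      M.D₀ ((M.Ψ (M.D e)).coeff n) + M.D₃ ((M.Ψ (M.D e)).coeff (n - 3)) =
      (M.Ψ (algebraMap K N κ)).coeff n + algebraMap K N (12 * a) * (M.Ψ e).coeff n := by
    intro n hn
    rw [← coeff_Ψ_D, heq, map_add, map_add, coeff_add, coeff_add, coeff_Ψ_map_mul,
      coeff_Ψ_ofNat_mul, map_mul M.Ψ, hlr.mul hlr n (by omega), mul_zero, add_zero]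
  have hE := M.E_coeff_Ψ e
  have hE' := M.E_coeff_Ψ (M.D e)
  generalize (M.Ψ (M.D e)).coeff = w at hw hc hE'
  have hlr : ∀ i < r, (M.Ψ e).coeff i = 0 := hlr
  generalize (M.Ψ e).coeff = x at *
  have hwlow : ∀ i < r - 1, w i = 0 := fun i hi => by
    rw [hw, hlr _ (by omega), hlr _ (by omega), hlr _ (by omega)]; simp
  have hw1 : w (r - 1) = M.D₁ (x r) := by
    rw [hw, hlr (r - 1) (by omega), hlr (r - 1 - 3) (by omega)]; simp
  have h3 := hc (r - 1 - 1) (by omega)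
  rw [sub_add_cancel, hwlow (r - 1 - 1) (by omega), hwlow (r - 1 - 1 - 3) (by omega),
    hlr (r - 1 - 1) (by omega)] at h3
  simp only [map_zero, add_zero, mul_zero] at h3
  have h4 : M.D₁ (w (r - 1)) = 0 := by
    by_cases hr2 : r = 2
    · subst hr2
      have hk : κ = 0 := by
        refine M.eq_zero_of_D₁_eq (l := 0) (f := w (2 - 1)) (by rw [hE']; push_cast; ring) ?_
        rw [h3, zpow_zero, mul_one]
        exact M.coeff_zero_Ψ_map κ
      rw [h3, hk]; simp
    · rw [h3]; exact M.coeff_Ψ_map _ (by omega)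
  have h5 : M.D₁ (x r) = 0 := by
    by_contra h
    rw [← hw1] at h
    obtain ⟨b, l, hb, hrl, hwb⟩ := M.exists_eq_zpow_H h (hE' _) h4
    exact hb (M.eq_zero_of_D₁_eq (by rw [hE, show -r = 6 * l - 1 by omega]; push_cast; ring)
      (hw1 ▸ hwb))
  rw [h5] at hw1
  obtain ⟨γ, j, hγ, hrj, hxr⟩ := M.exists_eq_zpow_H her (hE r) h5
  obtain rfl : r = -(6 * j) := by omega
  have hk0 : κ = 0 := by
    have := hc 0 (by omega)
    rw [hwlow _ (by omega), hwlow _ (by omega), hwlow _ (by omega), hlr _ (by omega),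
      coeff_zero_Ψ_map] at this
    simpa using this.symm
  simp only [hk0, map_zero, coeff_zero, zero_add] at hc
  -- successive coefficients
  have d0 := hc (-(6 * j) - 1) (by omega)
  rw [sub_add_cancel, hw1, hwlow (-(6 * j) - 1 - 3) (by omega), hlr _ (by omega)] at d0
  simp only [map_zero, add_zero, mul_zero] at d0
  obtain ⟨c, hc0⟩ := M.exists_algebraMap_eq (f := w (-(6 * j)) / M.H ^ j) (by
    rw [M.E_div_zpow_H _ (hE' _)]; push_cast; ring) (by rw [D₁_div_zpow_H, d0, zero_div])
  have hHj := zpow_ne_zero j M.H_ne_zero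
  replace hc0 : w (-(6 * j)) = algebraMap K N c * M.H ^ j := by
    rw [hc0, div_mul_cancel₀ _ hHj]
  have f1 := hw (-(6 * j))
  rw [hlr (-(6 * j) - 3) (by omega), hxr, hc0] at f1
  simp only [map_zero, add_zero, Derivation.leibniz, M.D₀_zpow_H, smul_eq_mul, mul_zero,
    zero_add, M.D₀_map] at f1
  have f1' : M.D₁ (x (-(6 * j) + 1)) = algebraMap K N (c - δ γ) * M.H ^ j := by
    rw [map_sub]; linear_combination -f1
  have hcγ := M.eq_zero_of_D₁_eq (by rw [hE]; push_cast; ring) f1'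
  rw [hcγ, map_zero, zero_mul] at f1'
  obtain rfl : c = δ γ := sub_eq_zero.1 hcγ
  have x1 := M.eq_zero_of_D₁_eq_zero (by omega) (hE _) f1'
  have d1 := hc (-(6 * j)) (by omega)
  rw [hwlow (-(6 * j) - 3) (by omega), hxr, hc0] at d1
  simp only [map_zero, add_zero, Derivation.leibniz, M.D₀_zpow_H, smul_eq_mul, mul_zero,
    zero_add, M.D₀_map] at d1
  have d1' : M.D₁ (w (-(6 * j) + 1)) = algebraMap K N (12 * a * γ - δ (δ γ)) * M.H ^ j := by
    rw [map_sub, map_mul]; linear_combination d1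
  have hγ2 := M.eq_zero_of_D₁_eq (by rw [hE']; push_cast; ring) d1'
  rw [hγ2, map_zero, zero_mul] at d1'
  have w1 := M.eq_zero_of_D₁_eq_zero (by omega) (hE' _) d1'
  have f2 := hw (-(6 * j) + 1)
  rw [x1, w1, hlr (-(6 * j) + 1 - 3) (by omega)] at f2
  simp only [map_zero, add_zero] at f2
  have x2 := M.eq_zero_of_D₁_eq_zero (by omega) (hE _) f2.symm
  have d2 := hc (-(6 * j) + 1) (by omega)
  rw [x1, w1, hwlow (-(6 * j) + 1 - 3) (by omega)] at d2
  simp only [map_zero, add_zero, mul_zero] at d2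
  have w2 := M.eq_zero_of_D₁_eq_zero (by omega) (hE' _) d2
  have f3 := hw (-(6 * j) + 1 + 1)
  rw [x2, w2, hlr (-(6 * j) + 1 + 1 - 3) (by omega)] at f3
  simp only [map_zero, add_zero] at f3
  have x3 := M.eq_zero_of_D₁_eq_zero (by omega) (hE _) f3.symm
  have d3 := hc (-(6 * j) + 1 + 1) (by omega)
  rw [x2, w2, show -(6 * j) + 1 + 1 - 3 = -(6 * j) - 1 by ring, hw1] at d3
  simp only [map_zero, add_zero, mul_zero] at d3
  have w3 := M.eq_zero_of_D₁_eq_zero (by omega) (hE' _) d3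
  have f4 := hw (-(6 * j) + 1 + 1 + 1)
  rw [x3, w3, show -(6 * j) + 1 + 1 + 1 - 3 = -(6 * j) by ring, hxr] at f4
  simp only [map_zero, add_zero, mul_zero, Derivation.leibniz, M.D₃_zpow_H, M.D₃_map,
    smul_eq_mul] at f4
  have x4 : x (-(6 * j) + 1 + 1 + 1 + 1) =
      algebraMap K N (-2 * j * γ * t) * M.H ^ (j - 1) * M.Y := by
    refine M.eq_of_D₁_eq (m := 6 * j - 4) (by omega) (by rw [hE]; push_cast; ring) ?_ ?_
    · simp only [Derivation.leibniz, M.E_map, M.E_zpow_H, M.E_Y, smul_eq_mul]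
      push_cast; ring
    · simp only [Derivation.leibniz, M.D₁_map, M.D₁_zpow_H, M.D₁_Y, smul_eq_mul]
      simp only [map_mul, map_neg, map_ofNat, map_intCast]
      linear_combination -f4
  have d4 := hc (-(6 * j) + 1 + 1 + 1) (by omega)
  rw [x3, w3, show -(6 * j) + 1 + 1 + 1 - 3 = -(6 * j) by ring, hc0] at d4
  simp only [map_zero, add_zero, mul_zero, Derivation.leibniz, M.D₃_zpow_H, M.D₃_map,
    smul_eq_mul] at d4
  have w4 : w (-(6 * j) + 1 + 1 + 1 + 1) =
      algebraMap K N (-2 * j * δ γ * t) * M.H ^ (j - 1) * M.Y := by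
    refine M.eq_of_D₁_eq (m := 6 * j - 4) (by omega) (by rw [hE']; push_cast; ring) ?_ ?_
    · simp only [Derivation.leibniz, M.E_map, M.E_zpow_H, M.E_Y, smul_eq_mul]
      push_cast; ring
    · simp only [Derivation.leibniz, M.D₁_map, M.D₁_zpow_H, M.D₁_Y, smul_eq_mul]
      simp only [map_mul, map_neg, map_ofNat, map_intCast]
      linear_combination d4
  have f5 := hw (-(6 * j) + 1 + 1 + 1 + 1)
  rw [x4, w4, show (-(6 * j) + 1 + 1 + 1 + 1 - 3) = -(6 * j) + 1 by ring, x1] at f5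
  simp only [map_zero, add_zero, Derivation.leibniz, M.D₀_zpow_H, M.D₀_map, M.D₀_Y, smul_eq_mul,
    ht] at f5
  have f5' : M.D₁ (x (-(6 * j) + 1 + 1 + 1 + 1 + 1)) =
      algebraMap K N (2 * j * γ) * M.H ^ (j - 1) * M.Y := by
    have h2' : δ (-2) = 0 := by
      rw [map_neg, Derivation.map_ofNat_eq_zero, neg_zero]
    simp only [map_mul, map_neg, map_ofNat, map_intCast, map_add, map_one, map_zero,
      Derivation.map_intCast, h2'] at f5 ⊢
    linear_combination -f5
  have := M.eq_zero_of_D₁_eq_mul_Y (by rw [hE]; push_cast; ring) f5'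
  have hj : (j : K) = 0 := by simpa [hγ] using this
  have hj' : j = 0 := by exact_mod_cast hj
  omega

end PainleveModel

end

section

open Polynomial

theorem Polynomial.natDegree_eq_zero_of_X_mem_adjoin {K : Type*} [Field K] {a b : K[X]}
    (hab : IsCoprime a b) (ha : a ≠ 0) (hb : b ≠ 0) {c : K} (hc : c ≠ 0)
    (h : (RatFunc.X : RatFunc K) ∈ IntermediateField.adjoin K
      {algebraMap K[X] (RatFunc K) (X * a ^ 3) / algebraMap K[X] (RatFunc K) (C c * b ^ 3)}) :
    a.natDegree = 0 ∧ b.natDegree = 0 := by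
  set g := algebraMap K[X] (RatFunc K) (X * a ^ 3) / algebraMap K[X] (RatFunc K) (C c * b ^ 3)
    with hg
  have hcb : C c * b ^ 3 ≠ 0 := mul_ne_zero (C_ne_zero.2 hc) (pow_ne_zero _ hb)
  have htop : IntermediateField.adjoin K {g} = ⊤ := by
    rw [eq_top_iff]
    exact (RatFunc.adjoin_X (K := K)).ge.trans
      (IntermediateField.adjoin_simple_le_iff.2 h)
  have hdeg := RatFunc.finrank_eq_max_natDegree g
  rw [htop, IntermediateField.finrank_top] at hdeg
  have hX : (X : K[X]) ≠ 0 := X_ne_zero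
  have hd := RatFunc.num_div_denom g
  have heq : g.num * (C c * b ^ 3) = X * a ^ 3 * g.denom := by
    have h1 := RatFunc.algebraMap_ne_zero hcb
    have h2 := RatFunc.algebraMap_ne_zero g.denom_ne_zero
    have h3 : algebraMap K[X] (RatFunc K) g.num / algebraMap K[X] (RatFunc K) g.denom =
      algebraMap K[X] (RatFunc K) (X * a ^ 3) / algebraMap K[X] (RatFunc K) (C c * b ^ 3) := hd
    rw [div_eq_div_iff h2 h1, ← map_mul, ← map_mul] at h3
    exact RatFunc.algebraMap_injective K h3
  have hu : IsUnit (C c) := isUnit_C.2 hc.isUnit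
  have hnum0 : g.num ≠ 0 := by
    intro h0
    rw [h0, zero_mul] at heq
    exact mul_ne_zero (mul_ne_zero hX (pow_ne_zero _ ha)) g.denom_ne_zero heq.symm
  have hadvd : a ^ 3 ∣ g.num := by
    have h1 : a ^ 3 ∣ g.num * (C c * b ^ 3) := heq ▸ ⟨X * g.denom, by ring⟩
    refine IsCoprime.dvd_of_dvd_mul_right ?_ h1
    exact (isCoprime_mul_unit_left_right hu _ _).2 hab.pow
  have hbdvd : b ^ 3 ∣ X * g.denom := by
    refine IsCoprime.dvd_of_dvd_mul_right (x := b ^ 3) (y := X * g.denom) (z := a ^ 3) ?_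
      ⟨g.num * C c, by linear_combination -heq⟩
    exact hab.symm.pow
  have h1 := natDegree_le_of_dvd hadvd hnum0
  have h2 := natDegree_le_of_dvd hbdvd (mul_ne_zero hX g.denom_ne_zero)
  rw [natDegree_pow] at h1 h2
  rw [natDegree_mul hX g.denom_ne_zero, natDegree_X] at h2
  have h3 : g.num.natDegree ≤ 1 := hdeg ▸ le_max_left _ _
  have h4 : g.denom.natDegree ≤ 1 := hdeg ▸ le_max_right _ _
  omega

theorem Polynomial.natDegree_eq_zero_of_mem_adjoin {K N : Type*} [Field K] [Field N] [Algebra K N]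
    {S : N} (hS : Transcendental K S) {a b : K[X]}
    (hab : IsCoprime a b) (ha : a ≠ 0) (hb : b ≠ 0) {c : K} (hc : c ≠ 0)
    (h : S ∈ IntermediateField.adjoin K
      {S * (aeval S a / aeval S b) ^ 3 / algebraMap K N c}) :
    a.natDegree = 0 ∧ b.natDegree = 0 := by
  have hinj : Function.Injective (aeval S : K[X] →ₐ[K] N) := transcendental_iff_injective.1 hS
  let φ := RatFunc.liftAlgHom (aeval S : K[X] →ₐ[K] N)
    (nonZeroDivisors_le_comap_nonZeroDivisors_of_injective _ hinj)
  have hφX : φ RatFunc.X = S := by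
    have := RatFunc.liftAlgHom_apply_div (aeval S : K[X] →ₐ[K] N)
      (nonZeroDivisors_le_comap_nonZeroDivisors_of_injective _ hinj) X 1
    simpa using this
  refine natDegree_eq_zero_of_X_mem_adjoin hab ha hb hc ?_
  rw [← IntermediateField.map_mem_map _ φ, IntermediateField.adjoin_map, Set.image_singleton, hφX]
  convert h using 3
  rw [RatFunc.liftAlgHom_apply_div]
  simp only [map_mul, map_pow, aeval_X, aeval_C]
  field_simp

end

section

open HahnSeries

namespace PainleveModel

variable {K N : Type*} [Field K] [CharZero K] [Field N] [Algebra K N]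
  {δ : Derivation ℤ K K} {t : K} (M : PainleveModel N δ t)

omit [CharZero K] in
theorem low_Ψ_mul {f g : N} {m n : ℤ} (hf : Low m (M.Ψ f)) (hg : Low n (M.Ψ g)) :
    Low (m + n) (M.Ψ (f * g)) := by
  rw [map_mul]; exact hf.mul hg

omit [CharZero K] in
theorem coeff_Ψ_mul {f g : N} {m n : ℤ} (hf : Low m (M.Ψ f)) (hg : Low n (M.Ψ g)) :
    (M.Ψ (f * g)).coeff (m + n) = (M.Ψ f).coeff m * (M.Ψ g).coeff n := by
  rw [map_mul, hf.coeff_mul hg]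

omit [CharZero K] in
theorem low_coeff_Ψ_pow {f : N} {m : ℤ} (hf : Low m (M.Ψ f)) (n : ℕ) :
    Low (n * m) (M.Ψ (f ^ n)) ∧ (M.Ψ (f ^ n)).coeff (n * m) = (M.Ψ f).coeff m ^ n := by
  induction n with
  | zero =>
    refine ⟨fun i hi => ?_, ?_⟩
    · have : i < 0 := by simpa using hi
      simp [coeff_one, this.ne]
    · simp
  | succ n ih =>
    rw [pow_succ, show ((n + 1 : ℕ) : ℤ) * m = n * m + m by push_cast; ring]
    exact ⟨M.low_Ψ_mul ih.1 hf, by rw [M.coeff_Ψ_mul ih.1 hf, ih.2, pow_succ]⟩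

omit [CharZero K] in
theorem low_coeff_Ψ_aeval {v w : N} (hv : Low (-2) (M.Ψ v)) (hw : Low (-3) (M.Ψ w))
    (P : MvPolynomial (Fin 2) K) (m : ℕ) (hm : ∀ d ∈ P.support, Finsupp.weight ![2, 3] d ≤ m) :
    Low (-m : ℤ) (M.Ψ (MvPolynomial.aeval ![v, w] P)) ∧
    (M.Ψ (MvPolynomial.aeval ![v, w] P)).coeff (-m : ℤ) =
      MvPolynomial.aeval ![(M.Ψ v).coeff (-2), (M.Ψ w).coeff (-3)]
        (MvPolynomial.weightedHomogeneousComponent ![2, 3] m P) := by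
  classical
  have key : ∀ d ∈ P.support,
      Low (-m : ℤ) (M.Ψ (MvPolynomial.aeval ![v, w] (MvPolynomial.monomial d (P.coeff d)))) ∧
      (M.Ψ (MvPolynomial.aeval ![v, w] (MvPolynomial.monomial d (P.coeff d)))).coeff (-m : ℤ) =
      if Finsupp.weight ![2, 3] d = m then
        MvPolynomial.aeval ![(M.Ψ v).coeff (-2), (M.Ψ w).coeff (-3)]
          (MvPolynomial.monomial d (P.coeff d)) else 0 := by
    intro d hd
    have hw' : Finsupp.weight ![2, 3] d = 2 * d 0 + 3 * d 1 := by
      rw [Finsupp.weight_apply, Finsupp.sum_fintype _ _ (by simp), Fin.sum_univ_two]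
      simp [mul_comm]
    have hle := hm d hd
    rw [hw'] at hle ⊢
    have h1 := M.low_coeff_Ψ_pow hv (d 0)
    have h2 := M.low_coeff_Ψ_pow hw (d 1)
    have h3 := M.low_Ψ_mul h1.1 h2.1
    have h4 := M.coeff_Ψ_mul h1.1 h2.1
    simp only [MvPolynomial.aeval_monomial, Finsupp.prod_fintype _ _ (fun _ => pow_zero _),
      Fin.prod_univ_two, Matrix.cons_val_zero, Matrix.cons_val_one]
    refine ⟨fun i hi => ?_, ?_⟩
    · rw [coeff_Ψ_map_mul, h3 i (by omega), mul_zero]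
    · rw [coeff_Ψ_map_mul]
      split_ifs with h
      · rw [show (-m : ℤ) = d 0 * -2 + d 1 * -3 by omega, h4, h1.2, h2.2]
      · rw [h3 _ (by omega), mul_zero]
  have hP : M.Ψ (MvPolynomial.aeval ![v, w] P) = ∑ d ∈ P.support,
      M.Ψ (MvPolynomial.aeval ![v, w] (MvPolynomial.monomial d (P.coeff d))) := by
    conv_lhs => rw [P.as_sum, map_sum, map_sum]
  rw [hP]
  refine ⟨fun i hi => ?_, ?_⟩
  · rw [coeff_sum]
    exact Finset.sum_eq_zero fun d hd => (key d hd).1 i hi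
  · rw [coeff_sum, Finset.sum_congr rfl fun d hd => (key d hd).2,
      MvPolynomial.weightedHomogeneousComponent_apply, map_sum, Finset.sum_filter]

omit [CharZero K] in
/-- If the leading coefficients of `v` and `w` are algebraically independent, then the leading
coefficient of a polynomial in `v`, `w` is a polynomial in the leading coefficients. -/
theorem exists_leading_coeff_aeval {v w : N} (hv : Low (-2) (M.Ψ v)) (hw : Low (-3) (M.Ψ w))
    (hi : AlgebraicIndependent K ![(M.Ψ v).coeff (-2), (M.Ψ w).coeff (-3)])
    {P : MvPolynomial (Fin 2) K} (hP : P ≠ 0) :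
    ∃ m : ℤ, Low m (M.Ψ (MvPolynomial.aeval ![v, w] P)) ∧
      (M.Ψ (MvPolynomial.aeval ![v, w] P)).coeff m ≠ 0 ∧
      (M.Ψ (MvPolynomial.aeval ![v, w] P)).coeff m ∈
        IntermediateField.adjoin K {(M.Ψ v).coeff (-2), (M.Ψ w).coeff (-3)} := by
  classical
  obtain ⟨d, hd, hmax⟩ := P.support.exists_max_image (Finsupp.weight ![2, 3])
    (MvPolynomial.support_nonempty.2 hP)
  obtain ⟨h1, h2⟩ := M.low_coeff_Ψ_aeval hv hw P (Finsupp.weight ![2, 3] d) hmax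
  refine ⟨_, h1, ?_, ?_⟩
  · rw [h2]
    intro h0
    have h3 := (map_eq_zero_iff _ hi).1 h0
    have h4 := congrArg (MvPolynomial.coeff d) h3
    rw [MvPolynomial.coeff_weightedHomogeneousComponent, if_pos rfl, MvPolynomial.coeff_zero] at h4
    exact MvPolynomial.mem_support_iff.1 hd h4
  · rw [h2]
    refine IntermediateField.algebra_adjoin_le_adjoin _ _ ?_
    rw [show ({(M.Ψ v).coeff (-2), (M.Ψ w).coeff (-3)} : Set N) =
      Set.range ![(M.Ψ v).coeff (-2), (M.Ψ w).coeff (-3)] by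
        simp [Matrix.range_cons, Set.pair_comm], Algebra.adjoin_range_eq_range_aeval]
    exact ⟨_, rfl⟩

omit [CharZero K] in
theorem mem_adjoin_of_Ψ_eq_single {v w : N} (hv : Low (-2) (M.Ψ v)) (hw : Low (-3) (M.Ψ w))
    (hi : AlgebraicIndependent K ![(M.Ψ v).coeff (-2), (M.Ψ w).coeff (-3)])
    {f g : N} (hf : f ∈ IntermediateField.adjoin K {v, w}) {n : ℤ} (hfg : M.Ψ f = single n g) :
    g ∈ IntermediateField.adjoin K {(M.Ψ v).coeff (-2), (M.Ψ w).coeff (-3)} := by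
  obtain rfl | hg := eq_or_ne g 0
  · exact zero_mem _
  rw [show ({v, w} : Set N) = Set.range ![v, w] by simp [Matrix.range_cons, Set.pair_comm],
    IntermediateField.mem_adjoin_range_iff] at hf
  obtain ⟨r, s, hrs⟩ := hf
  have hf0 : f ≠ 0 := by
    rintro rfl
    rw [map_zero] at hfg
    exact hg (by simpa using congrArg (fun x => x.coeff n) hfg.symm)
  have hs : MvPolynomial.aeval ![v, w] s ≠ 0 := by
    rintro h; rw [h, div_zero] at hrs; exact hf0 hrs
  have hr : MvPolynomial.aeval ![v, w] r ≠ 0 := by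
    rintro h; rw [h, zero_div] at hrs; exact hf0 hrs
  obtain ⟨m, hm1, hm2, hm3⟩ := M.exists_leading_coeff_aeval hv hw hi
    (P := s) (by rintro rfl; exact hs (map_zero _))
  obtain ⟨l, hl1, hl2, hl3⟩ := M.exists_leading_coeff_aeval hv hw hi
    (P := r) (by rintro rfl; exact hr (map_zero _))
  rw [eq_div_iff hs] at hrs
  have hlf : Low n (M.Ψ f) := fun i hi => by rw [hfg, coeff_single_of_ne hi.ne]
  have h1 := M.low_Ψ_mul hlf hm1
  have h2 := M.coeff_Ψ_mul hlf hm1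
  rw [hrs] at h1 h2
  rw [hfg, coeff_single_same] at h2
  obtain h | h | h := lt_trichotomy (n + m) l
  · rw [hl1 _ h] at h2
    exact absurd h2.symm (mul_ne_zero hg hm2)
  · rw [h] at h2
    rw [eq_div_of_mul_eq hm2 h2.symm]
    exact div_mem hl3 hm3
  · exact absurd (h1 _ h) hl2

variable [IsAlgClosed K]

theorem Y_mul_eq_of_D₁_D₁_eq {p : N} (hp0 : p ≠ 0) (hE : M.E p = 2 * p)
    (h : M.D₁ (M.D₁ p) = 6 * p ^ 2) :
    ∃ c : K, c ≠ 0 ∧ M.D₁ p ^ 2 - 4 * p ^ 3 = algebraMap K N c * M.H := by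
  have := M.charZero
  have h3 := M.E.map_ofNat_eq_zero 4
  have h4 := M.D₁.map_ofNat_eq_zero 4
  have hE' : M.E (M.D₁ p) = 3 * M.D₁ p := by
    rw [M.E_D₁_of_E_eq (m := 2) (by simpa using hE)]; norm_num
  obtain ⟨c, hc⟩ := M.exists_algebraMap_eq (f := (M.D₁ p ^ 2 - 4 * p ^ 3) / M.H ^ (1 : ℤ)) (by
      rw [M.E_div_zpow_H (m := 6)]
      · simp
      · simp only [map_sub, Derivation.leibniz, Derivation.leibniz_pow, h3, hE', hE, smul_eq_mul,
          nsmul_eq_mul]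
        push_cast; ring) (by
      rw [M.D₁_div_zpow_H]
      simp only [map_sub, Derivation.leibniz, Derivation.leibniz_pow, h4, h, smul_eq_mul,
          nsmul_eq_mul]
      push_cast; ring)
  rw [zpow_one, eq_div_iff M.H_ne_zero] at hc
  refine ⟨c, ?_, hc.symm⟩
  rintro rfl
  rw [map_zero, zero_mul] at hc
  have hp' : M.D₁ p ≠ 0 := by
    intro h0
    rw [h0] at hc
    have : p ^ 3 = 0 := by linear_combination (1 / 4) * hc
    exact hp0 (pow_eq_zero_iff (by norm_num) |>.1 this)
  refine one_ne_zero (M.eq_zero_of_D₁_eq (f := -(2 * p) / M.D₁ p) (a := 1) (l := 0) ?_ ?_)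
  · have h2 := M.E.map_ofNat_eq_zero 2
    simp only [Derivation.leibniz_div, map_neg, Derivation.leibniz, h2, hE, hE', smul_eq_mul]
    field_simp
    push_cast; ring
  · have h2 := M.D₁.map_ofNat_eq_zero 2
    simp only [Derivation.leibniz_div, map_neg, Derivation.leibniz, h2, h, smul_eq_mul, map_one,
      zpow_zero]
    field_simp
    linear_combination 3 * hc

theorem algebraicIndependent_of_D₁_D₁_eq {p : N} (hp0 : p ≠ 0) (hE : M.E p = 2 * p)
    (h : M.D₁ (M.D₁ p) = 6 * p ^ 2) : AlgebraicIndependent K ![p, M.D₁ p] := by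
  have := M.charZero
  obtain ⟨c, hc0, hc⟩ := M.Y_mul_eq_of_D₁_D₁_eq hp0 hE h
  have hE' : M.E (M.D₁ p) = 3 * M.D₁ p := by
    rw [M.E_D₁_of_E_eq (m := 2) (by simpa using hE)]; norm_num
  rw [algebraicIndependent_pair_iff]
  refine ⟨fun ha => ?_, fun ha => ?_⟩
  · have := M.E.eq_zero_of_isAlgebraic M.E_map ha
    rw [hE] at this
    simp_all
  · let d : Derivation ℤ N N := (2 * p) • M.D₁ - M.D₁ p • M.E
    have hd : ∀ f, d f = 2 * p * M.D₁ f - M.D₁ p * M.E f := fun f => rfl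
    have hdK : ∀ a : Algebra.adjoin K {p}, d (algebraMap _ N a) = 0 := by
      intro ⟨a, ha⟩
      change d a = 0
      induction ha using Algebra.adjoin_induction with
      | mem x hx => obtain rfl := hx; rw [hd, hE]; ring
      | algebraMap r => rw [hd, M.D₁_map, M.E_map]; ring
      | add x y _ _ hx hy => rw [map_add, hx, hy, add_zero]
      | mul x y _ _ hx hy => rw [Derivation.leibniz, hx, hy, smul_zero, smul_zero, add_zero]
    have h0 := d.eq_zero_of_isAlgebraic hdK ha
    rw [hd, h, hE'] at h0
    have : algebraMap K N c * M.H = 0 := by linear_combination -hc - (1 / 3) * h0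
    simp [hc0, M.H_ne_zero] at this

/-- A homogeneous solution of `p'' = 6p²` generating the whole field is `Y`. -/
theorem eq_Y_of_D₁_D₁_eq {p : N} (hp0 : p ≠ 0) (hE : M.E p = 2 * p)
    (h : M.D₁ (M.D₁ p) = 6 * p ^ 2) (htop : IntermediateField.adjoin K {p, M.D₁ p} = ⊤) :
    p = M.Y := by
  have := M.charZero
  obtain ⟨c, hc0, hc⟩ := M.Y_mul_eq_of_D₁_D₁_eq hp0 hE h
  have hcN : algebraMap K N c ≠ 0 := by simpa using hc0
  have hE' : M.E (M.D₁ p) = 3 * M.D₁ p := by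
    rw [M.E_D₁_of_E_eq (m := 2) (by simpa using hE)]; norm_num
  obtain ⟨M', hY, hZ⟩ := PainleveModel.exists_of_algebraicIndependent δ t
    (M.algebraicIndependent_of_D₁_D₁_eq hp0 hE h) htop
  have hEE : ∀ f, M'.E f = M.E f := Derivation.map_comp_eq_of_adjoin_eq_top (RingHom.id N)
    M'.E M.E htop (fun a => by simp [M.E_map, M'.E_map]) (by
      rintro x (rfl | rfl)
      · simpa [hY, hE] using M'.E_Y
      · simpa [hZ, hE'] using M'.E_Z)
  have hH : M'.H = algebraMap K N c * M.H := by
    rw [← hc, PainleveModel.H, hY, hZ]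
  have hH0 := M.H_ne_zero
  have hY0 := M.Y_ne_zero
  obtain ⟨a, b, hab, hb, hρ⟩ := M.exists_coprime_of_E_eq_zero (f := p / M.Y) (by
    rw [Derivation.leibniz_div, hE, M.E_Y, smul_eq_mul, smul_eq_mul, smul_eq_mul]; ring)
  have ha : a ≠ 0 := by
    rintro rfl
    rw [map_zero, zero_div, div_eq_zero_iff] at hρ
    tauto
  have hS : M'.S = M.S * (Polynomial.aeval M.S a / Polynomial.aeval M.S b) ^ 3 /
      algebraMap K N c := by
    rw [← hρ, PainleveModel.S, PainleveModel.S, hH, hY]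
    field_simp
  have hmem := M'.mem_adjoin_S_of_E_eq_zero (f := M.S) (by rw [hEE, M.E_S])
  rw [hS] at hmem
  obtain ⟨ha', hb'⟩ := Polynomial.natDegree_eq_zero_of_mem_adjoin M.transcendental_S hab ha hb hc0
    hmem
  rw [Polynomial.eq_C_of_natDegree_eq_zero ha', Polynomial.eq_C_of_natDegree_eq_zero hb',
    Polynomial.aeval_C, Polynomial.aeval_C, ← map_div₀] at hρ
  generalize a.coeff 0 / b.coeff 0 = κ at hρ
  rw [div_eq_iff hY0] at hρ
  have hκ : algebraMap K N κ ≠ 0 := by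
    intro h0; rw [h0, zero_mul] at hρ; exact hp0 hρ
  have h1 : algebraMap K N κ * (6 * M.Y ^ 2) = 6 * (algebraMap K N κ * M.Y) ^ 2 := by
    rw [hρ] at h
    simpa only [Derivation.leibniz, M.D₁_map, M.D₁_Y, M.D₁_Z, smul_eq_mul, mul_zero, add_zero]
      using h
  have h2 : algebraMap K N κ = 1 := by
    have h6 : (6 : N) ≠ 0 := by norm_num
    have := mul_ne_zero (mul_ne_zero h6 hκ) (pow_ne_zero 2 hY0)
    refine mul_left_cancel₀ this ?_
    linear_combination -h1
  rw [hρ, h2, one_mul]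

theorem coeff_eq_Y_of_D_D_eq (ht : δ t = 1) {v : N}
    (hv : M.D (M.D v) = 6 * v ^ 2 + algebraMap K N t)
    (hY : M.Y ∈ IntermediateField.adjoin K {v, M.D v})
    (hZ : M.Z ∈ IntermediateField.adjoin K {v, M.D v}) : (M.Ψ v).coeff (-2) = M.Y := by
  have := M.charZero
  have hl := M.low_of_D_D_eq hv
  have hl' : Low (-3) (M.Ψ (M.D v)) := M.low_Ψ_D hl
  have hcD : (M.Ψ (M.D v)).coeff (-3) = M.D₁ ((M.Ψ v).coeff (-2)) := M.coeff_Ψ_D_of_low hl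
  have hE : M.E ((M.Ψ v).coeff (-2)) = 2 * (M.Ψ v).coeff (-2) := by
    simpa using M.E_coeff_Ψ v (-2)
  have hDD := M.D₁_D₁_coeff hv
  have hp0 : (M.Ψ v).coeff (-2) ≠ 0 := by
    intro h0
    obtain ⟨a, rfl⟩ := M.exists_algebraMap_eq_of_coeff_eq_zero ht hv h0
    have hbot : IntermediateField.adjoin K {algebraMap K N a, M.D (algebraMap K N a)} = ⊥ := by
      rw [eq_bot_iff, IntermediateField.adjoin_le_iff]
      rintro x (rfl | rfl)
      · exact ⟨a, rfl⟩
      · rw [D_map]; exact ⟨_, rfl⟩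
    rw [hbot] at hY
    obtain ⟨y, hy⟩ := hY
    have hEY := M.E_Y
    rw [← hy] at hEY
    change M.E (algebraMap K N y) = 2 * algebraMap K N y at hEY
    rw [M.E_map] at hEY
    have : algebraMap K N y ≠ 0 := fun h => M.Y_ne_zero (hy ▸ h)
    simp_all
  have hi := M.algebraicIndependent_of_D₁_D₁_eq hp0 hE hDD
  rw [← hcD] at hi
  refine M.eq_Y_of_D₁_D₁_eq hp0 hE hDD ?_
  rw [← hcD, eq_top_iff, ← M.adjoin_eq_top, IntermediateField.adjoin_le_iff]
  rintro x (rfl | rfl)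
  · exact M.mem_adjoin_of_Ψ_eq_single hl hl' hi hY M.Ψ_Y
  · exact M.mem_adjoin_of_Ψ_eq_single hl hl' hi hZ M.Ψ_Z

end PainleveModel

end

section

open HahnSeries

namespace PainleveModel

variable {K N : Type*} [Field K] [CharZero K] [Field N] [Algebra K N]
  {δ : Derivation ℤ K K} {t : K} (M : PainleveModel N δ t)

theorem D₁_div_Z (f : N) : M.D₁ (f / M.Z) = (M.Z * M.D₁ f - 6 * M.Y ^ 2 * f) / M.Z ^ 2 := by
  rw [Derivation.leibniz_div, M.D₁_Z]
  have := M.Z_ne_zero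
  simp only [smul_eq_mul]
  field_simp

theorem E_div_Z {f m : N} (hf : M.E f = m * f) : M.E (f / M.Z) = (m - 3) * (f / M.Z) := by
  rw [Derivation.leibniz_div, M.E_Z, hf]
  have := M.Z_ne_zero
  simp only [smul_eq_mul]
  field_simp

variable [IsAlgClosed K]

omit [IsAlgClosed K] in
theorem eq_Z_mul_of_D₁ {f g : N} {m : ℤ} (hm : ¬ 6 ∣ m - 3) (hf : M.E f = m * f)
    (hg : M.E g = (m - 3) * g) (h : M.Z * M.D₁ f - 6 * M.Y ^ 2 * f = M.Z ^ 2 * M.D₁ g) :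
    f = M.Z * g := by
  have hZ := M.Z_ne_zero
  have : f / M.Z = g := M.eq_of_D₁_eq hm (by rw [M.E_div_Z hf]; push_cast; ring)
    (by rw [hg]; push_cast; ring) (by rw [D₁_div_Z, h]; field_simp)
  rw [← this]; field_simp

theorem eq_zero_of_D₁ {f : N} {m : ℤ} (hm : ¬ 6 ∣ m - 3) (hf : M.E f = m * f)
    (h : M.Z * M.D₁ f - 6 * M.Y ^ 2 * f = 0) : f = 0 := by
  simpa using M.eq_Z_mul_of_D₁ (g := 0) hm hf (by simp) (by simpa using h)

theorem eq_of_D₁_weight_two {f : N} {α β : K} {l : ℤ} (hf : M.E f = (6 * l + 2) * f)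
    (h : M.Z * M.D₁ f - 6 * M.Y ^ 2 * f =
      (algebraMap K N α * M.Z ^ 2 + algebraMap K N β * M.H) * M.H ^ l) :
    3 * α + β = 0 ∧ f = algebraMap K N (2 / 3 * β) * M.Y * M.H ^ l := by
  have := M.charZero
  have hZ := M.Z_ne_zero
  obtain ⟨k, hk⟩ : ∃ k, k = (f - algebraMap K N (2 / 3 * β) * M.Y * M.H ^ l) / M.Z := ⟨_, rfl⟩
  have hE : M.E k = (6 * l - 1) * k := by
    rw [hk, M.E_div_Z (m := 6 * l + 2)]
    · ring
    · simp only [map_sub, hf, Derivation.leibniz, M.E_map, M.E_Y, M.E_zpow_H, smul_eq_mul]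
      ring
  have hD : M.D₁ k = algebraMap K N (α + β / 3) * M.H ^ l := by
    rw [hk, M.D₁_div_Z, div_eq_iff (pow_ne_zero _ hZ)]
    simp only [map_sub, Derivation.leibniz, M.D₁_map, M.D₁_Y, M.D₁_zpow_H, smul_eq_mul]
    simp only [map_add, map_mul, map_div₀, map_ofNat]
    have hH : M.H = M.Z ^ 2 - 4 * M.Y ^ 3 := rfl
    generalize M.H ^ l = w at *
    rw [hH] at h
    linear_combination h
  have h0 := M.eq_zero_of_D₁_eq hE hD
  rw [h0, map_zero, zero_mul] at hD
  have hk0 := M.eq_zero_of_D₁_eq_zero (m := 6 * l - 1) (by omega) (by rw [hE]; push_cast; ring) hD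
  rw [hk0, eq_comm, div_eq_zero_iff, or_iff_left hZ, sub_eq_zero] at hk
  exact ⟨by linear_combination 3 * h0, hk⟩

theorem eq_of_D₁_weight_four {f : N} {α β κ : K} {l : ℤ} (hf : M.E f = (6 * l + 4) * f)
    (h : M.Z * M.D₁ f - 6 * M.Y ^ 2 * f =
      (algebraMap K N α * M.Y * M.Z ^ 2 + algebraMap K N β * M.H * M.Y +
        algebraMap K N κ * (M.Y ^ 4 + M.H * M.Y)) * M.H ^ l) :
    3 * α = β := by
  have := M.charZero
  have hZ := M.Z_ne_zero
  obtain ⟨k, hk⟩ : ∃ k, k =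
    (f - algebraMap K N (κ / 2 + 2 / 3 * β) * M.Y ^ 2 * M.H ^ l) / M.Z := ⟨_, rfl⟩
  have hE : M.E k = (6 * l + 1) * k := by
    rw [hk, M.E_div_Z (m := 6 * l + 4)]
    · ring
    · simp only [map_sub, hf, Derivation.leibniz, Derivation.leibniz_pow, M.E_map, M.E_Y,
        M.E_zpow_H, smul_eq_mul, nsmul_eq_mul]
      push_cast; ring
  have hD : M.D₁ k = algebraMap K N (α - β / 3) * M.H ^ l * M.Y := by
    rw [hk, M.D₁_div_Z, div_eq_iff (pow_ne_zero _ hZ)]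
    simp only [map_sub, Derivation.leibniz, Derivation.leibniz_pow, M.D₁_map, M.D₁_Y, M.D₁_zpow_H,
      smul_eq_mul, nsmul_eq_mul]
    simp only [map_add, map_mul, map_div₀, map_ofNat]
    have hH : M.H = M.Z ^ 2 - 4 * M.Y ^ 3 := rfl
    generalize M.H ^ l = w at *
    rw [hH] at h
    push_cast
    linear_combination h
  linear_combination 3 * M.eq_zero_of_D₁_eq_mul_Y hE hD

/-- A solution with the same polar part as `Y` is `Y`. -/
theorem eq_Y_of_coeff_eq (ht : δ t = 1) {v : N}
    (hv : M.D (M.D v) = 6 * v ^ 2 + algebraMap K N t) (hv2 : (M.Ψ v).coeff (-2) = M.Y) :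
    v = M.Y := by
  have := M.charZero
  have hl2 := M.low_of_D_D_eq hv
  by_contra hne
  set e := v - M.Y with he
  have he0 : M.Ψ e ≠ 0 := (map_ne_zero M.Ψ).2 (sub_ne_zero.2 hne)
  obtain ⟨r, hr⟩ : ∃ r, (M.Ψ e).order = r := ⟨_, rfl⟩
  have her : (M.Ψ e).coeff r ≠ 0 := hr ▸ coeff_order_eq_zero.not.2 he0
  have hlr : Low r (M.Ψ e) := fun n hn => coeff_eq_zero_of_lt_order (hr ▸ hn)
  have hl1 : Low (-1) (M.Ψ e) := fun i hi => by
    rw [he, map_sub, coeff_sub, M.Ψ_Y]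
    obtain rfl | hi : i = -2 ∨ i < -2 := by omega
    · rw [hv2, coeff_single_same, sub_self]
    · rw [hl2 i hi, coeff_single_of_ne hi.ne, sub_zero]
  have hr1 : -1 ≤ r := by
    by_contra h; exact her (hl1 r (by omega))
  have heq : M.D (M.D e) = 12 * M.Y * e + 6 * e ^ 2 := by
    rw [he, map_sub, map_sub, hv, D_Y, D_Z]; ring
  set f := M.D e with hf
  set Q := f ^ 2 - 12 * (M.Y * e ^ 2) - 4 * e ^ 3 with hQ
  set G := 2 * (M.Z * f) - 12 * (M.Y ^ 2 * e) - algebraMap K N (2 * t) * e + Q with hG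
  have hDG : M.D G = -(2 * e) := by
    have h2 := M.D.map_ofNat_eq_zero 2
    have h12 := M.D.map_ofNat_eq_zero 12
    have h4 := M.D.map_ofNat_eq_zero 4
    rw [hG, hQ]
    simp only [map_add, map_sub, Derivation.leibniz, Derivation.leibniz_pow, h2, h12, h4, M.D_Y,
      M.D_Z, M.D_map, heq, ← hf, smul_eq_mul, nsmul_eq_mul, ht, map_mul, map_ofNat]
    simp only [map_one, mul_one, mul_zero, add_zero]
    push_cast
    ring
  have hQlow : Low (min (2 * r - 2) (3 * r)) (M.Ψ Q) := by
    have h1 := M.low_Ψ_D hlr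
    have h2 := (M.low_coeff_Ψ_pow h1 2).1
    have h3 := (M.low_coeff_Ψ_pow hlr 2).1
    have h4 := (M.low_coeff_Ψ_pow hlr 3).1
    have h5 : Low (-2) (M.Ψ M.Y) := fun i hi => by rw [M.Ψ_Y, coeff_single_of_ne hi.ne]
    intro i hi
    rw [hQ, map_sub, map_sub, coeff_sub, coeff_sub, coeff_Ψ_ofNat_mul, coeff_Ψ_ofNat_mul,
      h2 i (by push_cast; omega), M.low_Ψ_mul h5 h3 i (by push_cast; omega),
      h4 i (by push_cast; omega)]
    ring
  have hQ4 : r = 3 → (M.Ψ Q).coeff 4 = (M.Ψ f).coeff 2 ^ 2 - 12 * (M.Y * (M.Ψ e).coeff 3 ^ 2) := by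
    rintro rfl
    have h1 := M.low_Ψ_D hlr
    have h2 := (M.low_coeff_Ψ_pow h1 2).2
    have h3 := (M.low_coeff_Ψ_pow hlr 2).2
    have h4 := (M.low_coeff_Ψ_pow hlr 3).1
    have h5 : (M.Ψ (M.Y * e ^ 2)).coeff 4 = M.Y * (M.Ψ (e ^ 2)).coeff 6 := by
      rw [map_mul, M.Ψ_Y, show (4 : ℤ) = 6 + -2 by rfl, coeff_single_mul_add]
    rw [show ((2 : ℕ) : ℤ) * (3 - 1) = 4 by rfl] at h2
    rw [show ((2 : ℕ) : ℤ) * 3 = 6 by rfl] at h3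
    rw [← hf, show (3 - 1 : ℤ) = 2 by rfl] at h2
    rw [hQ, map_sub, map_sub, coeff_sub, coeff_sub, coeff_Ψ_ofNat_mul, coeff_Ψ_ofNat_mul,
      h4 4 (by norm_num), h5, h2, h3, mul_zero, sub_zero]
  have hw : ∀ n, (M.Ψ f).coeff n = M.D₁ ((M.Ψ e).coeff (n + 1)) +
    M.D₀ ((M.Ψ e).coeff n) + M.D₃ ((M.Ψ e).coeff (n - 3)) := M.coeff_Ψ_D e
  have hGc : ∀ n, (M.Ψ G).coeff n = 2 * (M.Z * (M.Ψ f).coeff (n + 3)) -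
      12 * (M.Y ^ 2 * (M.Ψ e).coeff (n + 4)) - algebraMap K N (2 * t) * (M.Ψ e).coeff n +
      (M.Ψ Q).coeff n := by
    intro n
    have h1 : (M.Ψ (M.Z * f)).coeff n = M.Z * (M.Ψ f).coeff (n + 3) := by
      conv_lhs => rw [map_mul, M.Ψ_Z, show n = n + 3 + -3 by ring, coeff_single_mul_add]
    have h2 : (M.Ψ (M.Y ^ 2 * e)).coeff n = M.Y ^ 2 * (M.Ψ e).coeff (n + 4) := by
      conv_lhs => rw [map_mul, map_pow, M.Ψ_Y, single_pow,
        show n = n + 4 + (2 • -2 : ℤ) by simp, coeff_single_mul_add]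
    rw [hG, map_add, map_sub, map_sub, coeff_add, coeff_sub, coeff_sub, coeff_Ψ_ofNat_mul,
      coeff_Ψ_ofNat_mul, coeff_Ψ_map_mul, h1, h2]
  have hDGc : ∀ n, M.D₁ ((M.Ψ G).coeff (n + 1)) + M.D₀ ((M.Ψ G).coeff n) +
      M.D₃ ((M.Ψ G).coeff (n - 3)) = -(2 * (M.Ψ e).coeff n) := by
    intro n
    rw [← coeff_Ψ_D, hDG, map_neg, coeff_neg, coeff_Ψ_ofNat_mul]
  have hE := M.E_coeff_Ψ e
  have hE' := M.E_coeff_Ψ G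
  have hlr : ∀ i < r, (M.Ψ e).coeff i = 0 := hlr
  replace hQlow : ∀ i < (min (2 * r - 2) (3 * r)), (M.Ψ Q).coeff i = 0 := hQlow
  clear_value G Q f e
  clear hG hQ hf heq hDG he he0 hr hne hl1 hv hv2 hl2
  generalize (M.Ψ G).coeff = g at *
  generalize (M.Ψ Q).coeff = q at *
  generalize (M.Ψ f).coeff = w at *
  generalize (M.Ψ e).coeff = x at *
  replace hGc : ∀ n, g n = 2 * (M.Z * M.D₁ (x (n + 4)) - 6 * M.Y ^ 2 * x (n + 4)) +
      2 * M.Z * (M.D₀ (x (n + 3)) + M.D₃ (x n)) - 2 * algebraMap K N t * x n + q n := by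
    intro n
    rw [hGc, hw, show n + 3 + 1 = n + 4 by ring, show n + 3 - 3 = n by ring, map_mul, map_ofNat]
    ring
  have hglow : ∀ i < r - 4, g i = 0 := fun i hi => by
    rw [hGc, hlr (i + 4) (by omega), hlr (i + 3) (by omega), hlr i (by omega),
      hQlow i (by omega)]
    simp
  have g4 : g (r - 4) = 2 * (M.Z * M.D₁ (x r) - 6 * M.Y ^ 2 * x r) := by
    rw [hGc, sub_add_cancel, hlr (r - 4 + 3) (by omega), hlr (r - 4) (by omega),
      hQlow (r - 4) (by omega)]
    simp
  have d4 : M.D₁ (g (r - 4)) = 0 := by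
    have := hDGc (r - 5)
    rw [show r - 5 + 1 = r - 4 by ring, hglow (r - 5) (by omega), hglow (r - 5 - 3) (by omega),
      hlr (r - 5) (by omega)] at this
    simpa using this
  have g4' : g (r - 4) = 0 := by
    by_contra h0
    obtain ⟨b, l, hb, hrl, hgb⟩ := M.exists_eq_zpow_H h0 (hE' _) d4
    have hH : M.H ^ l = M.H * M.H ^ (l - 1) := by
      rw [mul_comm, ← zpow_add_one₀ M.H_ne_zero, sub_add_cancel]
    have hA := M.eq_of_D₁_weight_two (f := x r) (α := 0) (β := b / 2) (l := l - 1) (by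
      rw [hE, show -r = 6 * (l - 1) + 2 by omega]; push_cast; ring) (by
      rw [g4, hH] at hgb
      rw [map_zero, map_div₀, map_ofNat]
      linear_combination (1 / 2) * hgb)
    have := hA.1
    simp at this
    exact hb this
  rw [g4'] at g4
  have xr : M.D₁ (x r / M.Z) = 0 := by
    rw [M.D₁_div_Z, div_eq_zero_iff]
    left; linear_combination (-1 / 2) * g4
  obtain ⟨γ, j, hγ, hrj, hxr⟩ := M.exists_eq_zpow_H (f := x r / M.Z) (m := -r - 3)
    (div_ne_zero her M.Z_ne_zero) (by rw [M.E_div_Z (hE r)]; push_cast; ring) xr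
  obtain rfl : r = -(6 * j) - 3 := by omega
  rw [div_eq_iff M.Z_ne_zero] at hxr
  have hH0 := M.H_ne_zero
  obtain ⟨w', hw'⟩ : ∃ w', w' = M.H ^ (j - 1) := ⟨_, rfl⟩
  have hHj : M.H ^ j = M.H * w' := by
    rw [hw', mul_comm, ← zpow_add_one₀ M.H_ne_zero, sub_add_cancel]
  have hHj1 : M.H ^ (j + 1) = M.H ^ 2 * w' := by
    rw [zpow_add_one₀ hH0, hHj]; ring
  have hHdef : M.H = M.Z ^ 2 - 4 * M.Y ^ 3 := rfl
  -- coefficients of `g`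
  obtain ⟨b, hb⟩ := M.exists_algebraMap_eq (f := g (-(6 * j) - 6) / M.H ^ (j + 1)) (by
    rw [M.E_div_zpow_H _ (hE' _)]; push_cast; ring) (by
    have := hDGc (-(6 * j) - 7)
    rw [show -(6 * j) - 7 + 1 = -(6 * j) - 6 by ring,
      show -(6 * j) - 7 = -(6 * j) - 3 - 4 by ring, g4', hlr _ (by omega),
      hglow (-(6 * j) - 3 - 4 - 3) (by omega)] at this
    rw [D₁_div_zpow_H, show M.D₁ (g (-(6 * j) - 6)) = 0 by simpa using this, zero_div])
  replace hb : g (-(6 * j) - 6) = algebraMap K N b * M.H ^ (j + 1) := by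
    rw [hb, div_mul_cancel₀ _ (zpow_ne_zero _ hH0)]
  have e6 := hDGc (-(6 * j) - 6)
  rw [show -(6 * j) - 6 + 1 = -(6 * j) - 5 by ring, hb, hlr _ (by omega),
    hglow (-(6 * j) - 6 - 3) (by omega)] at e6
  simp only [Derivation.leibniz, M.D₀_map, M.D₀_zpow_H, smul_eq_mul, mul_zero, map_zero,
    add_zero, neg_zero, zero_add] at e6
  have hδb : δ b = 0 := by
    have := M.eq_zero_of_D₁_eq (f := g (-(6 * j) - 5)) (a := - δ b) (l := j + 1)
      (by rw [hE']; push_cast; ring) (by rw [map_neg]; linear_combination e6)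
    simpa using this
  rw [hδb, map_zero, mul_zero, add_zero] at e6
  have g5 := M.eq_zero_of_D₁_eq_zero (by omega) (hE' _) e6
  have e5 := hDGc (-(6 * j) - 5)
  rw [show -(6 * j) - 5 + 1 = -(6 * j) - 4 by ring, g5, hlr _ (by omega),
    hglow (-(6 * j) - 5 - 3) (by omega)] at e5
  simp only [mul_zero, map_zero, add_zero, neg_zero] at e5
  have g4 := M.eq_zero_of_D₁_eq_zero (by omega) (hE' _) e5
  have e4 := hDGc (-(6 * j) - 4)
  rw [show -(6 * j) - 4 + 1 = -(6 * j) - 3 by ring, g4, hlr _ (by omega),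
    show -(6 * j) - 4 - 3 = -(6 * j) - 3 - 4 by ring, g4'] at e4
  simp only [mul_zero, map_zero, add_zero, neg_zero] at e4
  have g3 := M.eq_zero_of_D₁_eq_zero (by omega) (hE' _) e4
  have e3 := hDGc (-(6 * j) - 3)
  rw [show -(6 * j) - 3 + 1 = -(6 * j) - 2 by ring, g3, hxr,
    show -(6 * j) - 3 - 3 = -(6 * j) - 6 by ring, hb] at e3
  simp only [Derivation.leibniz, M.D₃_map, M.D₃_zpow_H, smul_eq_mul, mul_zero, map_zero,
    add_zero, add_sub_cancel_right] at e3
  have g2 : g (-(6 * j) - 2) = algebraMap K N (-2 * (γ + (j + 1) * t * b)) * M.H ^ j * M.Y := by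
    refine M.eq_of_D₁_eq (m := 6 * j + 2) (by omega) (by rw [hE']; push_cast; ring) ?_ ?_
    · simp only [Derivation.leibniz, M.E_map, M.E_zpow_H, M.E_Y, smul_eq_mul]
      push_cast; ring
    · simp only [Derivation.leibniz, M.D₁_map, M.D₁_zpow_H, M.D₁_Y, smul_eq_mul]
      simp only [map_mul, map_neg, map_ofNat, map_intCast, map_add, map_one]
      push_cast at e3
      linear_combination e3
  -- coefficients of `x`
  have f6 := hGc (-(6 * j) - 6)
  rw [show -(6 * j) - 6 + 4 = -(6 * j) - 2 by ring, show -(6 * j) - 6 + 3 = -(6 * j) - 3 by ring,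
    hb, hxr, hlr (-(6 * j) - 6) (by omega), hQlow _ (by omega)] at f6
  simp only [Derivation.leibniz, M.D₀_map, M.D₀_zpow_H, M.D₀_Z, smul_eq_mul, mul_zero, map_zero,
    add_zero, zero_add, sub_zero] at f6
  obtain ⟨hbγ, x2⟩ := M.eq_of_D₁_weight_two (f := x (-(6 * j) - 2)) (α := - δ γ) (β := b / 2)
    (l := j) (by rw [hE]; push_cast; ring) (by
      simp only [map_neg, map_div₀, map_ofNat]
      rw [hHj] at f6 ⊢
      rw [hHj1] at f6
      linear_combination (-1 / 2) * f6)
  have f5 := hGc (-(6 * j) - 5)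
  rw [show -(6 * j) - 5 + 4 = -(6 * j) - 1 by ring, show -(6 * j) - 5 + 3 = -(6 * j) - 2 by ring,
    g5, x2, hlr (-(6 * j) - 5) (by omega), hQlow _ (by omega)] at f5
  have hδb' : δ (2 / 3 * (b / 2)) = 0 := by
    rw [show 2 / 3 * (b / 2) = b / ((3 : ℕ) : K) by push_cast; ring, Derivation.leibniz_div_const,
      hδb, smul_zero]
    exact δ.map_natCast 3
  simp only [Derivation.leibniz, M.D₀_map, M.D₀_zpow_H, M.D₀_Y, smul_eq_mul, mul_zero, map_zero,
    add_zero, sub_zero, hδb'] at f5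
  have x1 := M.eq_zero_of_D₁ (by omega) (hE (-(6 * j) - 1)) (by linear_combination (-1 / 2) * f5)
  have f4 := hGc (-(6 * j) - 4)
  rw [show -(6 * j) - 4 + 4 = -(6 * j) by ring, show -(6 * j) - 4 + 3 = -(6 * j) - 1 by ring,
    g4, x1, hlr (-(6 * j) - 4) (by omega), hQlow _ (by omega)] at f4
  simp only [mul_zero, map_zero, add_zero, sub_zero] at f4
  have x0 := M.eq_zero_of_D₁ (by omega) (hE (-(6 * j))) (by linear_combination (-1 / 2) * f4)
  have f3 := hGc (-(6 * j) - 3)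
  rw [show -(6 * j) - 3 + 4 = -(6 * j) + 1 by ring, show -(6 * j) - 3 + 3 = -(6 * j) by ring,
    g3, x0, hxr, hQlow _ (by omega)] at f3
  simp only [Derivation.leibniz, M.D₃_map, M.D₃_zpow_H, M.D₃_Z, smul_eq_mul, mul_zero, map_zero,
    add_zero, zero_add] at f3
  have y1 : x (-(6 * j) + 1) = M.Z * (algebraMap K N (-2 * j * γ * t) * M.H ^ (j - 1) * M.Y) := by
    refine M.eq_Z_mul_of_D₁ (m := 6 * j - 1) (by omega) (by rw [hE]; push_cast; ring) ?_ ?_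
    · simp only [Derivation.leibniz, M.E_map, M.E_zpow_H, M.E_Y, smul_eq_mul]
      push_cast; ring
    · simp only [Derivation.leibniz, M.D₁_map, M.D₁_zpow_H, M.D₁_Y, smul_eq_mul]
      simp only [map_mul, map_neg, map_ofNat, map_intCast]
      linear_combination (-1 / 2) * f3
  have e2 := hDGc (-(6 * j) - 2)
  rw [show -(6 * j) - 2 + 1 = -(6 * j) - 1 by ring, g2, x2,
    show -(6 * j) - 2 - 3 = -(6 * j) - 5 by ring, g5] at e2
  have hδ2 : δ (-2 * (γ + (j + 1) * t * b)) = -2 * (δ γ + (j + 1) * b) := by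
    have h2 := δ.map_ofNat_eq_zero 2
    simp only [Derivation.leibniz, map_add, map_neg, h2, Derivation.map_intCast, ht, hδb,
      Derivation.map_one_eq_zero, smul_eq_mul]
    ring
  simp only [Derivation.leibniz, M.D₀_map, M.D₀_zpow_H, M.D₀_Y, smul_eq_mul, mul_zero, map_zero,
    add_zero, zero_add, hδ2] at e2
  obtain rfl : b = 6 * δ γ := by linear_combination 2 * hbγ
  have hδγ : δ γ = 0 := by
    have := M.eq_zero_of_D₁_eq_mul_Y (f := g (-(6 * j) - 1)) (a := (12 * j + 10) * δ γ) (l := j)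
      (by rw [hE']; push_cast; ring) (by
        simp only [map_mul, map_neg, map_ofNat, map_intCast, map_add, map_one, map_div₀] at e2 ⊢
        linear_combination e2)
    refine (mul_eq_zero.1 this).resolve_left ?_
    have : ((12 * j + 10 : ℤ) : K) ≠ 0 := Int.cast_ne_zero.2 (by omega)
    exact_mod_cast this
  have f2 := hGc (-(6 * j) - 2)
  rw [show -(6 * j) - 2 + 4 = -(6 * j) + 2 by ring, show -(6 * j) - 2 + 3 = -(6 * j) + 1 by ring,
    g2, y1, x2, hδγ] at f2
  have hδ3 : δ (-2 * j * γ * t) = -2 * j * γ := by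
    have h2 := δ.map_ofNat_eq_zero 2
    simp only [Derivation.leibniz, map_neg, h2, Derivation.map_intCast, ht, hδγ, smul_eq_mul]
    ring
  simp only [Derivation.leibniz, M.D₀_map, M.D₀_zpow_H, M.D₀_Y, M.D₀_Z, smul_eq_mul, mul_zero,
    map_zero, add_zero, zero_add, zero_mul, zero_div, sub_zero, hδ3] at f2
  have hq : ∃ κ : K, q (-(6 * j) - 2) =
      algebraMap K N κ * (M.Y ^ 4 + M.H * M.Y) * M.H ^ (j - 1) := by
    by_cases hj : j = -1
    · subst hj
      refine ⟨-12 * γ ^ 2, ?_⟩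
      have hw2 := hw 2
      norm_num at hxr hlr hQ4 hw2 hw' hHj ⊢
      rw [hlr 2 (by norm_num), hlr (-1) (by norm_num), hxr] at hw2
      simp only [Derivation.leibniz, M.D₁_map, M.D₁_Z, map_zero, add_zero, smul_eq_mul] at hw2
      have hinv : M.D₁ (M.H⁻¹) = 0 := by simpa using M.D₁_zpow_H (-1)
      rw [hinv] at hw2
      rw [hQ4, hw2, hxr, ← inv_pow]
      generalize M.H⁻¹ = u
      rw [hHdef]
      simp only [map_ofNat]
      ring
    · refine ⟨0, ?_⟩
      rw [hQlow _ (by omega)]; simp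
  obtain ⟨κ, hκ⟩ := hq
  have hfin := M.eq_of_D₁_weight_four (f := x (-(6 * j) + 2)) (α := 2 * j * γ) (β := - γ)
    (κ := - (κ / 2)) (l := j - 1) (by rw [hE]; push_cast; ring) (by
      rw [hκ] at f2
      rw [hHj, ← hw'] at f2
      rw [← hw']
      simp only [map_mul, map_neg, map_ofNat, map_intCast, map_div₀] at f2 ⊢
      linear_combination (-1 / 2) * f2)
  have h0 : (6 * j + 1 : K) * γ = 0 := by linear_combination hfin
  have h1 : ((6 * j + 1 : ℤ) : K) ≠ 0 := Int.cast_ne_zero.2 (by omega)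
  push_cast at h1
  exact hγ ((mul_eq_zero.1 h0).resolve_left h1)

/-- Two solutions of the first Painlevé equation generating the same purely transcendental
extension coincide. -/
theorem eq_Y_of_D_D_eq (ht : δ t = 1) {v : N}
    (hv : M.D (M.D v) = 6 * v ^ 2 + algebraMap K N t)
    (hY : M.Y ∈ IntermediateField.adjoin K {v, M.D v})
    (hZ : M.Z ∈ IntermediateField.adjoin K {v, M.D v}) : v = M.Y :=
  M.eq_Y_of_coeff_eq ht hv (M.coeff_eq_Y_of_D_D_eq ht hv hY hZ)

end PainleveModel

end

section
open HahnSeries Polynomial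

variable {k : Type*} [Field k]

theorem HahnSeries.coeff_eval₂_single_pow {a : ℚ} (ha : a ≠ 0) (p : k[X]) (n : ℕ) :
    (p.eval₂ (HahnSeries.C (Γ := ℚ)) (single a 1)).coeff (n • a) = p.coeff n := by
  induction p using Polynomial.induction_on' with
  | add p q hp hq => rw [eval₂_add, HahnSeries.coeff_add, hp, hq, Polynomial.coeff_add]
  | monomial m c =>
    rw [eval₂_monomial, single_pow, C_apply, single_mul_single, zero_add, one_pow, mul_one,
      Polynomial.coeff_monomial]
    split_ifs with h
    · rw [h, coeff_single_same]
    · refine coeff_single_of_ne fun h' => h ?_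
      simpa [ha, eq_comm] using h'

namespace HahnSeries

/-- The element `ζ + x` of the field of Hahn series in `x`. -/
noncomputable def shift (ζ : k) : HahnSeries ℚ k := C ζ + single 1 1

theorem eval₂_shift (ζ : k) (p : k[X]) :
    p.eval₂ C (shift ζ) = (taylor ζ p).eval₂ (C (Γ := ℚ)) (single 1 1) := by
  rw [taylor_apply, eval₂_comp]
  simp [shift, add_comm]

theorem coeff_eval₂_shift (ζ : k) (p : k[X]) : (p.eval₂ C (shift ζ)).coeff 0 = p.eval ζ := by
  have := coeff_eval₂_single_pow one_ne_zero (taylor ζ p) 0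
  rwa [zero_smul, taylor_coeff_zero, ← eval₂_shift] at this

theorem eval₂_shift_injective (ζ : k) :
    Function.Injective (eval₂RingHom (C (Γ := ℚ)) (shift ζ)) := by
  refine (injective_iff_map_eq_zero _).2 fun p hp => taylor_injective ζ ?_
  ext n
  rw [map_zero, ← coeff_eval₂_single_pow one_ne_zero, ← eval₂_shift]
  rw [coe_eval₂RingHom] at hp
  rw [hp]; simp

theorem eval₂_single_injective {a : ℚ} (ha : a ≠ 0) :
    Function.Injective (eval₂RingHom (C (Γ := ℚ) (R := k)) (single a 1)) := by
  refine (injective_iff_map_eq_zero _).2 fun p hp => ?_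
  ext n
  rw [← coeff_eval₂_single_pow ha]
  rw [coe_eval₂RingHom] at hp
  rw [hp]; simp

theorem eval₂_mem (S : Subring (HahnSeries ℚ k)) {h : HahnSeries ℚ k} (hC : ∀ c, C c ∈ S)
    (hh : h ∈ S) (p : k[X]) : p.eval₂ C h ∈ S := by
  rw [eval₂_eq_sum_range]
  exact S.sum_mem fun i _ => S.mul_mem (hC _) (S.pow_mem hh _)

theorem shift_mem_puiseux (ζ : k) : shift ζ ∈ puiseux k :=
  add_mem (by rw [C_apply]; exact single_mem_puiseux _ _) (single_mem_puiseux _ _)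

variable (k) in
/-- The ring of Hahn series without terms of negative exponent. -/
def integers : Subring (HahnSeries ℚ k) where
  carrier := {x | Low 0 x}
  zero_mem' := Low.zero 0
  one_mem' := fun _ hi => coeff_single_of_ne hi.ne
  add_mem' := Low.add
  neg_mem' := Low.neg
  mul_mem' := fun hx hy => by simpa using Low.mul hx hy

theorem C_mem_integers (c : k) : C c ∈ integers k := fun _ hi => coeff_single_of_ne hi.ne

theorem shift_mem_integers (ζ : k) : shift ζ ∈ integers k :=
  add_mem (C_mem_integers ζ) fun _ hi => coeff_single_of_ne (hi.trans zero_lt_one).ne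

end HahnSeries

variable {Ω : Type*} [Field Ω] [Algebra k[X] Ω]

/-- A ring homomorphism from an extension of `k[X]` to Hahn series over `k` which is the identity
on `k` and maps `X` to `h`. -/
def IsExpansion (h : HahnSeries ℚ k) (φ : Ω →+* HahnSeries ℚ k) : Prop :=
  ∀ p : k[X], φ (algebraMap k[X] Ω p) = p.eval₂ HahnSeries.C h

/-- The conjugates of an algebraic function are its images under expansions. -/
theorem exists_multiset_isExpansion [IsAlgClosed k] [CharZero k]
    [Algebra (FractionRing k[X]) Ω] [IsScalarTower k[X] (FractionRing k[X]) Ω]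
    [Algebra.IsAlgebraic (FractionRing k[X]) Ω] {h : HahnSeries ℚ k} (hh : h ∈ puiseux k)
    (hinj : Function.Injective (eval₂RingHom (HahnSeries.C (Γ := ℚ)) h)) (g : Ω) :
    ∃ s : Multiset (HahnSeries ℚ k), s ≠ 0 ∧ (∀ ρ, ρ ∈ s ↔ ∃ φ : Ω →+* HahnSeries ℚ k,
      IsExpansion h φ ∧ φ g = ρ) ∧
      ∃ θ : FractionRing k[X] →+* HahnSeries ℚ k,
        (∀ p, θ (algebraMap k[X] _ p) = p.eval₂ HahnSeries.C h) ∧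
        ∃ m : ℕ, θ ((minpoly (FractionRing k[X]) g).coeff 0) = (-1) ^ m * s.prod := by
  let C' : k →+* puiseux k := (HahnSeries.C (Γ := ℚ)).codRestrict (puiseux k) fun c => by
    rw [C_apply]; exact single_mem_puiseux _ _
  let ev : k[X] →+* puiseux k := eval₂RingHom C' ⟨h, hh⟩
  have hev : ∀ p, (puiseux k).subtype (ev p) = p.eval₂ HahnSeries.C h := fun p => by
    simp only [ev, coe_eval₂RingHom, hom_eval₂]
    rfl
  have hevinj : Function.Injective ev := fun p q hpq => hinj (by
    simp only [coe_eval₂RingHom, ← hev, hpq])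
  let θ' : FractionRing k[X] →+* puiseux k := IsFractionRing.lift hevinj
  let := θ'.toAlgebra
  have hθ' : ∀ p, θ' (algebraMap k[X] _ p) = ev p := IsFractionRing.lift_algebraMap hevinj
  set f := minpoly (FractionRing k[X]) g with hf
  have hintegral : IsIntegral (FractionRing k[X]) g := Algebra.IsIntegral.isIntegral g
  have hmon : (f.map θ').Monic := (minpoly.monic hintegral).map θ'
  have hspl : (f.map θ').Splits := IsAlgClosed.splits _
  refine ⟨(f.map θ').roots.map (puiseux k).subtype, ?_, fun ρ => ?_,
    (puiseux k).subtype.comp θ', fun p => ?_, f.natDegree, ?_⟩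
  · rw [Ne, Multiset.map_eq_zero, ← Multiset.card_eq_zero, ← hspl.natDegree_eq_card_roots,
      natDegree_map]
    exact (minpoly.natDegree_pos hintegral).ne'
  · have hset := Algebra.IsAlgebraic.range_eval_eq_rootSet_minpoly (F := FractionRing k[X])
      (K := Ω) (puiseux k) g
    have hmem : ∀ r : puiseux k, r ∈ (f.map θ').roots ↔
        ∃ ψ : Ω →ₐ[FractionRing k[X]] puiseux k, ψ g = r := by
      intro r
      have : r ∈ (minpoly (FractionRing k[X]) g).rootSet (puiseux k) ↔ r ∈ (f.map θ').roots := by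
        rw [mem_rootSet', mem_roots']
        simp only [IsRoot.def, eval_map, aeval_def]
        rfl
      rw [← this, ← hset]; rfl
    rw [Multiset.mem_map]
    constructor
    · rintro ⟨r, hr, rfl⟩
      obtain ⟨ψ, rfl⟩ := (hmem r).1 hr
      refine ⟨(puiseux k).subtype.comp ψ.toRingHom, fun p => ?_, rfl⟩
      rw [IsScalarTower.algebraMap_apply k[X] (FractionRing k[X]) Ω, ← hev, ← hθ']
      exact congrArg (puiseux k).subtype (ψ.commutes _)
    · rintro ⟨φ, hφ, rfl⟩
      have hroot : (f.map ((puiseux k).subtype.comp θ')).eval (φ g) = 0 := by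
        have h1 : (puiseux k).subtype.comp θ' = φ.comp (algebraMap (FractionRing k[X]) Ω) := by
          refine IsLocalization.ringHom_ext (nonZeroDivisors k[X]) (RingHom.ext fun p => ?_)
          simp only [RingHom.comp_apply, hθ', hev,
            ← IsScalarTower.algebraMap_apply k[X] (FractionRing k[X]) Ω, hφ p]
        rw [h1, ← Polynomial.map_map, eval_map, eval₂_hom, eval_map, ← aeval_def, minpoly.aeval,
          map_zero]
      rw [← Polynomial.map_map] at hroot
      have h2 : φ g ∈ ((f.map θ').map (puiseux k).subtype).roots :=
        (mem_roots (map_ne_zero hmon.ne_zero)).2 hroot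
      rw [hspl.roots_map, Multiset.mem_map] at h2
      exact h2
  · rw [RingHom.comp_apply, hθ', hev]
  · rw [RingHom.comp_apply]
    have := hspl.coeff_zero_eq_prod_roots_of_monic hmon
    rw [coeff_map, natDegree_map] at this
    rw [this, map_mul, map_pow, map_neg, map_one, map_multiset_prod]

/-- An algebraic function which is regular everywhere and vanishes at infinity is zero. -/
theorem eq_zero_of_low_isExpansion [IsAlgClosed k] [CharZero k]
    [Algebra (FractionRing k[X]) Ω] [IsScalarTower k[X] (FractionRing k[X]) Ω]
    [Algebra.IsAlgebraic (FractionRing k[X]) Ω] {g : Ω}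
    (hfin : ∀ ζ, ∀ φ : Ω →+* HahnSeries ℚ k, IsExpansion (shift ζ) φ → Low 0 (φ g))
    (hinf : ∀ φ : Ω →+* HahnSeries ℚ k, IsExpansion (single (-1) 1) φ → Low 1 (φ g)) :
    g = 0 := by
  have hintegral : IsIntegral (FractionRing k[X]) g := Algebra.IsIntegral.isIntegral g
  rw [← minpoly.coeff_zero_eq_zero hintegral]
  set a := (minpoly (FractionRing k[X]) g).coeff 0
  obtain ⟨p, q, hpq, ha⟩ := IsFractionRing.exists_reduced_fraction k[X] a
  have hneg : ∀ m : ℕ, Low (0 : ℚ) ((-1 : HahnSeries ℚ k) ^ m) := by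
    exact fun m => (integers k).pow_mem ((integers k).neg_mem (integers k).one_mem) m
  have hq0 : (q : k[X]) ≠ 0 := nonZeroDivisors.ne_zero q.2
  have hqa : a * algebraMap _ _ (q : k[X]) = algebraMap _ _ p := by
    rw [← ha, IsLocalization.mk'_spec]
  have hroot : ∀ ζ, (q : k[X]).eval ζ ≠ 0 := by
    intro ζ hζ
    obtain ⟨s, -, hs, θ, hθ, m, hm⟩ := exists_multiset_isExpansion (shift_mem_puiseux ζ)
      (eval₂_shift_injective ζ) g
    have hlow : Low 0 (θ a) := by
      rw [hm]
      simpa using (hneg m).mul ((integers k).multiset_prod_mem _ fun ρ hρ => by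
        obtain ⟨φ, hφ, rfl⟩ := (hs ρ).1 hρ
        exact hfin ζ φ hφ)
    have hq : Low 0 (θ (algebraMap _ _ (q : k[X]))) := by
      rw [hθ]
      exact eval₂_mem (integers k) (C_mem_integers) (shift_mem_integers ζ) _
    have h1 := hlow.coeff_mul hq
    rw [← map_mul, hqa, hθ, hθ, add_zero, coeff_eval₂_shift, coeff_eval₂_shift, hζ,
      mul_zero] at h1
    have h2 := hpq.isCoprime
    obtain ⟨u, v, huv⟩ := h2
    have := congrArg (Polynomial.eval ζ) huv
    simp [h1, hζ] at this
  obtain ⟨c, hc⟩ : ∃ c, (q : k[X]) = Polynomial.C c := by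
    refine ⟨_, eq_C_of_degree_eq_zero ?_⟩
    by_contra hd
    obtain ⟨ζ, hζ⟩ := IsAlgClosed.exists_root _ hd
    exact hroot ζ hζ
  obtain ⟨s, hs0, hs, θ, hθ, m, hm⟩ :=
    exists_multiset_isExpansion (single_mem_puiseux (-1 : ℚ) (1 : k))
    (eval₂_single_injective (by norm_num : (-1 : ℚ) ≠ 0)) g
  have hlow : Low 1 (θ a) := by
    obtain ⟨ρ, hρ⟩ := Multiset.exists_mem_of_ne_zero hs0
    obtain ⟨s', rfl⟩ := Multiset.exists_cons_of_mem hρ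
    have h1 : ∀ ρ' ∈ ρ ::ₘ s', Low 1 ρ' := fun ρ' hρ' => by
      obtain ⟨φ, hφ, rfl⟩ := (hs ρ').1 hρ'
      exact hinf φ hφ
    rw [hm, Multiset.prod_cons]
    have := (hneg m).mul ((h1 ρ hρ).mul ((integers k).multiset_prod_mem _ fun x hx =>
      (h1 x (Multiset.mem_cons_of_mem hx)).mono zero_le_one))
    simpa using this
  have hp : p = 0 := by
    have hC : Low (0 : ℚ) (HahnSeries.C (Γ := ℚ) c) := fun i hi => by
      rw [C_apply, coeff_single_of_ne hi.ne]
    have h1 := hlow.mul hC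
    rw [← eval₂_C (HahnSeries.C (Γ := ℚ)) (single (-1) 1), ← hc, ← hθ, ← map_mul, hqa, hθ] at h1
    ext n
    rw [← coeff_eval₂_single_pow (by norm_num : (-1 : ℚ) ≠ 0)]
    rw [h1 _ (by
      rw [nsmul_eq_mul]; have : (0 : ℚ) ≤ n := n.cast_nonneg
      linarith)]
    simp
  rw [hp, map_zero] at hqa
  exact (mul_eq_zero.1 hqa).resolve_right fun h => hq0 ((FaithfulSMul.algebraMap_injective _ _)
    (h.trans (map_zero _).symm))

end

section
open HahnSeries

variable {k : Type*} [Field k]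

namespace HahnSeries

variable (k) in
/-- Hahn series with integral exponents. -/
abbrev intSupported : Subfield (HahnSeries ℚ k) :=
  supportedIn k (Int.castAddHom ℚ).range

theorem C_mem_intSupported (c : k) : C c ∈ intSupported k := fun i hi => by
  have : i = 0 := eq_of_mem_support_single hi
  rw [this]; exact zero_mem _

theorem coeff_eq_zero_of_mem_intSupported {x : HahnSeries ℚ k} (hx : x ∈ intSupported k) {i : ℚ}
    (hi : i ∉ (Int.castAddHom ℚ).range) : x.coeff i = 0 := by
  by_contra h
  exact hi (mem_supportedIn.1 hx i h)

/-- Derivations of Hahn series lowering the exponents by at most one, with controlled leading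
term. -/
structure IsRegularDerivation (𝔻 : Derivation ℤ (HahnSeries ℚ k) (HahnSeries ℚ k)) (b : k) :
    Prop where
  low : ∀ {p f}, Low p f → Low (p - 1) (𝔻 f)
  coeff : ∀ {p f}, Low p f → (𝔻 f).coeff (p - 1) = b * p * f.coeff p
  mem : ∀ {f}, f ∈ intSupported k → 𝔻 f ∈ intSupported k

theorem exists_low {v : HahnSeries ℚ k} (hv : v ≠ 0) : ∃ p, Low p v ∧ v.coeff p ≠ 0 :=
  ⟨v.order, fun _ => coeff_eq_zero_of_lt_order, coeff_order_eq_zero.not.2 hv⟩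

theorem coeff_six_mul_add_C {w : HahnSeries ℚ k} (t : k) (i : ℚ) :
    (6 * w + C t).coeff i = 6 * w.coeff i + (C t : HahnSeries ℚ k).coeff i := by
  rw [coeff_add, show (6 : HahnSeries ℚ k) = C 6 from (map_ofNat C 6).symm, C_apply,
    coeff_single_zero_mul]

variable [CharZero k]

theorem IsRegularDerivation.mem_intSupported
    {𝔻 : Derivation ℤ (HahnSeries ℚ k) (HahnSeries ℚ k)} {b : k}
    (h : IsRegularDerivation 𝔻 b) (hb : b ≠ 0) {t : k} {v : HahnSeries ℚ k}
    (hv : 𝔻 (𝔻 v) = 6 * v ^ 2 + C t) : v ∈ intSupported k := by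
  have low2 : ∀ {p f}, Low p f → Low (p - 2) (𝔻 (𝔻 f)) := fun {p f} hf => by
    have := h.low (h.low hf)
    rwa [show p - 1 - 1 = p - 2 by ring] at this
  have coeff2 : ∀ {p f}, Low p f →
      (𝔻 (𝔻 f)).coeff (p - 2) = b ^ 2 * (p - 1) * p * f.coeff p := fun {p f} hf => by
    have := h.coeff (h.low hf)
    rw [show p - 1 - 1 = p - 2 by ring, h.coeff hf] at this
    rw [this]; push_cast; ring
  have coeffC : ∀ {i : ℚ}, i ≠ 0 → (C t : HahnSeries ℚ k).coeff i = 0 := fun hi => by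
    rw [C_apply, coeff_single_of_ne hi]
  have hlow : Low (-2) v := by
    by_cases hv0 : v = 0
    · rw [hv0]; exact Low.zero _
    obtain ⟨p, hp, hp0⟩ := exists_low hv0
    refine hp.mono ?_
    by_contra! hlt
    have := congrArg (fun z => z.coeff (p + p)) hv
    rw [low2 hp _ (by linarith), coeff_six_mul_add_C, pow_two, hp.coeff_mul hp,
      coeffC (by linarith), add_zero] at this
    exact mul_ne_zero (by norm_num) (mul_ne_zero hp0 hp0) this.symm
  have hlead : v.coeff (-2) = 0 ∨ v.coeff (-2) = b ^ 2 := by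
    have := congrArg (fun z => z.coeff (-2 + -2)) hv
    rw [coeff_six_mul_add_C, pow_two, hlow.coeff_mul hlow, coeffC (by norm_num), add_zero,
      show (-2 + -2 : ℚ) = -2 - 2 by norm_num, coeff2 hlow] at this
    push_cast at this
    have : 6 * (v.coeff (-2) * (v.coeff (-2) - b ^ 2)) = 0 := by linear_combination -this
    simpa [sub_eq_zero] using this
  set Z := (Int.castAddHom ℚ).range
  set w := v.restrict (Z : Set ℚ) with hw
  have hwv : ∀ i ∈ Z, w.coeff i = v.coeff i := fun i hi => coeff_restrict_of_mem _ hi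
  have hwv' : ∀ i ∉ Z, w.coeff i = 0 := fun i hi => coeff_restrict_of_notMem _ hi
  have hwZ : w ∈ intSupported k := mem_supportedIn.2 fun i hi => by
    by_contra h; exact hi (hwv' i h)
  obtain hε0 | hε0 := eq_or_ne (v - w) 0
  · rw [sub_eq_zero.1 hε0]; exact hwZ
  exfalso
  obtain ⟨ε, hε⟩ : ∃ ε, ε = v - w := ⟨_, rfl⟩
  rw [← hε] at hε0
  obtain ⟨m, hm, hm0⟩ := exists_low hε0
  have hmZ : m ∉ Z := fun hmZ => hm0 (by rw [hε, coeff_sub, hwv m hmZ, sub_self])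
  have hm2 : -2 < m := by
    by_contra! hle
    obtain hlt | rfl := hle.lt_or_eq
    · exact hm0 (by rw [hε, coeff_sub, hwv' m hmZ, hlow m hlt, sub_zero])
    · exact hmZ ⟨-2, by simp⟩
  have hm2Z : m - 2 ∉ Z := fun hmem => hmZ (by
    have := Z.add_mem hmem ⟨2, rfl⟩
    simpa using this)
  have hwlow : Low (-2) w := fun i hi => by
    by_cases hiZ : i ∈ Z
    · rw [hwv i hiZ, hlow i hi]
    · exact hwv' i hiZ
  have hsplit : 𝔻 (𝔻 ε) = (6 * w ^ 2 + C t - 𝔻 (𝔻 w)) + (6 * (2 * (w * ε) + ε * ε) + C 0) := by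
    rw [hε, map_sub, map_sub, hv, map_zero]; ring
  have := congrArg (fun z => z.coeff (m - 2)) hsplit
  rw [coeff2 hm, coeff_add, coeff_six_mul_add_C, coeff_add, two_mul, coeff_add,
    show m - 2 = -2 + m by ring, hwlow.coeff_mul hm, hm.mul hm _ (by linarith),
    hwv (-2) ⟨-2, by simp⟩, map_zero, coeff_zero,
    coeff_eq_zero_of_mem_intSupported (sub_mem (add_mem (mul_mem (by
      rw [show (6 : HahnSeries ℚ k) = C 6 from (map_ofNat C 6).symm]
      exact C_mem_intSupported 6) (pow_mem hwZ 2)) (C_mem_intSupported t)) (h.mem (h.mem hwZ)))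
      (by rwa [show -2 + m = m - 2 by ring])] at this
  have key : b ^ 2 * (m - 1) * m = 12 * v.coeff (-2) := by
    refine mul_right_cancel₀ hm0 ?_
    linear_combination this
  rcases hlead with h0 | h0 <;> rw [h0] at key
  · have h1 : (m - 1 : k) * m = 0 := by
      refine mul_left_cancel₀ (pow_ne_zero 2 hb) ?_
      linear_combination key
    have h2 : (m - 1) * m = 0 := by exact_mod_cast h1
    rcases mul_eq_zero.1 h2 with h2 | h2
    · exact hmZ ⟨1, by simp; linarith⟩
    · exact hmZ ⟨0, by simp; linarith⟩
  · have h1 : (m - 4 : k) * (m + 3) = 0 := by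
      refine mul_left_cancel₀ (pow_ne_zero 2 hb) ?_
      linear_combination key
    have h2 : (m - 4) * (m + 3) = 0 := by exact_mod_cast h1
    rcases mul_eq_zero.1 h2 with h2 | h2
    · exact hmZ ⟨4, by simp; linarith⟩
    · exact hmZ ⟨-3, by simp; linarith⟩

end HahnSeries
end

/-- A ring homomorphism commuting with derivations on `R` does so on everything algebraic over
`R`. -/
theorem Derivation.map_comp_eq_of_isAlgebraic {R F H : Type*} [CommRing R] [Field F] [Field H]
    [CharZero F] [Algebra R F] [FaithfulSMul R F] (φ : F →+* H) (d : Derivation ℤ F F)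
    (e : Derivation ℤ H H)
    (h : ∀ r, φ (d (algebraMap R F r)) = e (φ (algebraMap R F r))) {a : F}
    (ha : IsAlgebraic R a) : φ (d a) = e (φ a) := by
  rw [← sub_eq_zero]
  by_contra h0
  have hinj : Function.Injective (algebraMap R F) := FaithfulSMul.algebraMap_injective R F
  have : IsDomain R := hinj.isDomain
  have : CharZero R := (algebraMap R F).charZero
  have hp : ∀ p : Polynomial R, φ (d (Polynomial.aeval a p)) - e (φ (Polynomial.aeval a p)) =
      φ (Polynomial.aeval a (Polynomial.derivative p)) * (φ (d a) - e (φ a)) := by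
    intro p
    induction p using Polynomial.induction_on' with
    | add p q hp hq => simp only [map_add, add_mul, ← hp, ← hq]; ring
    | monomial n r =>
      simp [Polynomial.aeval_monomial, Polynomial.derivative_monomial, Derivation.leibniz_pow,
        h]
      ring
  have key : ∀ n : ℕ, ∀ p : Polynomial R, p.natDegree = n → Polynomial.aeval a p = 0 → p = 0 := by
    intro n
    induction n with
    | zero =>
      intro p hp h
      rw [Polynomial.eq_C_of_natDegree_eq_zero hp] at h ⊢
      simp only [Polynomial.aeval_C] at h
      rw [(map_eq_zero_iff _ hinj).1 h, map_zero]
    | succ n ih =>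
      intro p hpn h
      have h1 := hp p
      rw [h, map_zero, map_zero, map_zero, sub_zero] at h1
      have h2 := (map_eq_zero φ).1 ((mul_eq_zero.1 h1.symm).resolve_right h0)
      have h3 := ih p.derivative (by rw [Polynomial.natDegree_derivative, hpn]; rfl) h2
      have h4 := Polynomial.derivative_eq_zero.1 h3
      rw [h4] at hpn
      simp at hpn
  obtain ⟨p, hp0, hp⟩ := ha
  exact hp0 (key _ p rfl hp)

section
open HahnSeries

variable {k : Type*} [Field k]

namespace HahnSeries

theorem Low.pow {p : ℚ} {z : HahnSeries ℚ k} (h : Low p z) (n : ℕ) :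
    Low (n * p) (z ^ n) ∧ (z ^ n).coeff (n * p) = z.coeff p ^ n := by
  induction n with
  | zero =>
    rw [Nat.cast_zero, zero_mul, pow_zero, pow_zero]
    exact ⟨(integers k).one_mem, by rw [coeff_one, if_pos rfl]⟩
  | succ n ih =>
    rw [pow_succ, pow_succ, Nat.cast_succ, add_mul, one_mul, ih.1.coeff_mul h, ih.2]
    exact ⟨ih.1.mul h, rfl⟩

theorem mem_integers_of_isIntegralElem {R : Type*} [CommRing R] {f : R →+* HahnSeries ℚ k}
    (hf : ∀ r, f r ∈ integers k) {z : HahnSeries ℚ k} (hz : f.IsIntegralElem z) :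
    z ∈ integers k := by
  obtain ⟨P, hP, hPz⟩ := hz
  by_cases hz0 : z = 0
  · rw [hz0]; exact zero_mem _
  obtain ⟨p, hp, hp0⟩ := exists_low hz0
  by_contra hneg
  have hp1 : p < 0 := by
    by_contra! h
    exact hneg (hp.mono h)
  have h1 := congrArg (fun x => x.coeff (P.natDegree * p)) hPz
  rw [Polynomial.eval₂_eq_sum_range, Finset.sum_range_succ, hP.coeff_natDegree, map_one,
    one_mul] at h1
  have h2 : Low ((P.natDegree - 1) * p)
      (∑ i ∈ Finset.range P.natDegree, f (P.coeff i) * z ^ i) := by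
    refine Finset.sum_induction _ (Low ((P.natDegree - 1) * p)) (fun _ _ => Low.add)
      (Low.zero _) fun i hi => ?_
    refine (Low.mul (hf (P.coeff i)) (hp.pow i).1).mono ?_
    have : (i : ℚ) + 1 ≤ P.natDegree := by exact_mod_cast Finset.mem_range.1 hi
    nlinarith
  change (_ + _ : HahnSeries ℚ k).coeff _ = 0 at h1
  rw [coeff_add, (hp.pow _).2, h2 _ (by nlinarith), zero_add] at h1
  exact pow_ne_zero _ hp0 h1

theorem mapDerivation_C (d : Derivation ℤ k k) (c : k) :
    mapDerivation ℚ d (C c) = C (d c) := by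
  ext i
  rw [coeff_mapDerivation, C_apply, C_apply]
  by_cases h : i = 0
  · rw [h, coeff_single_same, coeff_single_same]
  · rw [coeff_single_of_ne h, coeff_single_of_ne h, map_zero]

theorem mapDerivation_single_one (d : Derivation ℤ k k) (q : ℚ) :
    mapDerivation ℚ d (single q 1) = 0 := by
  ext i
  rw [coeff_mapDerivation, coeff_zero]
  by_cases h : i = q
  · rw [h, coeff_single_same, d.map_one_eq_zero]
  · rw [coeff_single_of_ne h, map_zero]

theorem shift_mem_intSupported (ζ : k) : shift ζ ∈ intSupported k :=
  add_mem (C_mem_intSupported ζ) fun i hi => by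
    have : i = 1 := eq_of_mem_support_single hi
    rw [this]; exact ⟨1, by simp⟩

variable [CharZero k]

variable (k) in
/-- The derivation `d/dx`. -/
noncomputable def ddx : Derivation ℤ (HahnSeries ℚ k) (HahnSeries ℚ k) :=
  (single (-1) 1 : HahnSeries ℚ k) • eulerDerivation (Rat.castHom k).toAddMonoidHom

theorem coeff_ddx (f : HahnSeries ℚ k) (i : ℚ) :
    (ddx k f).coeff i = ((i + 1 : ℚ) : k) * f.coeff (i + 1) := by
  have := coeff_single_mul_add (r := (1 : k)) (x := eulerDerivation
    (Rat.castHom k).toAddMonoidHom f) (a := i + 1) (b := -1)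
  rw [add_neg_cancel_right, one_mul] at this
  exact this

theorem ddx_C (c : k) : ddx k (C c) = 0 := by
  ext i
  rw [coeff_ddx, C_apply, coeff_zero]
  by_cases h : i + 1 = 0
  · rw [h]; simp
  · rw [coeff_single_of_ne h, mul_zero]

theorem ddx_single_neg_one : ddx k (single (-1) 1) = single (-2) (-1) := by
  ext i
  rw [coeff_ddx]
  by_cases h : i = -2
  · rw [h, show (-2 + 1 : ℚ) = -1 by norm_num, coeff_single_same, coeff_single_same]; simp
  · rw [coeff_single_of_ne h, coeff_single_of_ne fun h' => h (by linarith), mul_zero]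

theorem ddx_single_one : ddx k (single 1 1) = 1 := by
  ext i
  rw [coeff_ddx, coeff_one]
  by_cases h : i = 0
  · subst h; simp
  · rw [coeff_single_of_ne (by simpa using h), if_neg h, mul_zero]

theorem ddx_shift (ζ : k) : ddx k (shift ζ) = 1 := by
  rw [shift, map_add, ddx_C, ddx_single_one, zero_add]

theorem Low.ddx {p : ℚ} {f : HahnSeries ℚ k} (hf : Low p f) : Low (p - 1) (ddx k f) :=
  fun i hi => by rw [coeff_ddx, hf _ (by linarith), mul_zero]

theorem ddx_mem_intSupported {f : HahnSeries ℚ k} (hf : f ∈ intSupported k) :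
    ddx k f ∈ intSupported k := mem_supportedIn.2 fun i hi => by
  rw [coeff_ddx] at hi
  have := sub_mem (mem_supportedIn.1 hf _ (right_ne_zero_of_mul hi))
    (show (1 : ℚ) ∈ (Int.castAddHom ℚ).range from ⟨1, by simp⟩)
  rwa [add_sub_cancel_right] at this

theorem ddx_mem_integers {f : HahnSeries ℚ k} (hf : f ∈ intSupported k) (hf' : f ∈ integers k) :
    ddx k f ∈ integers k := fun i hi => by
  rw [coeff_ddx]
  by_contra h
  obtain ⟨n, hn⟩ := mem_supportedIn.1 hf _ (right_ne_zero_of_mul h)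
  have h1 : i + 1 ≠ 0 := fun h1 => h (by rw [h1]; simp)
  have h2 : ¬ i + 1 < 0 := fun h2 => right_ne_zero_of_mul h (hf' _ h2)
  rw [← hn] at h1 h2
  have hn' : (n : ℚ) = i + 1 := hn
  have h3 : n ≠ 0 := fun h3 => h1 (by simp [h3])
  have h4 : ¬ n < 0 := fun h4 => h2 (by simpa using h4)
  have h5 : (1 : ℚ) ≤ n := by exact_mod_cast (by omega : 1 ≤ n)
  linarith

theorem isRegularDerivation_sum {ι : Type*} (s : Finset ι) (δ : ι → Derivation ℤ k k)
    {h : ι → HahnSeries ℚ k} (hh : ∀ i, h i ∈ intSupported k) (hh' : ∀ i, h i ∈ integers k)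
    {B : HahnSeries ℚ k} (hB : B ∈ intSupported k) (hB' : B ∈ integers k) :
    IsRegularDerivation (∑ j ∈ s, h j • mapDerivation ℚ (δ j) + B • ddx k) (B.coeff 0) := by
  have happ : ∀ f, (∑ j ∈ s, h j • mapDerivation ℚ (δ j) + B • ddx k) f =
      ∑ j ∈ s, h j * mapDerivation ℚ (δ j) f + B * ddx k f := fun f => by
    rw [Derivation.add_apply, Derivation.coe_smul, Pi.smul_apply, smul_eq_mul,
      ← Derivation.coeFnAddMonoidHom_apply, map_sum, Finset.sum_apply]
    rfl
  have hmap : ∀ {p} {f : HahnSeries ℚ k}, Low p f →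
      Low p (∑ j ∈ s, h j * mapDerivation ℚ (δ j) f) := fun {p f} hf =>
    Finset.sum_induction _ (Low p) (fun _ _ => Low.add) (Low.zero _) fun j _ => by
      have hlow : Low p (mapDerivation ℚ (δ j) f) := fun i hi => by
        rw [coeff_mapDerivation, hf i hi, map_zero]
      simpa using Low.mul (hh' j) hlow
  refine ⟨fun {p f} hf => ?_, fun {p f} hf => ?_, fun {f} hf => ?_⟩
  · rw [happ]
    refine ((hmap hf).mono (by linarith)).add ?_
    simpa using Low.mul hB' hf.ddx
  · rw [happ, coeff_add, hmap hf _ (by linarith), zero_add]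
    have := Low.coeff_mul hB' hf.ddx
    rw [zero_add, coeff_ddx, sub_add_cancel] at this
    rw [this]; ring
  · rw [happ]
    refine add_mem (sum_mem fun j _ => mul_mem (hh j) (mem_supportedIn.2 fun i hi => ?_))
      (mul_mem hB (ddx_mem_intSupported hf))
    refine mem_supportedIn.1 hf i fun h0 => hi ?_
    rw [coeff_mapDerivation, h0, map_zero]

end HahnSeries
end

section
open HahnSeries Polynomial

variable {k Ω : Type*} [Field k] [CharZero k] [Field Ω] [CharZero Ω] [Algebra k[X] Ω]
  [FaithfulSMul k[X] Ω] [Algebra.IsAlgebraic k[X] Ω]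

omit [CharZero k] in
theorem IsExpansion.map_derivation {h : HahnSeries ℚ k} {φ : Ω →+* HahnSeries ℚ k}
    (hφ : IsExpansion h φ) (d : Derivation ℤ Ω Ω)
    (e : Derivation ℤ (HahnSeries ℚ k) (HahnSeries ℚ k))
    (hC : ∀ c, φ (d (algebraMap k[X] Ω (Polynomial.C c))) = e (HahnSeries.C c))
    (hX : φ (d (algebraMap k[X] Ω X)) = e h) (a : Ω) : φ (d a) = e (φ a) := by
  have hφX : φ (algebraMap k[X] Ω X) = h := by rw [hφ, eval₂_X]
  have hφC : ∀ c, φ (algebraMap k[X] Ω (Polynomial.C c)) = HahnSeries.C c := fun c => by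
    rw [hφ, eval₂_C]
  refine Derivation.map_comp_eq_of_isAlgebraic (R := k[X]) φ d e (fun p => ?_)
    (Algebra.IsAlgebraic.isAlgebraic a)
  induction p using Polynomial.induction_on' with
  | add p q hp hq => simp only [map_add, hp, hq]
  | monomial n c =>
    rw [← C_mul_X_pow_eq_monomial]
    simp only [map_mul, map_pow, Derivation.leibniz, Derivation.leibniz_pow, smul_eq_mul, map_add,
      nsmul_eq_mul, map_natCast, hφX, hφC, hC, hX]

variable {d : Derivation ℤ Ω Ω} (hdC : ∀ c, d (algebraMap k[X] Ω (Polynomial.C c)) = 0)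
  (hdX : d (algebraMap k[X] Ω X) = 1)

include hdC hdX

theorem IsExpansion.map_d {ζ : k} {φ : Ω →+* HahnSeries ℚ k}
    (hφ : IsExpansion (shift ζ) φ) (a : Ω) : φ (d a) = ddx k (φ a) :=
  hφ.map_derivation d (ddx k) (fun c => by rw [hdC, ddx_C, map_zero])
    (by rw [hdX, ddx_shift, map_one]) a

theorem IsExpansion.low_map_iterate_d {φ : Ω →+* HahnSeries ℚ k}
    (hφ : IsExpansion (single (-1) 1) φ) {a : Ω} {p : ℚ} (ha : Low p (φ a)) (n : ℕ) :
    Low (p + n) (φ (d^[n] a)) := by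
  have key : ∀ a, φ (d a) = single 2 (-1) * ddx k (φ a) := fun a => by
    refine hφ.map_derivation d ((single 2 (-1) : HahnSeries ℚ k) • ddx k) (fun c => ?_) ?_ a
    · rw [hdC, map_zero, Derivation.coe_smul, Pi.smul_apply, ddx_C, smul_zero]
    · simp [hdX, ddx_single_neg_one, single_mul_single]
  induction n with
  | zero => simpa using ha
  | succ n ih =>
    rw [Function.iterate_succ_apply', key]
    have h2 : Low (2 : ℚ) (single 2 (-1) : HahnSeries ℚ k) := fun i hi => coeff_single_of_ne hi.ne
    refine (h2.mul ih.ddx).mono ?_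
    push_cast; linarith

theorem exists_iterate_d_eq_zero [IsAlgClosed k] (D : Derivation ℤ Ω Ω)
    {ι : Type*} (s : Finset ι) (e : ι → ℕ) (δ : ι → Derivation ℤ k k) {β t : k}
    (hDC : ∀ c, D (algebraMap k[X] Ω (Polynomial.C c)) =
      ∑ j ∈ s, algebraMap k[X] Ω (X ^ e j * Polynomial.C (δ j c)))
    (hDX : D (algebraMap k[X] Ω X) = algebraMap k[X] Ω (Polynomial.C β))
    (htrans : ∀ ζ, ∑ j ∈ s, ζ ^ e j * δ j ζ ≠ β) {v : Ω}
    (hv : D (D v) = 6 * v ^ 2 + algebraMap k[X] Ω (Polynomial.C t)) {c : k[X]}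
    (hc : (algebraMap k[X] Ω).IsIntegralElem (algebraMap k[X] Ω c * v)) :
    ∃ n, d^[n] (algebraMap k[X] Ω c * v) = 0 := by
  let := FractionRing.liftAlgebra k[X] Ω
  have := FractionRing.isScalarTower_liftAlgebra k[X] Ω
  have : Algebra.IsAlgebraic (FractionRing k[X]) Ω := Algebra.IsAlgebraic.extendScalars
    (FaithfulSMul.algebraMap_injective k[X] (FractionRing k[X]))
  set b := algebraMap k[X] Ω c * v with hb
  have hfin : ∀ ζ, ∀ φ : Ω →+* HahnSeries ℚ k, IsExpansion (shift ζ) φ →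
      φ b ∈ intSupported k ∧ φ b ∈ integers k := by
    intro ζ φ hφ
    have hintegral : ∀ p : k[X], p.eval₂ HahnSeries.C (shift ζ) ∈ intSupported k := fun p =>
      eval₂_mem (intSupported k).toSubring C_mem_intSupported (shift_mem_intSupported ζ) p
    have hintegral' : ∀ p : k[X], p.eval₂ HahnSeries.C (shift ζ) ∈ integers k := fun p =>
      eval₂_mem (integers k) C_mem_integers (shift_mem_integers ζ) p
    set P : k[X] := Polynomial.C β - ∑ j ∈ s, X ^ e j * Polynomial.C (δ j ζ) with hP
    have hreg := isRegularDerivation_sum s δ (h := fun j => shift ζ ^ e j)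
      (fun j => pow_mem (shift_mem_intSupported ζ) _) (fun j => pow_mem (shift_mem_integers ζ) _)
      (hintegral P) (hintegral' P)
    set 𝔻 := ∑ j ∈ s, shift ζ ^ e j • mapDerivation ℚ (δ j) + P.eval₂ HahnSeries.C (shift ζ) • ddx k
      with h𝔻
    have happ : ∀ f, 𝔻 f = ∑ j ∈ s, shift ζ ^ e j * mapDerivation ℚ (δ j) f +
        P.eval₂ HahnSeries.C (shift ζ) * ddx k f := fun f => by
      rw [h𝔻, Derivation.add_apply, Derivation.coe_smul, Pi.smul_apply, smul_eq_mul,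
        ← Derivation.coeFnAddMonoidHom_apply, map_sum, Finset.sum_apply]
      rfl
    have hcomm : ∀ a, φ (D a) = 𝔻 (φ a) := by
      refine hφ.map_derivation D 𝔻 (fun c => ?_) ?_
      · rw [hDC, happ, ddx_C, mul_zero, add_zero, map_sum]
        refine Finset.sum_congr rfl fun j _ => ?_
        rw [hφ, mapDerivation_C, eval₂_mul, eval₂_X_pow, eval₂_C]
      · rw [hDX, happ, hφ, eval₂_C, ddx_shift, mul_one, hP, eval₂_sub, eval₂_C, eval₂_finsetSum]
        rw [eq_comm, add_sub_left_comm, add_eq_left, sub_eq_zero]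
        refine Finset.sum_congr rfl fun j _ => ?_
        rw [eval₂_mul, eval₂_X_pow, eval₂_C, shift, map_add, mapDerivation_C,
          mapDerivation_single_one, add_zero]
    have hB : (P.eval₂ HahnSeries.C (shift ζ)).coeff 0 ≠ 0 := by
      rw [coeff_eval₂_shift, hP, eval_sub, eval_C, eval_finsetSum, sub_ne_zero]
      simp only [eval_mul, eval_pow, eval_X, eval_C]
      exact (htrans ζ).symm
    have hvint : φ v ∈ intSupported k := by
      refine hreg.mem_intSupported hB (t := t) ?_
      rw [← hcomm, ← hcomm, hv, map_add, map_mul, map_pow, map_ofNat, hφ, eval₂_C]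
    refine ⟨by rw [hb, map_mul, hφ]; exact mul_mem (hintegral c) hvint, ?_⟩
    refine mem_integers_of_isIntegralElem (f := φ.comp (algebraMap k[X] Ω))
      (fun r => by rw [RingHom.comp_apply, hφ]; exact hintegral' r) ?_
    obtain ⟨Q, hQ, hQb⟩ := hc
    exact ⟨Q, hQ, by rw [← hom_eval₂, hQb, map_zero]⟩
  have hiter : ∀ n ζ, ∀ φ : Ω →+* HahnSeries ℚ k, IsExpansion (shift ζ) φ →
      φ (d^[n] b) ∈ intSupported k ∧ φ (d^[n] b) ∈ integers k := by
    intro n ζ φ hφ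
    induction n with
    | zero => exact hfin ζ φ hφ
    | succ n ih =>
      rw [Function.iterate_succ_apply', hφ.map_d hdC hdX]
      exact ⟨ddx_mem_intSupported ih.1, ddx_mem_integers ih.1 ih.2⟩
  obtain ⟨S, -, hS, -⟩ :=
    exists_multiset_isExpansion (single_mem_puiseux (-1 : ℚ) (1 : k))
    (eval₂_single_injective (by norm_num : (-1 : ℚ) ≠ 0)) b
  have hbound : ∃ n : ℕ, ∀ ρ ∈ S, Low (-n : ℚ) ρ := by
    clear hS
    induction S using Multiset.induction_on with
    | empty => exact ⟨0, by simp⟩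
    | cons ρ S ih =>
      obtain ⟨n, hn⟩ := ih
      obtain ⟨m, hm⟩ := exists_nat_ge (-ρ.order)
      refine ⟨n + m, fun ρ' hρ' => ?_⟩
      rcases Multiset.mem_cons.1 hρ' with rfl | h
      · have : Low ρ'.order ρ' := fun _ => coeff_eq_zero_of_lt_order
        refine this.mono ?_
        push_cast; have : (0 : ℚ) ≤ n := n.cast_nonneg
        linarith
      · refine (hn ρ' h).mono ?_
        push_cast; have : (0 : ℚ) ≤ m := m.cast_nonneg
        linarith
  obtain ⟨n, hn⟩ := hbound
  refine ⟨n + 1, eq_zero_of_low_isExpansion (fun ζ φ hφ => (hiter (n + 1) ζ φ hφ).2)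
    fun φ hφ => ?_⟩
  have := hφ.low_map_iterate_d hdC hdX (hn (φ b) ((hS _).2 ⟨φ, hφ, rfl⟩)) (n + 1)
  simpa using this
end

/-- A derivation mapping `E` to elements algebraic over `E` preserves the relative algebraic
closure of `E`. -/
theorem Derivation.exists_algebraicClosure {E F : Type*} [Field E] [CharZero E] [Field F]
    [Algebra E F] (d : Derivation ℤ F F) (h : ∀ e, IsAlgebraic E (d (algebraMap E F e))) :
    ∃ d' : Derivation ℤ (algebraicClosure E F) (algebraicClosure E F),
      ∀ a, (d' a : F) = d a := by
  let f : E →+ algebraicClosure E F :=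
    { toFun := fun e => ⟨d (algebraMap E F e), mem_algebraicClosure_iff.2 (h e)⟩
      map_zero' := by ext; simp
      map_add' := fun a b => by ext; simp }
  let δ : Derivation ℤ E (algebraicClosure E F) := Derivation.mk' f.toIntLinearMap fun a b => by
    ext
    simp [f, Algebra.smul_def]
  have : Algebra.FormallyEtale E (algebraicClosure E F) := Algebra.FormallyEtale.of_isSeparable _ _
  have : CharZero F := charZero_of_injective_algebraMap (algebraMap E F).injective
  obtain ⟨d', hd'⟩ := Derivation.exists_extend_of_formallyEtale δ
  refine ⟨d', fun a => ?_⟩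
  refine Derivation.map_comp_eq_of_isAlgebraic (R := E) (algebraMap (algebraicClosure E F) F) d' d
    (fun r => ?_) (Algebra.IsAlgebraic.isAlgebraic a)
  rw [hd']
  rfl

theorem Derivation.map_mem_adjoin {K F : Type*} [Field K] [Field F] [Algebra K F]
    (d : Derivation ℤ F F) (hK : ∀ c, d (algebraMap K F c) ∈ (algebraMap K F).range) {S : Set F}
    (hS : ∀ x ∈ S, d x ∈ IntermediateField.adjoin K S) {x : F}
    (hx : x ∈ IntermediateField.adjoin K S) : d x ∈ IntermediateField.adjoin K S := by
  induction hx using IntermediateField.adjoin_induction with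
  | mem x hx => exact hS x hx
  | algebraMap c =>
    obtain ⟨b, hb⟩ := hK c
    rw [← hb]
    exact (IntermediateField.adjoin K S).algebraMap_mem b
  | add x y _ _ hx hy => rw [map_add]; exact add_mem hx hy
  | inv x hx' hx =>
    rw [Derivation.leibniz_inv, smul_eq_mul]
    exact mul_mem (neg_mem (pow_mem (inv_mem hx') 2)) hx
  | mul x y hx' hy' hx hy =>
    rw [Derivation.leibniz]
    exact add_mem (mul_mem hx' hy) (mul_mem hy' hx)

theorem Derivation.eq_of_isTranscendenceBasis {K F σ : Type*} [Field K] [Field F] [CharZero F]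
    [Algebra K F] {y : σ → F} (hy : IsTranscendenceBasis K y) {d e : Derivation ℤ F F}
    (hK : ∀ c, d (algebraMap K F c) = e (algebraMap K F c)) (hde : ∀ i, d (y i) = e (y i)) :
    d = e := by
  ext x
  refine Derivation.eq_of_isAlgebraic (R := Algebra.adjoin K (Set.range y)) d e (fun r => ?_)
    (hy.isAlgebraic.1 x)
  obtain ⟨r, hr⟩ := r
  change d r = e r
  induction hr using Algebra.adjoin_induction with
  | mem x hx => obtain ⟨i, rfl⟩ := hx; exact hde i
  | algebraMap c => exact hK c
  | add x y _ _ hx hy => simp [hx, hy]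
  | mul x y _ _ hx hy => simp [hx, hy]

theorem Derivation.eq_zero_of_isAlgebraic_adjoin_simple {K F : Type*} [Field K] [Field F]
    [CharZero F] [Algebra K F] (d : Derivation ℤ F F) (hdK : ∀ c, d (algebraMap K F c) = 0) {a : F}
    (hda : d a = 0) {x : F} (hx : IsAlgebraic (IntermediateField.adjoin K {a}) x) : d x = 0 := by
  refine d.eq_zero_of_isAlgebraic (R := IntermediateField.adjoin K {a}) (fun r => ?_) hx
  obtain ⟨r, hr⟩ := r
  change d r = 0
  induction hr using IntermediateField.adjoin_induction with
  | mem x hx => rw [Set.mem_singleton_iff.1 hx]; exact hda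
  | algebraMap c => exact hdK c
  | add x y _ _ hx hy => rw [map_add, hx, hy, add_zero]
  | inv x hx' hx => rw [Derivation.leibniz_inv, hx, smul_zero]
  | mul x y hx' hy' hx hy => rw [Derivation.leibniz, hx, hy, smul_zero, smul_zero, add_zero]

section
open Polynomial

theorem exists_iterate_eq_zero_of_isTranscendenceBasis {K F : Type*} [Field K] [CharZero K]
    [Field F] [IsAlgClosed F] [Algebra K F] {y : Fin 2 → F} (hy : IsTranscendenceBasis K y)
    {i j : Fin 2} (hij : i ≠ j) {d : Derivation ℤ F F} (hdK : ∀ c, d (algebraMap K F c) = 0)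
    (hdi : d (y i) = 0) (hdj : d (y j) = 1) (D : Derivation ℤ F F) {ι : Type*} (s : Finset ι)
    (e : ι → ℕ) (δ : ι → Derivation ℤ F F) {t : K} {β : F}
    (hδK : ∀ l c, δ l (algebraMap K F c) ∈ (algebraMap K F).range)
    (hδi : ∀ l, δ l (y i) ∈ IntermediateField.adjoin K {y i})
    (hD : ∀ c, IsAlgebraic (IntermediateField.adjoin K {y i}) c →
      D c = ∑ l ∈ s, y j ^ e l * δ l c)
    (hDj : D (y j) = β) (hβ : β ∈ IntermediateField.adjoin K {y i})
    (htrans : ∀ ζ, IsAlgebraic (IntermediateField.adjoin K {y i}) ζ →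
      ∑ l ∈ s, ζ ^ e l * δ l ζ ≠ β) {v : F}
    (hv : D (D v) = 6 * v ^ 2 + algebraMap K F t) {q : MvPolynomial (Fin 2) K}
    (hq : (MvPolynomial.aeval (R := K) y).toRingHom.IsIntegralElem (MvPolynomial.aeval y q * v)) :
    ∃ n, d^[n] (MvPolynomial.aeval y q * v) = 0 := by
  set E := IntermediateField.adjoin K {y i} with hE
  have hyi : y i ∈ E := IntermediateField.mem_adjoin_simple_self K (y i)
  have : CharZero F := charZero_of_injective_algebraMap (algebraMap K F).injective
  let k := algebraicClosure E F
  have : IsAlgClosed k := (algebraicClosure.isAlgClosure E F).isAlgClosed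
  have hEk : ∀ a ∈ E, a ∈ k := fun a ha => k.algebraMap_mem (⟨a, ha⟩ : E)
  have hδE : ∀ l, ∀ a ∈ E, δ l a ∈ E := fun l a ha =>
    (δ l).map_mem_adjoin (hδK l) (fun x hx => by rw [Set.mem_singleton_iff.1 hx]; exact hδi l) ha
  choose δ' hδ' using fun l => (δ l).exists_algebraicClosure (E := E) fun a =>
    isAlgebraic_algebraMap (⟨δ l a, hδE l a a.2⟩ : E)
  have htr : Transcendental k (y j) := by
    refine Transcendental.algebraicClosure ?_
    have h1 : AlgebraicIndependent K ![y i, y j] := by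
      have := hy.1.comp ![i, j] (by
        intro a b hab
        fin_cases a <;> fin_cases b <;> simp_all)
      convert this using 1
      ext l; fin_cases l <;> rfl
    have h2 := (algebraicIndependent_pair_iff.1 h1).2
    rwa [hE, IntermediateField.transcendental_adjoin_iff]
  let : Algebra k[X] F := (aeval (R := k) (y j)).toRingHom.toAlgebra
  have hmap : ∀ p, algebraMap k[X] F p = aeval (y j) p := fun _ => rfl
  have : FaithfulSMul k[X] F := (faithfulSMul_iff_algebraMap_injective _ _).2
    (transcendental_iff_injective.1 htr)
  let g : MvPolynomial (Fin 2) K →+* k[X] := MvPolynomial.eval₂Hom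
    (C.comp ((algebraMap E k).comp (algebraMap K E)))
    fun l => if l = j then X else C ⟨y i, hEk _ hyi⟩
  have hg : (algebraMap k[X] F).comp g = (MvPolynomial.aeval (R := K) y).toRingHom := by
    refine MvPolynomial.ringHom_ext (fun c => ?_) fun l => ?_
    · simp [g, hmap]
    · simp only [RingHom.comp_apply, g, MvPolynomial.eval₂Hom_X', hmap]
      split_ifs with h
      · simp [h]
      · have : l = i := by omega
        simp [this]
  have halg : Algebra.IsAlgebraic k[X] F := by
    have := hy.isAlgebraic
    refine Algebra.IsAlgebraic.ringHom_of_comp_eq (R := Algebra.adjoin K (Set.range y))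
      (g.comp hy.1.aevalEquiv.symm.toAlgHom.toRingHom) (RingHom.id F) ?_ Function.surjective_id ?_
    · refine (RingHom.coe_comp _ _ ▸ Function.Injective.comp ?_ hy.1.aevalEquiv.symm.injective)
      refine Function.Injective.of_comp (f := algebraMap k[X] F) ?_
      rw [← RingHom.coe_comp, hg]
      exact hy.1
    · ext x
      refine (congr($hg (hy.1.aevalEquiv.symm x))).trans ?_
      change MvPolynomial.aeval y (hy.1.aevalEquiv.symm x) = (x : F)
      rw [← hy.1.algebraMap_aevalEquiv]
      simp
  have hmapC : ∀ c : k, algebraMap k[X] F (C c) = c := fun c => by rw [hmap, aeval_C]; rfl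
  have hdC : ∀ c : k, d (algebraMap k[X] F (C c)) = 0 := by
    intro c
    rw [hmapC]
    exact d.eq_zero_of_isAlgebraic_adjoin_simple hdK hdi (mem_algebraicClosure_iff.1 c.2)
  have hβk : β ∈ k := hEk _ hβ
  have hgq : algebraMap k[X] F (g q) = MvPolynomial.aeval y q := congr($hg q)
  rw [← hgq] at hq ⊢
  refine exists_iterate_d_eq_zero hdC (by rw [hmap, aeval_X, hdj]) D s e δ'
    (β := ⟨β, hβk⟩) (t := algebraMap E k (algebraMap K E t)) (fun c => ?_) ?_ (fun ζ h => ?_) ?_ ?_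
  · rw [hmapC, hD c (mem_algebraicClosure_iff.1 c.2)]
    refine Finset.sum_congr rfl fun l _ => ?_
    rw [map_mul, map_pow, hmapC, hδ', hmap, aeval_X]
  · rw [hmap, aeval_X, hDj, hmapC]
  · refine htrans ζ (mem_algebraicClosure_iff.1 ζ.2) ?_
    have := congr((($h : k) : F))
    simpa [hδ'] using this
  · rw [hv, hmapC]; rfl
  · obtain ⟨P, hP, hPv⟩ := hq
    refine ⟨P.map g, hP.map g, ?_⟩
    rw [eval₂_map, hg]
    exact hPv
end

theorem Derivation.iterate_succ_mul {F : Type*} [CommRing F] (d : Derivation ℤ F F) {x : F}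
    (hx : d x = 1) (w : F) (n : ℕ) :
    d^[n + 1] (x * w) = x * d^[n + 1] w + (n + 1) * d^[n] w := by
  induction n with
  | zero => simp [hx]
  | succ n ih =>
    rw [Function.iterate_succ_apply', ih, map_add, Derivation.leibniz, hx,
      ← Function.iterate_succ_apply' d, Derivation.leibniz, ← Function.iterate_succ_apply' d n,
      show d ((n : F) + 1) = 0 by simp]
    simp only [smul_eq_mul]
    push_cast
    ring

/-- An element killed by a power of a derivation `d` with `d x = 1` is a polynomial in `x` with
coefficients in the kernel of `d`. -/
theorem Derivation.mem_of_iterate_eq_zero {F : Type*} [Field F] [CharZero F] (d : Derivation ℤ F F)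
    {x : F} (hx : d x = 1) {V : AddSubgroup F} (hVx : ∀ v ∈ V, x * v ∈ V) (hVd : ∀ v ∈ V, d v ∈ V)
    {A : Subfield F} (hA : ∀ v ∈ V, d v = 0 → v ∈ A) (hxA : x ∈ A) (n : ℕ) :
    ∀ v ∈ V, d^[n + 1] v = 0 → v ∈ A := by
  induction n with
  | zero => exact hA
  | succ n ih =>
    intro v hv h
    have h1 : d v ∈ A := ih _ (hVd v hv) h
    have h2 : (n + 1) • v - x * d v ∈ A := by
      refine ih _ (sub_mem (nsmul_mem hv _) (hVx _ (hVd v hv))) ?_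
      rw [iterate_map_sub, iterate_map_nsmul, d.iterate_succ_mul hx,
        ← Function.iterate_succ_apply d, ← Function.iterate_succ_apply d, h, nsmul_eq_mul]
      push_cast; ring
    have h3 : (n + 1) • v ∈ A := by simpa using add_mem h2 (mul_mem hxA h1)
    have h0 : ((n + 1 : ℕ) : F) ≠ 0 := Nat.cast_ne_zero.2 n.succ_ne_zero
    rw [nsmul_eq_mul] at h3
    have h4 := mul_mem (inv_mem (natCast_mem A (n + 1))) h3
    rwa [inv_mul_cancel_left₀ h0] at h4

theorem IsTranscendenceBasis.isAlgebraic_of_derivation_eq_zero {K F : Type*} [Field K] [CharZero K]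
    [Field F] [Algebra K F] {y : Fin 2 → F} (hy : IsTranscendenceBasis K y)
    {d : Fin 2 → Derivation ℤ F F} (hdK : ∀ i c, d i (algebraMap K F c) = 0)
    (hd : ∀ i j, d i (y j) = if i = j then 1 else 0) {x : F} (hx : ∀ i, d i x = 0) :
    IsAlgebraic K x := by
  by_contra htr
  have : CharZero F := charZero_of_injective_algebraMap (algebraMap K F).injective
  obtain ⟨B, hxB, hB⟩ := exists_isTranscendenceBasis_superset (R := K) (s := {x})
    (algebraicIndependent_unique_type_iff.2 htr)
  obtain ⟨e, heK, hex⟩ := Derivation.exists_extend (0 : Derivation ℤ K F) hB fun _ => 1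
  have : e = e (y 0) • d 0 + e (y 1) • d 1 := by
    refine Derivation.eq_of_isTranscendenceBasis hy (fun c => ?_) fun i => ?_
    · simp [heK, hdK]
    · fin_cases i <;> simp [hd]
  have h1 := hex ⟨x, hxB rfl⟩
  rw [this] at h1
  simp [hx] at h1

theorem IsTranscendenceBasis.exists_isIntegralElem_mul {K F σ : Type*} [Field K]
    [Field F] [Algebra K F] {y : σ → F} (hy : IsTranscendenceBasis K y) (v : F) :
    ∃ q : MvPolynomial σ K, MvPolynomial.aeval y q ≠ 0 ∧
      (MvPolynomial.aeval (R := K) y).toRingHom.IsIntegralElem (MvPolynomial.aeval y q * v) := by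
  let : Algebra (MvPolynomial σ K) F := (MvPolynomial.aeval (R := K) y).toRingHom.toAlgebra
  have halg : Algebra.IsAlgebraic (MvPolynomial σ K) F := by
    have := hy.isAlgebraic
    refine Algebra.IsAlgebraic.ringHom_of_comp_eq (R := Algebra.adjoin K (Set.range y))
      hy.1.aevalEquiv.symm.toAlgHom.toRingHom (RingHom.id F) hy.1.aevalEquiv.symm.injective
      Function.surjective_id ?_
    ext x
    change MvPolynomial.aeval y (hy.1.aevalEquiv.symm x) = (x : F)
    rw [← hy.1.algebraMap_aevalEquiv]
    simp
  obtain ⟨q, hq0, hq⟩ := (halg.1 v).exists_integral_multiple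
  exact ⟨q, fun h => hq0 (hy.1.eq_zero_of_aeval_eq_zero q h), hq⟩

theorem algebraicIndependent_pair_comm {R A : Type*} [CommRing R] [CommRing A] [Algebra R A]
    {a b : A} : AlgebraicIndependent R ![a, b] ↔ AlgebraicIndependent R ![b, a] := by
  rw [← algebraicIndependent_equiv (Equiv.swap (0 : Fin 2) 1)]
  have : ![a, b] ∘ Equiv.swap (0 : Fin 2) 1 = ![b, a] := by
    ext i; fin_cases i <;> simp
  rw [this]

theorem exists_algebraMap_eq_of_isAlgebraic {K F : Type*} [Field K] [IsAlgClosed K] [Field F]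
    [Algebra K F] {x : F} (hx : IsAlgebraic K x) : ∃ c, algebraMap K F c = x := by
  obtain ⟨c, hc⟩ := (IsAlgClosed.algebraMap_bijective_of_isIntegral
    (k := K) (K := algebraicClosure K F)).2 ⟨x, mem_algebraicClosure_iff.2 hx⟩
  exact ⟨c, congr(($hc : F))⟩

/-- A solution algebraic over the field generated by a generic solution `Y` and its derivative is
rational over it. -/
theorem PainleveI.mem_adjoin_of_D_D_eq {K F : Type*} [Field K] [CharZero K] [IsAlgClosed K]
    [Field F] [IsAlgClosed F] [Algebra K F] {δ : Derivation ℤ K K} {t : K} (ht : δ t = 1)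
    {D : Derivation ℤ F F} (hD : ∀ a, D (algebraMap K F a) = algebraMap K F (δ a)) {Y Z : F}
    (hb : IsTranscendenceBasis K ![Y, Z]) (hY : D Y = Z)
    (hZ : D Z = 6 * Y ^ 2 + algebraMap K F t) {v : F}
    (hv : D (D v) = 6 * v ^ 2 + algebraMap K F t) :
    v ∈ IntermediateField.adjoin K {Y, Z} := by
  have : CharZero F := charZero_of_injective_algebraMap (algebraMap K F).injective
  have hind := algebraicIndependent_pair_iff.1 hb.1
  let δ₁ : Derivation ℤ K F := (Algebra.linearMap K F).compDer δ
  have hδ₁ : ∀ c, δ₁ c = algebraMap K F (δ c) := fun _ => rfl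
  obtain ⟨A, hAK, hA⟩ := Derivation.exists_extend δ₁ hb 0
  have hAY : A Y = 0 := hA 0
  have hAZ : A Z = 0 := hA 1
  obtain ⟨dY, hYK, hdY⟩ := Derivation.exists_extend (0 : Derivation ℤ K F) hb ![1, 0]
  obtain ⟨dZ, hZK, hdZ⟩ := Derivation.exists_extend (0 : Derivation ℤ K F) hb ![0, 1]
  have hYY : dY Y = 1 := hdY 0
  have hYZ : dY Z = 0 := hdY 1
  have hZY : dZ Y = 0 := hdZ 0
  have hZZ : dZ Z = 1 := hdZ 1
  simp only [Derivation.zero_apply] at hYK hZK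
  have hDeq : D = A + Z • dY + (6 * Y ^ 2 + algebraMap K F t) • dZ := by
    refine Derivation.eq_of_isTranscendenceBasis hb (fun c => ?_) fun i => ?_
    · simp [hD, hAK, hδ₁, hYK, hZK]
    · fin_cases i
      · simp [hY, hAY, hYY, hZY]
      · simp [hZ, hAZ, hYZ, hZZ]
  have hDapp : ∀ c, D c = A c + Z * dY c + (6 * Y ^ 2 + algebraMap K F t) * dZ c := fun c => by
    rw [hDeq]; simp
  obtain ⟨q, hq0, hq⟩ := hb.exists_isIntegralElem_mul v
  have hmemY : Y ∈ IntermediateField.adjoin K {Y} := IntermediateField.mem_adjoin_simple_self K Y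
  have hmemZ : Z ∈ IntermediateField.adjoin K {Z} := IntermediateField.mem_adjoin_simple_self K Z
  have h6 : ∀ E : IntermediateField K F, ∀ y ∈ E, 6 * y ^ 2 + algebraMap K F t ∈ E := fun E y hy =>
    add_mem (mul_mem (ofNat_mem E 6) (pow_mem hy 2)) (E.algebraMap_mem t)
  obtain ⟨n, hn⟩ : ∃ n, dZ^[n] (MvPolynomial.aeval ![Y, Z] q * v) = 0 := by
    refine exists_iterate_eq_zero_of_isTranscendenceBasis hb (i := 0) (j := 1) (by decide) hZK hZY
      hZZ D Finset.univ ![0, 1] ![A, dY] (fun l c => ?_) (fun l => ?_) (fun c hc => ?_) hZ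
      (h6 _ _ hmemY) (fun ζ hζ h => ?_) hv hq
    · fin_cases l
      · exact ⟨δ c, (hAK c).symm⟩
      · exact ⟨0, by simp [hYK]⟩
    · fin_cases l
      · simp [hAY]
      · simp [hYY]
    · rw [hDapp, dZ.eq_zero_of_isAlgebraic_adjoin_simple hZK hZY hc]
      simp [Fin.sum_univ_two]
    · simp only [Fin.sum_univ_two, Matrix.cons_val_zero, Matrix.cons_val_one, pow_zero, one_mul,
        pow_one] at h
      have := PainleveI.algebraicIndependent_of_transcendental ht (D := A + ζ • dY) (y := Y)
        (z := ζ)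
        (fun a => by simp [hAK, hδ₁, hYK]) (by simp [hAY, hYY]) (by simpa using h) hind.1
      exact (algebraicIndependent_pair_iff.1 this).2 (IntermediateField.isAlgebraic_adjoin_iff.1 hζ)
  obtain ⟨m, hm⟩ : ∃ m, dY^[m] (MvPolynomial.aeval ![Y, Z] q * v) = 0 := by
    refine exists_iterate_eq_zero_of_isTranscendenceBasis hb (i := 1) (j := 0) (by decide) hYK hYZ
      hYY D Finset.univ ![0, 2] ![A + algebraMap K F t • dZ, (6 : F) • dZ] (fun l c => ?_)
      (fun l => ?_) (fun c hc => ?_) hY hmemZ (fun η hη h => ?_) hv hq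
    · fin_cases l
      · exact ⟨δ c, by simp [hAK, hδ₁, hZK]⟩
      · exact ⟨0, by simp [hZK]⟩
    · fin_cases l
      · simp [hAZ, hZZ, ← Algebra.algebraMap_eq_smul_one]
      · simp [hZZ]
    · rw [hDapp, dY.eq_zero_of_isAlgebraic_adjoin_simple hYK hYZ hc]
      simp [Fin.sum_univ_two, Algebra.smul_def]
      ring
    · simp only [Fin.sum_univ_two, Matrix.cons_val_zero, Matrix.cons_val_one, pow_zero, one_mul,
        Derivation.add_apply, Derivation.coe_smul, Pi.smul_apply, smul_eq_mul] at h
      set B := A + (6 * η ^ 2 + algebraMap K F t) • dZ with hB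
      have hBK : ∀ a, B (algebraMap K F a) = algebraMap K F (δ a) := fun a => by
        simp [hB, hAK, hδ₁, hZK]
      have hBη : B η = Z := by rw [← h]; simp [hB]; ring
      by_cases htr : Transcendental K η
      · have := PainleveI.algebraicIndependent_of_transcendental ht hBK hBη
          (by simp [hB, hAZ, hZZ]) htr
        rw [algebraicIndependent_pair_comm] at this
        exact (algebraicIndependent_pair_iff.1 this).2
          (IntermediateField.isAlgebraic_adjoin_iff.1 hη)
      · obtain ⟨c, hc⟩ : ∃ c, algebraMap K F c = η :=
          exists_algebraMap_eq_of_isAlgebraic (not_not.1 htr)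
        refine hb.1.transcendental 1 ?_
        simp only [Matrix.cons_val_one]
        rw [← hBη, ← hc, hBK]
        exact isAlgebraic_algebraMap _
  set E := IntermediateField.adjoin K {Y, Z} with hE
  have hYE : Y ∈ E := IntermediateField.subset_adjoin K _ (by simp)
  have hZE : Z ∈ E := IntermediateField.subset_adjoin K _ (by simp)
  have hcomm : Function.Commute dY dZ := by
    have : ⁅dY, dZ⁆ = 0 := by
      refine Derivation.eq_of_isTranscendenceBasis hb (fun c => ?_) fun i => ?_
      · simp [Derivation.commutator_apply, hYK, hZK]
      · fin_cases i <;> simp [Derivation.commutator_apply, hYY, hYZ, hZY, hZZ]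
    intro x
    have := congr($this x)
    rwa [Derivation.commutator_apply, Derivation.zero_apply, sub_eq_zero] at this
  have hconst : ∀ x, dZ x = 0 → dY x = 0 → x ∈ E := by
    intro x h1 h0
    have hx : IsAlgebraic K x := by
      refine hb.isAlgebraic_of_derivation_eq_zero (d := ![dY, dZ]) (fun i c => ?_) (fun i j => ?_)
        fun i => ?_
      · fin_cases i
        exacts [hYK c, hZK c]
      · fin_cases i <;> fin_cases j <;> simp [hYY, hYZ, hZY, hZZ]
      · fin_cases i
        exacts [h0, h1]
    obtain ⟨c, rfl⟩ := exists_algebraMap_eq_of_isAlgebraic hx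
    exact E.algebraMap_mem c
  have hker : ∀ x, dZ x = 0 → ∀ m, dY^[m] x = 0 → x ∈ E := by
    intro x hx m hm
    refine dY.mem_of_iterate_eq_zero hYY (V := (dZ : F →+ F).ker) (A := E.toSubfield)
      (fun w hw => ?_) (fun w hw => ?_) (fun w hw => hconst w hw) hYE m x hx
      (by rw [Function.iterate_succ_apply', hm, map_zero])
    · change dZ _ = 0
      rw [Derivation.leibniz, hZY, show dZ w = 0 from hw]; simp
    · change dZ _ = 0
      rw [← hcomm, show dZ w = 0 from hw, map_zero]
  have hmul : ∀ m w, dY^[m] (Z * w) = Z * dY^[m] w := by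
    intro m w
    induction m with
    | zero => rfl
    | succ m ih => rw [Function.iterate_succ_apply', ih, Derivation.leibniz, hYZ,
        Function.iterate_succ_apply']; simp
  let V : AddSubgroup F :=
    { carrier := {x | dY^[m] x = 0}
      zero_mem' := iterate_map_zero dY m
      add_mem' := fun {a b} ha hb => by
        rw [Set.mem_ofPred_eq] at *
        rw [iterate_map_add, ha, hb, add_zero]
      neg_mem' := fun {a} ha => by
        rw [Set.mem_ofPred_eq] at *
        rw [iterate_map_neg, ha, neg_zero] }
  have hw : MvPolynomial.aeval ![Y, Z] q * v ∈ E := by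
    refine dZ.mem_of_iterate_eq_zero hZZ (V := V) (A := E.toSubfield)
      (fun w hw => ?_) (fun w hw => ?_) (fun w hw h => ?_) hZE n _ ?_
      (by rw [Function.iterate_succ_apply', hn, map_zero])
    · change dY^[m] _ = 0
      rw [hmul, show dY^[m] w = 0 from hw, mul_zero]
    · change dY^[m] _ = 0
      rw [(hcomm.iterate_left m).eq, show dY^[m] w = 0 from hw, map_zero]
    · exact hker w h m hw
    · exact hm
  have hqE : MvPolynomial.aeval ![Y, Z] q ∈ E := by
    have h1 : MvPolynomial.aeval ![Y, Z] q ∈ Algebra.adjoin K (Set.range ![Y, Z]) := by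
      rw [Algebra.adjoin_range_eq_range_aeval]
      exact ⟨q, rfl⟩
    refine (Algebra.adjoin_le (S := E.toSubalgebra) ?_) h1
    rintro _ ⟨i, rfl⟩
    fin_cases i
    exacts [hYE, hZE]
  have := mul_mem (inv_mem hqE) hw
  rwa [inv_mul_cancel_left₀ hq0] at this

theorem IntermediateField.mem_adjoin_coe_iff {K F : Type*} [Field K] [Field F] [Algebra K F]
    {N : IntermediateField K F} {a b x : N} :
    (x : F) ∈ IntermediateField.adjoin K {(a : F), (b : F)} ↔
      x ∈ IntermediateField.adjoin K {a, b} := by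
  have h : (IntermediateField.adjoin K {a, b}).map N.val =
      IntermediateField.adjoin K {(a : F), (b : F)} := by
    rw [IntermediateField.adjoin_map, Set.image_pair]; rfl
  rw [← h, IntermediateField.mem_map]
  exact ⟨fun ⟨y, hy, hyx⟩ => (Subtype.ext hyx : y = x) ▸ hy, fun hx => ⟨x, hx, rfl⟩⟩

namespace PainleveI

theorem eq_of_isTranscendenceBasis {K F : Type*} [Field K] [CharZero K] [IsAlgClosed K]
    [Field F] [IsAlgClosed F] [Algebra K F] {δ : Derivation ℤ K K} {t : K} (ht : δ t = 1)
    {D : Derivation ℤ F F} (hD : ∀ a, D (algebraMap K F a) = algebraMap K F (δ a)) {u v : F}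
    (hb : IsTranscendenceBasis K ![u, D u]) (hu : D (D u) = 6 * u ^ 2 + algebraMap K F t)
    (hv : D (D v) = 6 * v ^ 2 + algebraMap K F t) (htr : Transcendental K v) : v = u := by
  have hiv := algebraicIndependent_of_transcendental ht hD rfl hv htr
  have hbv : IsTranscendenceBasis K ![v, D v] := by
    refine hiv.isTranscendenceBasis_of_lift_trdeg_le_of_finite ?_
    rw [← hb.lift_cardinalMk_eq_trdeg]
  have h1 : v ∈ IntermediateField.adjoin K {u, D u} := mem_adjoin_of_D_D_eq ht hD hb rfl hu hv
  have h2 : u ∈ IntermediateField.adjoin K {v, D v} := mem_adjoin_of_D_D_eq ht hD hbv rfl hv hu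
  have stable : ∀ w, D (D w) = 6 * w ^ 2 + algebraMap K F t →
      ∀ x ∈ IntermediateField.adjoin K {w, D w}, D x ∈ IntermediateField.adjoin K {w, D w} := by
    intro w hw x hx
    refine D.map_mem_adjoin (fun a => ⟨δ a, (hD a).symm⟩) ?_ hx
    set E := IntermediateField.adjoin K {w, D w} with hE
    have hwE : w ∈ E := IntermediateField.subset_adjoin K _ (by simp)
    rintro x (rfl | rfl)
    · exact IntermediateField.subset_adjoin K _ (by simp)
    · rw [hw]
      exact add_mem (mul_mem (ofNat_mem E 6) (pow_mem hwE 2)) (E.algebraMap_mem t)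
  set N := IntermediateField.adjoin K {u, D u} with hN
  have huN : u ∈ N := IntermediateField.subset_adjoin K _ (by simp)
  let Y : N := ⟨u, huN⟩
  let Z : N := ⟨D u, stable u hu u huN⟩
  let V : N := ⟨v, h1⟩
  let V' : N := ⟨D v, stable u hu v h1⟩
  have htop : IntermediateField.adjoin K {Y, Z} = ⊤ := by
    refine top_unique fun x _ => ?_
    rw [← IntermediateField.mem_adjoin_coe_iff]
    exact x.2
  have hi : AlgebraicIndependent K ![Y, Z] := by
    refine AlgebraicIndependent.of_comp N.val ?_
    convert hb.1 using 1
    ext i; fin_cases i <;> rfl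
  obtain ⟨M, hMY, hMZ⟩ := PainleveModel.exists_of_algebraicIndependent δ t hi htop
  have hM : ∀ x, ((M.D x : N) : F) = D x := by
    refine Derivation.map_comp_eq_of_adjoin_eq_top (algebraMap N F) M.D D htop (fun a => ?_)
      fun x hx => ?_
    · rw [M.D_map]
      exact (hD a).symm
    · rcases hx with rfl | rfl
      · rw [← hMY, M.D_Y, hMZ, hMY]; rfl
      · rw [← hMZ, M.D_Z, hMZ, hMY]
        refine Eq.trans ?_ hu.symm
        rfl
  have hMV : M.D V = V' := Subtype.ext (hM V)
  have := M.eq_Y_of_D_D_eq ht (v := V) (Subtype.ext ?_) ?_ ?_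
  · rw [hMY] at this
    exact congr(($this : F))
  · rw [hM, hM]
    exact hv
  · rw [hMV, hMY, ← IntermediateField.mem_adjoin_coe_iff]
    exact h2
  · rw [hMV, hMZ, ← IntermediateField.mem_adjoin_coe_iff]
    exact stable v hv u h2

end PainleveI

namespace PainleveI

theorem algebraicIndependent_option_of_isAlgClosed {K F : Type*} [Field K] [CharZero K]
    [IsAlgClosed K] [Field F] [IsAlgClosed F] [Algebra K F] {δ : Derivation ℤ K K} {t : K}
    (ht : δ t = 1) {D : Derivation ℤ F F} (hD : ∀ a, D (algebraMap K F a) = algebraMap K F (δ a))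
    {u v : F} (hu : D (D u) = 6 * u ^ 2 + algebraMap K F t)
    (hv : D (D v) = 6 * v ^ 2 + algebraMap K F t) (hut : Transcendental K u)
    (hvt : Transcendental K v) (huv : v ≠ u) :
    AlgebraicIndependent K fun o : Option (Fin 2) => o.elim v ![u, D u] := by
  have hi := algebraicIndependent_of_transcendental ht hD rfl hu hut
  rw [hi.option_iff_transcendental]
  intro hvalg
  set E := IntermediateField.adjoin K (Set.range ![u, D u]) with hE
  have hEu : u ∈ E := IntermediateField.subset_adjoin K _ ⟨0, rfl⟩
  have hEu' : D u ∈ E := IntermediateField.subset_adjoin K _ ⟨1, rfl⟩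
  have hDE : ∀ a ∈ E, D a ∈ E := by
    refine fun x hx => D.map_mem_adjoin (fun a => ⟨δ a, (hD a).symm⟩) ?_ hx
    rintro _ ⟨i, rfl⟩
    fin_cases i
    · exact hEu'
    · change D (D u) ∈ E
      rw [hu]
      exact add_mem (mul_mem (ofNat_mem E 6) (pow_mem hEu 2)) (E.algebraMap_mem t)
  let H := algebraicClosure E F
  obtain ⟨D', hD'⟩ := D.exists_algebraicClosure (E := E) fun a =>
    isAlgebraic_algebraMap (⟨D a, hDE a a.2⟩ : E)
  have : IsAlgClosed H := (algebraicClosure.isAlgClosure E F).isAlgClosed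
  have hEH : ∀ a ∈ E, a ∈ H := fun a ha => H.algebraMap_mem (⟨a, ha⟩ : E)
  let φ : H →ₐ[K] F := H.val.restrictScalars K
  let U : H := ⟨u, hEH u hEu⟩
  have hDU : ((D' U : H) : F) = D u := hD' U
  let V : H := ⟨v, mem_algebraicClosure_iff.2 (IntermediateField.isAlgebraic_adjoin_iff.2 hvalg)⟩
  have hiU : AlgebraicIndependent K ![U, D' U] := by
    refine AlgebraicIndependent.of_comp φ ?_
    convert hi using 1
    ext i; fin_cases i
    · rfl
    · exact hDU
  have hb : IsTranscendenceBasis K ![U, D' U] := by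
    rw [hiU.isTranscendenceBasis_iff_isAlgebraic]
    refine ⟨fun x => ?_⟩
    by_contra hx
    have h1 := ((hiU.option_iff_transcendental x).2 hx).map' (f := φ) Subtype.val_injective
    have h2 : φ ∘ (fun o : Option (Fin 2) => o.elim x ![U, D' U]) =
        fun o => o.elim (x : F) ![u, D u] := by
      ext o
      rcases o with _ | i
      · rfl
      · fin_cases i
        · rfl
        · exact hDU
    rw [h2, hi.option_iff_transcendental] at h1
    exact h1 (IntermediateField.isAlgebraic_adjoin_iff.1 (mem_algebraicClosure_iff.1 x.2))
  have hVU : V = U := by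
    refine eq_of_isTranscendenceBasis ht (D := D') (fun a => ?_) hb ?_ ?_ ?_
    · exact Subtype.ext ((hD' _).trans (hD a))
    · exact Subtype.ext ((hD' _).trans (hDU ▸ hu))
    · exact Subtype.ext ((hD' _).trans ((congrArg D (hD' V)).trans hv))
    · intro h
      exact hvt (h.algHom φ)
  exact huv (congrArg Subtype.val hVU)

variable {K L : Type*} [Field K] [CharZero K] [Field L] [Algebra K L] {D : Derivation ℤ L L}
  (hD : ∀ a, D (algebraMap K L a) ∈ (algebraMap K L).range) {t : K}
  (ht : D (algebraMap K L t) = 1)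

include hD ht

theorem algebraicIndependent_pair_and_option {u : L}
    (hu : D (D u) = 6 * u ^ 2 + algebraMap K L t) (hut : Transcendental K u) :
    AlgebraicIndependent K ![u, D u] ∧
      ∀ v, D (D v) = 6 * v ^ 2 + algebraMap K L t → Transcendental K v → v ≠ u →
        AlgebraicIndependent K fun o : Option (Fin 2) => o.elim v ![u, D u] := by
  have : CharZero L := charZero_of_injective_algebraMap (algebraMap K L).injective
  let F := AlgebraicClosure L
  have : CharZero F := charZero_of_injective_algebraMap (algebraMap L F).injective
  have : Algebra.FormallyEtale L F := Algebra.FormallyEtale.of_isSeparable _ _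
  obtain ⟨D', hD'⟩ := Derivation.exists_extend_of_formallyEtale
    ((Algebra.linearMap L F).compDer D)
  replace hD' : ∀ a, D' (algebraMap L F a) = algebraMap L F (D a) := hD'
  let K' := algebraicClosure K F
  have : IsAlgClosed K' := (algebraicClosure.isAlgClosure K F).isAlgClosed
  obtain ⟨δ, hδ⟩ := D'.exists_algebraicClosure (E := K) fun a => by
    obtain ⟨b, hb⟩ := hD a
    rw [IsScalarTower.algebraMap_apply K L F, hD', ← hb, ← IsScalarTower.algebraMap_apply]
    exact isAlgebraic_algebraMap b
  have ht' : δ (algebraMap K K' t) = 1 := by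
    refine Subtype.ext ((hδ _).trans ?_)
    change D' (algebraMap K F t) = 1
    rw [IsScalarTower.algebraMap_apply K L F, hD', ht, map_one]
  have htr : ∀ w : L, Transcendental K w → Transcendental K' (algebraMap L F w) := fun w hw =>
    Transcendental.algebraicClosure
      (mt (isAlgebraic_algebraMap_iff (algebraMap L F).injective).1 hw)
  have hsol : ∀ w : L, D (D w) = 6 * w ^ 2 + algebraMap K L t →
      D' (D' (algebraMap L F w)) = 6 * algebraMap L F w ^ 2 +
        algebraMap K' F (algebraMap K K' t) := by
    intro w hw
    rw [hD', hD', hw, map_add, map_mul, map_pow, map_ofNat,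
      ← IsScalarTower.algebraMap_apply, ← IsScalarTower.algebraMap_apply]
  let φ : L →ₐ[K] F := IsScalarTower.toAlgHom K L F
  refine ⟨?_, fun v hv hvt huv => ?_⟩
  · have h1 := algebraicIndependent_of_transcendental ht' (D := D') (fun a => (hδ a).symm) rfl
      (hsol u hu) (htr u hut)
    refine AlgebraicIndependent.of_comp φ ?_
    convert h1.restrictScalars (algebraMap K K').injective using 1
    ext i; fin_cases i
    · rfl
    · exact (hD' u).symm
    rfl
  · have h1 := algebraicIndependent_option_of_isAlgClosed ht' (D := D') (fun a => (hδ a).symm)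
      (hsol u hu) (hsol v hv) (htr u hut) (htr v hvt) fun h => huv ((algebraMap L F).injective h)
    refine AlgebraicIndependent.of_comp φ ?_
    convert h1.restrictScalars (algebraMap K K').injective using 1
    ext o
    rcases o with _ | i
    · rfl
    · fin_cases i
      · rfl
      · exact (hD' u).symm
    rfl

end PainleveI

namespace PainleveI

theorem algebraicIndependent_sumElim_of_transcendental.{v} {L : Type v} [Field L]
    {D : Derivation ℤ L L} {T : L} (hT : D T = 1) (n : ℕ) :
    ∀ (K : Type v) [Field K] [CharZero K] [Algebra K L]
      (_ : ∀ a, D (algebraMap K L a) ∈ (algebraMap K L).range) (_ : T ∈ (algebraMap K L).range)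
      (y : Fin n → L) (_ : Function.Injective y) (_ : ∀ i, D (D (y i)) = 6 * y i ^ 2 + T)
      (_ : ∀ i, Transcendental K (y i)),
      AlgebraicIndependent K (Sum.elim y fun i => D (y i)) := by
  induction n with
  | zero =>
    intro K _ _ _ _ _ y _ _ _
    rw [algebraicIndependent_empty_type_iff]
    exact (algebraMap K L).injective
  | succ n ih =>
    intro K _ _ _ hD ⟨t, ht⟩ y hy hsol htr
    subst ht
    obtain ⟨hx, hopt⟩ := algebraicIndependent_pair_and_option hD hT (hsol 0) (htr 0)
    set x := ![y 0, D (y 0)] with hxdef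
    let E := IntermediateField.adjoin K (Set.range x)
    have hE0 : y 0 ∈ E := IntermediateField.subset_adjoin K _ ⟨0, rfl⟩
    have hE1 : D (y 0) ∈ E := IntermediateField.subset_adjoin K _ ⟨1, rfl⟩
    have hDE : ∀ a ∈ E, D a ∈ E := by
      refine fun a ha => D.map_mem_adjoin hD ?_ ha
      rintro _ ⟨i, rfl⟩
      fin_cases i
      · exact hE1
      · change D (D (y 0)) ∈ E
        rw [hsol]
        exact add_mem (mul_mem (ofNat_mem E 6) (pow_mem hE0 2)) (E.algebraMap_mem t)
    have : CharZero E := charZero_of_injective_algebraMap (algebraMap K E).injective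
    have hrest := ih E (fun a => ⟨⟨D a, hDE a a.2⟩, rfl⟩)
      ⟨⟨_, E.algebraMap_mem t⟩, rfl⟩ (fun i => y i.succ)
      (fun i j h => Fin.succ_injective n (hy h)) (fun i => hsol _) fun i => by
        have h1 := hopt (y i.succ) (hsol _) (htr _) fun h => Fin.succ_ne_zero i (hy h)
        rw [hx.option_iff_transcendental] at h1
        exact IntermediateField.transcendental_adjoin_iff.2 h1
    have hall := AlgebraicIndependent.sumElim_iff.2
      ⟨hx, IntermediateField.algebraicIndependent_adjoin_iff.1 hrest⟩
    let f : Fin (n + 1) ⊕ Fin (n + 1) → (Fin n ⊕ Fin n) ⊕ Fin 2 :=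
      Sum.elim (Fin.cases (Sum.inr 0) fun i => Sum.inl (Sum.inl i))
        (Fin.cases (Sum.inr 1) fun i => Sum.inl (Sum.inr i))
    have hf : Function.Injective f := by
      rintro (i | i) (j | j) <;> refine Fin.cases ?_ (fun i => ?_) i <;>
        refine Fin.cases ?_ (fun j => ?_) j <;> simp [f]
    convert hall.comp f hf using 1
    ext (i | i) <;> refine Fin.cases ?_ (fun i => ?_) i <;> simp [f, hxdef]

end PainleveI

/-- Nishioka's theorem (Fact 3.3): if `y₁, …, yₙ` are pairwise distinct solutions of the
first Painlevé equation `y'' = 6y² + t`, none of which is algebraic over the differential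
subfield `K`, then `y₁, y₁', …, yₙ, yₙ'` are algebraically independent over `K`. -/
theorem painleveI_solutions_algebraically_independent
    (L : Type*) [Field L] [Algebra ℂ L]
    (D : L → L)
    (hD_add : ∀ a b : L, D (a + b) = D a + D b)
    (hD_mul : ∀ a b : L, D (a * b) = a * D b + b * D a)
    (hD_const : ∀ c : ℂ, D (algebraMap ℂ L c) = 0)
    (t : L) (hDt : D t = 1)
    (K : Subfield L)
    (hK_const : ∀ c : ℂ, algebraMap ℂ L c ∈ K)
    (hK_t : t ∈ K)
    (hK_D : ∀ a ∈ K, D a ∈ K)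
    (n : ℕ) (hn : 1 ≤ n)
    (y : Fin n → L)
    (hdistinct : ∀ i j : Fin n, i ≠ j → y i ≠ y j)
    (hsol : ∀ i : Fin n, D (D (y i)) = 6 * (y i) ^ 2 + t)
    (halg : ∀ i : Fin n, ¬ IsAlgebraic K (y i)) :
    AlgebraicIndependent K (Sum.elim y (fun i => D (y i))) := by
  have : CharZero L := charZero_of_injective_algebraMap (algebraMap ℂ L).injective
  let δ : Derivation ℤ L L :=
    Derivation.mk' (AddMonoidHom.mk' D hD_add).toIntLinearMap hD_mul
  exact PainleveI.algebraicIndependent_sumElim_of_transcendental (D := δ) hDt n K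
    (fun a => ⟨⟨D a, hK_D a a.2⟩, rfl⟩) ⟨⟨t, hK_t⟩, rfl⟩ y
    (fun i j h => by_contra fun hij => hdistinct i j hij h) hsol halg
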